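/- arXiv:math/9810169 — 4 statements merged into one kernel-verified Lean document; each statement's English description precedes it below -/
import Mathlib

section
/- Given N pairwise distinct complex numbers z₁, …, z_N and arbitrary complex values a₁, …, a_N, there exists a smooth compactly supported function g : (0,∞) → ℂ whose Mellin transform satisfies ĝ(z_i) = a_i for all i = 1, …, N. -/
open Complex Set

open MeasureTheory in
/-- The Mellin transform of a continuous function with compact support in `(0,∞)` converges
everywhere. -/
theorem mellinConvergent_of_hasCompactSupport {g : ℝ → ℂ} (hg : Continuous g)
    (hc : HasCompactSupport g) (hs : tsupport g ⊆ Ioi 0) (s : ℂ) : MellinConvergent g s := by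
  have hcont : ContinuousOn (fun t : ℝ => (t : ℂ) ^ (s - 1) • g t) (tsupport g) := by
    refine ContinuousOn.smul (f := fun t : ℝ => (t : ℂ) ^ (s - 1)) (fun t ht => ?_) hg.continuousOn
    exact (continuousAt_ofReal_cpow_const t (s - 1)
      (Or.inr (ne_of_gt (hs ht)))).continuousWithinAt
  refine ((integrableOn_iff_integrable_of_support_subset ?_).mp
    (hcont.integrableOn_compact hc)).integrableOn
  exact (Function.support_smul_subset_right (fun t : ℝ => (t : ℂ) ^ (s - 1)) g).trans
    (subset_tsupport g)

/-- The characters `t ↦ exp (z t)` of the additive group of `ℝ`. -/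
noncomputable def expCharacter (z : ℂ) : Multiplicative ℝ →* ℂ where
  toFun t := exp (z * (t.toAdd : ℝ))
  map_one' := by simp
  map_mul' x y := by simp [mul_add, exp_add]

theorem expCharacter_injective : Function.Injective expCharacter := by
  intro z w h
  have hd : ∀ z : ℂ, HasDerivAt (fun t : ℝ => exp (z * (t : ℂ))) z 0 := fun z => by
    simpa using ((hasDerivAt_id (0 : ℝ)).ofReal_comp.const_mul z).cexp
  refine (hd z).unique ?_
  have hfun : (fun t : ℝ => exp (z * (t : ℂ))) = fun t : ℝ => exp (w * (t : ℂ)) :=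
    funext fun t => DFunLike.congr_fun h (Multiplicative.ofAdd t)
  exact hfun ▸ hd w

/-- Distinct complex powers are linearly independent on `(0,∞)`. -/
theorem eq_zero_of_sum_mul_cpow_eq_zero {N : ℕ} {z : Fin N → ℂ} (hz : Function.Injective z)
    {c : Fin N → ℂ} (h : ∀ u : ℝ, 0 < u → ∑ i, c i * (u : ℂ) ^ (z i - 1) = 0) : c = 0 := by
  have hli := (linearIndependent_monoidHom (Multiplicative ℝ) ℂ).comp (fun i => expCharacter (z i))
    (expCharacter_injective.comp hz)
  rw [Fintype.linearIndependent_iff] at hli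
  refine funext (hli c (funext fun t => ?_))
  have hu := h (Real.exp t.toAdd) (Real.exp_pos _)
  have hterm : ∀ i, c i * expCharacter (z i) t =
      (c i * ((Real.exp t.toAdd : ℝ) : ℂ) ^ (z i - 1)) * exp (t.toAdd : ℝ) := fun i => by
    have hne : ((Real.exp t.toAdd : ℝ) : ℂ) ≠ 0 := ofReal_ne_zero.mpr (Real.exp_pos _).ne'
    rw [cpow_def_of_ne_zero hne, ← ofReal_log (Real.exp_pos _).le, Real.log_exp, mul_assoc,
      ← exp_add]
    change c i * exp (z i * _) = _
    congr 2
    ring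
  simp only [Finset.sum_apply, Pi.smul_apply, Function.comp_apply, smul_eq_mul, Pi.zero_apply,
    hterm, ← Finset.sum_mul, hu, zero_mul]

/-- The tuples of values at `z` of Mellin transforms of smooth functions with compact support in
`(0,∞)`. -/
noncomputable def mellinValues {N : ℕ} (z : Fin N → ℂ) : Submodule ℂ (Fin N → ℂ) where
  carrier := {a | ∃ g : ℝ → ℂ, ContDiff ℝ (⊤ : ℕ∞) g ∧ HasCompactSupport g ∧
    tsupport g ⊆ Ioi 0 ∧ ∀ i, mellin g (z i) = a i}
  zero_mem' := ⟨0, contDiff_const, HasCompactSupport.zero, by simp [tsupport],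
    fun i => by simp [mellin]⟩
  add_mem' := by
    rintro a b ⟨f, hf, hfc, hfs, hfa⟩ ⟨g, hg, hgc, hgs, hgb⟩
    refine ⟨f + g, hf.add hg, hfc.add hgc, (tsupport_add f g).trans (union_subset hfs hgs),
      fun i => ?_⟩
    rw [Pi.add_apply, ← hfa i, ← hgb i]
    exact (hasMellin_add (mellinConvergent_of_hasCompactSupport hf.continuous hfc hfs _)
      (mellinConvergent_of_hasCompactSupport hg.continuous hgc hgs _)).2
  smul_mem' := by
    rintro k a ⟨g, hg, hgc, hgs, hga⟩
    refine ⟨fun t => k • g t, hg.const_smul k, hgc.smul_left (f := fun _ => k),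
      (tsupport_smul_subset_right (fun _ => k) g).trans hgs, fun i => ?_⟩
    rw [mellin_const_smul, hga i, Pi.smul_apply]

open MeasureTheory in
theorem mellinValues_eq_top {N : ℕ} {z : Fin N → ℂ} (hz : Function.Injective z) :
    mellinValues z = ⊤ := by
  by_contra hne
  obtain ⟨φ, hφ, hker⟩ := Submodule.exists_le_ker_of_lt_top _ (lt_top_iff_ne_top.mpr hne)
  set c : Fin N → ℂ := fun i => φ (Pi.single i 1) with hc
  have happly : ∀ a, φ a = ∑ i, a i * c i := fun a => by
    rw [LinearMap.pi_apply_eq_sum_univ φ a]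
    simp only [hc, smul_eq_mul]
    refine Finset.sum_congr rfl fun i _ => congrArg (fun v => a i * φ v) (funext fun j => ?_)
    simp [Pi.single_apply, eq_comm]
  have hcont : ContinuousOn (fun u : ℝ => ∑ i, c i * (u : ℂ) ^ (z i - 1)) (Ioi 0) := by
    refine continuousOn_finsetSum _ fun i _ => continuousOn_const.mul fun u hu => ?_
    exact (continuousAt_ofReal_cpow_const u _ (Or.inr (ne_of_gt hu))).continuousWithinAt
  have hae := isOpen_Ioi.ae_eq_zero_of_integral_contDiff_smul_eq_zero (μ := volume)
    (hcont.locallyIntegrableOn measurableSet_Ioi) (fun g hg hgc hgs => ?_)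
  · have hzero : EqOn (fun u : ℝ => ∑ i, c i * (u : ℂ) ^ (z i - 1)) (fun _ => 0) (Ioi 0) :=
      Measure.eqOn_open_of_ae_eq ((ae_restrict_iff' measurableSet_Ioi).mpr hae) isOpen_Ioi hcont
        continuousOn_const
    have hc0 := eq_zero_of_sum_mul_cpow_eq_zero hz (fun u hu => hzero hu)
    exact hφ (LinearMap.ext fun a => by simp [happly, hc0])
  · set G : ℝ → ℂ := fun t => (g t : ℂ) with hG
    have hGd : ContDiff ℝ (⊤ : ℕ∞) G := ofRealCLM.contDiff.comp hg
    have hGc : HasCompactSupport G := hgc.comp_left (g := ofReal) rfl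
    have hGs : tsupport G ⊆ Ioi 0 :=
      (closure_mono (Function.support_comp_subset (g := ofReal) rfl g)).trans hgs
    have hmem : (fun i => mellin G (z i)) ∈ mellinValues z := ⟨G, hGd, hGc, hGs, fun _ => rfl⟩
    have hφ0 := (happly _).symm.trans (hker hmem)
    rw [← hφ0, ← setIntegral_eq_integral_of_forall_compl_eq_zero (s := Ioi (0 : ℝ))
      (fun u hu => by rw [image_eq_zero_of_notMem_tsupport (fun h => hu (hgs h)), zero_smul])]
    have hconv := fun i => mellinConvergent_of_hasCompactSupport hGd.continuous hGc hGs (z i)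
    simp only [mellin]
    simp_rw [← integral_mul_const]
    rw [← integral_finsetSum _ fun i _ => Integrable.mul_const (hconv i) (c i)]
    refine integral_congr_ae (Filter.Eventually.of_forall fun u => ?_)
    simp only [real_smul, Finset.mul_sum, smul_eq_mul, hG]
    exact Finset.sum_congr rfl fun i _ => by ring

/-- Given `N` pairwise distinct complex numbers `z₁, …, z_N` and arbitrary complex values
`a₁, …, a_N`, there exists a smooth compactly supported function `g` on `(0,∞)` whose
Mellin transform satisfies `ĝ(zᵢ) = aᵢ` for all `i`. -/
theorem exists_smooth_compactly_supported_mellin_interpolation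
    (N : ℕ) (z : Fin N → ℂ) (hz : Function.Injective z) (a : Fin N → ℂ) :
    ∃ g : ℝ → ℂ, ContDiff ℝ (⊤ : ℕ∞) g ∧ HasCompactSupport g ∧ tsupport g ⊆ Ioi 0 ∧
      ∀ i, mellin g (z i) = a i := by
  have ha : a ∈ mellinValues z := mellinValues_eq_top hz ▸ Submodule.mem_top
  exact ha
end

section
/- Let ε > 0 and let g : (0,∞) → ℂ satisfy conditions (A_ε) and (B). Then for every c with 1 < c < 1+ε, the double sum ∑_p log(p) ∑_{k ≥ 1} g(p^k) (over primes p and integers k ≥ 1) converges absolutely, the limit lim_{T→∞} (1/2πi) ∫_{c−iT}^{c+iT} (−ζ′(s)/ζ(s))·ĝ(s) ds exists, and it equals ∑_p log(p) ∑_{k ≥ 1} g(p^k), where ζ is the Riemann zeta function. -/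
open Complex MeasureTheory Set Filter intervalIntegral

open scoped Real

open Topology in
theorem integral_sinc_eq (R : ℝ) (hR : 0 ≤ R) :
    ∫ x in (0 : ℝ)..R, Real.sinc x =
      ∫ t in Ioi (0 : ℝ), (1 - Real.exp (-(R * t)) * (Real.cos R + t * Real.sin R)) *
        (1 + t ^ 2)⁻¹ := by
  have laplace : ∀ x : ℝ, 0 < x → ∫ t in Ioi (0 : ℝ), Real.exp (-(x * t)) = x⁻¹ := by
    intro x hx
    have := integral_exp_mul_Ioi (a := -x) (by linarith) 0
    simpa [neg_mul] using this
  have inner : ∀ t : ℝ, ∫ x in (0 : ℝ)..R, Real.sin x * Real.exp (-(x * t)) =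
      (1 - Real.exp (-(R * t)) * (Real.cos R + t * Real.sin R)) * (1 + t ^ 2)⁻¹ := by
    intro t
    have hpos : (1 + t ^ 2) ≠ 0 := by positivity
    rw [integral_eq_sub_of_hasDerivAt
      (f := fun x ↦ -(Real.exp (-(x * t)) * (Real.cos x + t * Real.sin x)) * (1 + t ^ 2)⁻¹)]
    · simp; ring
    · intro x _
      have h1 : HasDerivAt (fun x : ℝ ↦ Real.exp (-(x * t))) (Real.exp (-(x * t)) * (-(1 * t))) x :=
        ((hasDerivAt_id x).mul_const t).neg.exp
      have h2 := (Real.hasDerivAt_cos x).add ((Real.hasDerivAt_sin x).const_mul t)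
      refine ((h1.mul h2).neg.mul_const (1 + t ^ 2)⁻¹).congr_deriv ?_
      simp only [Pi.add_apply]
      field_simp
      ring
    · exact Continuous.intervalIntegrable (by fun_prop) _ _
  have hint : ∀ x : ℝ, 0 < x → IntegrableOn (fun t ↦ Real.exp (-(x * t))) (Ioi 0) := by
    intro x hx
    have := integrableOn_exp_mul_Ioi (a := -x) (by linarith) 0
    simpa [neg_mul] using this
  have hprod : Integrable (Function.uncurry fun x t : ℝ ↦ Real.sin x * Real.exp (-(x * t)))
      ((volume.restrict (uIoc 0 R)).prod (volume.restrict (Ioi (0 : ℝ)))) := by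
    rw [uIoc_of_le hR]
    refine (integrable_prod_iff ?_).2 ⟨?_, ?_⟩
    · exact Continuous.aestronglyMeasurable (by unfold Function.uncurry; fun_prop)
    · filter_upwards [ae_restrict_mem measurableSet_Ioc] with x hx
      simpa using (hint x hx.1).const_mul (Real.sin x)
    · have : IntegrableOn (fun x ↦ |Real.sinc x|) (Ioc 0 R) :=
        ((Real.continuous_sinc.abs).integrableOn_Icc).mono_set Ioc_subset_Icc_self
      refine this.congr ?_
      filter_upwards [ae_restrict_mem measurableSet_Ioc] with x hx
      simp only [Function.uncurry_apply_pair, norm_mul, Real.norm_eq_abs, Real.abs_exp]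
      rw [MeasureTheory.integral_const_mul, laplace x hx.1, Real.sinc_of_ne_zero hx.1.ne', abs_div,
        abs_of_pos hx.1, div_eq_mul_inv]
  have swap := intervalIntegral_integral_swap hprod
  simp only [inner] at swap
  rw [← swap]
  refine integral_congr_ae ?_
  rw [uIoc_of_le hR]
  refine Eventually.of_forall fun x hx ↦ ?_
  rw [MeasureTheory.integral_const_mul, laplace x hx.1, Real.sinc_of_ne_zero hx.1.ne',
    div_eq_mul_inv]

open Topology in
theorem tendsto_integral_sinc_atTop :
    Tendsto (fun R : ℝ ↦ ∫ x in (0 : ℝ)..R, Real.sinc x) atTop (𝓝 (π / 2)) := by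
  have key : Tendsto (fun R : ℝ ↦ ∫ t in Ioi (0 : ℝ),
      (1 - Real.exp (-(R * t)) * (Real.cos R + t * Real.sin R)) * (1 + t ^ 2)⁻¹) atTop
      (𝓝 (∫ t in Ioi (0 : ℝ), (1 + t ^ 2)⁻¹)) := by
    refine tendsto_integral_filter_of_dominated_convergence (fun t ↦ 3 * (1 + t ^ 2)⁻¹) ?_ ?_ ?_ ?_
    · refine Eventually.of_forall fun R ↦ Continuous.aestronglyMeasurable ?_
      have : ∀ t : ℝ, 1 + t ^ 2 ≠ 0 := fun t ↦ by positivity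
      fun_prop (disch := assumption)
    · filter_upwards [eventually_ge_atTop 1] with R hR
      filter_upwards [ae_restrict_mem measurableSet_Ioi] with t ht
      have ht : 0 < t := ht
      have hexp := Real.exp_pos (-(R * t))
      have h1 : Real.exp (-(R * t)) * (1 + t) ≤ 1 := by
        rw [Real.exp_neg, inv_mul_le_iff₀ (Real.exp_pos _)]
        nlinarith [Real.add_one_le_exp (R * t)]
      have h2 : |Real.cos R + t * Real.sin R| ≤ 1 + t := by
        refine (abs_add_le _ _).trans (add_le_add (Real.abs_cos_le_one R) ?_)
        rw [abs_mul, abs_of_pos ht]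
        exact mul_le_of_le_one_right ht.le (Real.abs_sin_le_one R)
      have h3 : |Real.exp (-(R * t)) * (Real.cos R + t * Real.sin R)| ≤ 1 := by
        rw [abs_mul, Real.abs_exp]
        exact (mul_le_mul_of_nonneg_left h2 hexp.le).trans h1
      rw [norm_mul, Real.norm_eq_abs, Real.norm_eq_abs,
        abs_of_pos (by positivity : 0 < (1 + t ^ 2)⁻¹)]
      refine mul_le_mul_of_nonneg_right ?_ (by positivity)
      rw [abs_le] at h3 ⊢
      constructor <;> linarith
    · exact (integrable_inv_one_add_sq.const_mul 3).integrableOn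
    · filter_upwards [ae_restrict_mem measurableSet_Ioi] with t ht
      have ht : 0 < t := ht
      have h0 : Tendsto (fun R : ℝ ↦ Real.exp (-(R * t)) * (1 + t)) atTop (𝓝 0) := by
        have : Tendsto (fun R : ℝ ↦ Real.exp (-(R * t))) atTop (𝓝 0) :=
          Real.tendsto_exp_neg_atTop_nhds_zero.comp (tendsto_id.atTop_mul_const ht)
        simpa using this.mul_const (1 + t)
      have h1 : Tendsto (fun R : ℝ ↦ Real.exp (-(R * t)) * (Real.cos R + t * Real.sin R)) atTop
          (𝓝 0) := by
        refine squeeze_zero_norm (fun R ↦ ?_) h0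
        rw [norm_mul, Real.norm_eq_abs, Real.abs_exp, Real.norm_eq_abs]
        refine mul_le_mul_of_nonneg_left ?_ (Real.exp_pos _).le
        refine (abs_add_le _ _).trans (add_le_add (Real.abs_cos_le_one R) ?_)
        rw [abs_mul, abs_of_pos ht]
        exact mul_le_of_le_one_right ht.le (Real.abs_sin_le_one R)
      simpa using (h1.const_sub 1).mul_const (1 + t ^ 2)⁻¹
  rw [integral_Ioi_inv_one_add_sq, Real.arctan_zero, sub_zero] at key
  refine key.congr' ?_
  filter_upwards [eventually_ge_atTop 0] with R hR using (integral_sinc_eq R hR).symm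

/-- The sine integral `Si x = ∫₀ˣ sinc t dt`. -/
noncomputable def sineIntegral (x : ℝ) : ℝ := ∫ t in (0 : ℝ)..x, Real.sinc t

theorem continuous_sineIntegral : Continuous sineIntegral :=
  intervalIntegral.continuous_primitive (fun _ _ ↦ Real.continuous_sinc.intervalIntegrable _ _) 0

open Topology in
theorem tendsto_sineIntegral_atTop : Tendsto sineIntegral atTop (𝓝 (π / 2)) :=
  tendsto_integral_sinc_atTop

@[simp]
theorem sineIntegral_zero : sineIntegral 0 = 0 := by simp [sineIntegral]

theorem sineIntegral_neg (x : ℝ) : sineIntegral (-x) = -sineIntegral x := by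
  have := intervalIntegral.integral_comp_neg (a := 0) (b := x) Real.sinc
  simp only [Real.sinc_neg, neg_zero] at this
  rw [sineIntegral, sineIntegral, this, ← intervalIntegral.integral_symm]

open Topology in
theorem tendsto_sineIntegral_atBot : Tendsto sineIntegral atBot (𝓝 (-(π / 2))) := by
  have := (tendsto_sineIntegral_atTop.comp tendsto_neg_atBot_atTop).neg
  simpa [Function.comp_def, sineIntegral_neg] using this

theorem exists_abs_sineIntegral_le : ∃ C : ℝ, ∀ x : ℝ, |sineIntegral x| ≤ C := by
  obtain ⟨N, hN⟩ := eventually_atTop.1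
    ((tendsto_sineIntegral_atTop.abs).eventually_le_const (lt_add_one |π / 2|))
  have hpos : ∀ x : ℝ, 0 ≤ x → |sineIntegral x| ≤ max (|π / 2| + 1) N := by
    intro x hx
    rcases le_total N x with h | h
    · exact (hN x h).trans (le_max_left _ _)
    · refine le_trans ?_ (h.trans (le_max_right _ _))
      have := intervalIntegral.norm_integral_le_of_norm_le_const (a := 0) (b := x)
        (f := Real.sinc) (C := 1) fun x _ ↦ Real.abs_sinc_le_one x
      simpa [sineIntegral, abs_of_nonneg hx] using this
  refine ⟨max (|π / 2| + 1) N, fun x ↦ ?_⟩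
  rcases le_total 0 x with h | h
  · exact hpos x h
  · simpa [sineIntegral_neg] using hpos (-x) (by linarith)

theorem integral_mul_sinc (T a b : ℝ) :
    ∫ y in a..b, T * Real.sinc (T * y) = sineIntegral (T * b) - sineIntegral (T * a) := by
  have := intervalIntegral.mul_integral_comp_mul_left (a := a) (b := b) (f := Real.sinc) (c := T)
  rw [intervalIntegral.integral_const_mul, this, sineIntegral, sineIntegral,
    intervalIntegral.integral_interval_sub_left] <;>
  exact Real.continuous_sinc.intervalIntegrable _ _

theorem integral_indicator_Ici_mul_sinc (T τ : ℝ) {R : ℝ} (hR : 0 ≤ R) :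
    ∫ y in (-R)..R, (Ici τ).indicator (fun y ↦ T * Real.sinc (T * y)) y =
      sineIntegral (T * R) - sineIntegral (T * max (-R) (min R τ)) := by
  set σ := max (-R) (min R τ) with hσ
  have hl : -R ≤ σ := le_max_left _ _
  have hr : σ ≤ R := max_le (by linarith) (min_le_left _ _)
  have hcont : Continuous fun y : ℝ ↦ T * Real.sinc (T * y) := by
    have := Real.continuous_sinc; fun_prop
  have hii : ∀ a b : ℝ, IntervalIntegrable
      ((Ici τ).indicator fun y ↦ T * Real.sinc (T * y)) volume a b := fun a b ↦ by
    have := (hcont.intervalIntegrable (μ := volume) a b)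
    rw [intervalIntegrable_iff] at this ⊢
    exact this.indicator measurableSet_Ici
  rw [← integral_add_adjacent_intervals (hii (-R) σ) (hii σ R), ← integral_mul_sinc]
  have h1 : ∫ y in (-R)..σ, (Ici τ).indicator (fun y ↦ T * Real.sinc (T * y)) y = 0 := by
    rw [← intervalIntegral.integral_zero (a := -R) (b := σ) (μ := volume)]
    refine integral_congr_ae ?_
    filter_upwards [compl_mem_ae_iff.2 (measure_singleton σ)] with y hy hy'
    rw [uIoc_of_le hl] at hy'
    refine indicator_of_notMem (fun h : τ ≤ y ↦ ?_) _
    have : y < σ := lt_of_le_of_ne hy'.2 hy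
    rcases lt_max_iff.1 this with h' | h'
    · exact absurd h' (not_lt.2 hy'.1.le)
    · exact absurd h (not_le.2 (h'.trans_le (min_le_right _ _)))
  have h2 : ∫ y in σ..R, (Ici τ).indicator (fun y ↦ T * Real.sinc (T * y)) y =
      ∫ y in σ..R, T * Real.sinc (T * y) := by
    refine integral_congr_ae (Eventually.of_forall fun y hy ↦ ?_)
    rw [uIoc_of_le hr] at hy
    refine indicator_of_mem (show τ ≤ y from ?_) _
    rcases min_le_iff.1 ((le_max_right (-R) (min R τ)).trans hy.1.le) with h' | h'
    · have := hy.1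
      rw [le_antisymm hy.2 h', hσ] at this
      exact (not_lt.1 fun h ↦ absurd this (by simp [min_eq_left h.le])).trans h'
    · exact h'
  rw [h1, h2, zero_add]

theorem continuous_mul_sinc (T : ℝ) : Continuous fun y : ℝ ↦ T * Real.sinc (T * y) := by
  have := Real.continuous_sinc
  fun_prop

/-- Fubini for the truncated Dirichlet integral of a distribution function. -/
theorem integral_measure_Iic_mul_sinc (μ : Measure ℝ) [IsFiniteMeasure μ] (T x : ℝ) {R : ℝ}
    (hR : 0 ≤ R) :
    ∫ y in (-R)..R, T * Real.sinc (T * y) * μ.real (Iic (x + y)) =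
      ∫ t, (sineIntegral (T * R) - sineIntegral (T * max (-R) (min R (t - x)))) ∂μ := by
  have hswap : ∀ t y : ℝ, (Ici (t - x)).indicator (fun y ↦ T * Real.sinc (T * y)) y =
      (Iic (x + y)).indicator (fun _ ↦ T * Real.sinc (T * y)) t := by
    intro t y
    simp only [indicator, mem_Ici, mem_Iic, sub_le_iff_le_add']
  have hint : Integrable (Function.uncurry fun y t : ℝ ↦
      (Ici (t - x)).indicator (fun y ↦ T * Real.sinc (T * y)) y)
      ((volume.restrict (uIoc (-R) R)).prod μ) := by
    have hmeas : MeasurableSet {p : ℝ × ℝ | p.2 - x ≤ p.1} :=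
      measurableSet_le (by fun_prop) (by fun_prop)
    have hk : IntegrableOn (fun y ↦ T * Real.sinc (T * y)) (uIoc (-R) R) :=
      intervalIntegrable_iff.1 ((continuous_mul_sinc T).intervalIntegrable _ _)
    have := (Integrable.comp_fst hk μ).indicator hmeas
    refine this.congr (Eventually.of_forall fun p ↦ ?_)
    simp [indicator, Function.uncurry]
  have := intervalIntegral_integral_swap hint
  simp only [integral_indicator_Ici_mul_sinc T _ hR] at this
  rw [← this]
  refine integral_congr fun y _ ↦ ?_
  simp only [hswap]
  rw [MeasureTheory.integral_indicator measurableSet_Iic, setIntegral_const, smul_eq_mul, mul_comm]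

open Topology in
/-- Letting the truncation go to infinity in the Dirichlet integral of a distribution function. -/
theorem tendsto_integral_measure_Iic_mul_sinc (μ : Measure ℝ) [IsFiniteMeasure μ] {T : ℝ}
    (hT : 0 < T) (x : ℝ) :
    Tendsto (fun R : ℝ ↦ ∫ y in (-R)..R, T * Real.sinc (T * y) * μ.real (Iic (x + y))) atTop
      (𝓝 (∫ t, (π / 2 - sineIntegral (T * (t - x))) ∂μ)) := by
  obtain ⟨C, hC⟩ := exists_abs_sineIntegral_le
  have key : Tendsto (fun R : ℝ ↦
      ∫ t, (sineIntegral (T * R) - sineIntegral (T * max (-R) (min R (t - x)))) ∂μ) atTop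
      (𝓝 (∫ t, (π / 2 - sineIntegral (T * (t - x))) ∂μ)) := by
    refine tendsto_integral_filter_of_dominated_convergence (fun _ ↦ C + C) ?_ ?_
      (integrable_const _) ?_
    · refine Eventually.of_forall fun R ↦ Continuous.aestronglyMeasurable ?_
      have := continuous_sineIntegral
      fun_prop
    · exact Eventually.of_forall fun R ↦ Eventually.of_forall fun t ↦
        (abs_sub _ _).trans (add_le_add (hC _) (hC _))
    · refine Eventually.of_forall fun t ↦ Tendsto.sub
        (tendsto_sineIntegral_atTop.comp (tendsto_id.const_mul_atTop hT)) ?_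
      refine tendsto_const_nhds.congr' ?_
      filter_upwards [eventually_ge_atTop |t - x|] with R hR
      rw [abs_le] at hR
      rw [min_eq_right hR.2, max_eq_right hR.1]
  refine key.congr' ?_
  filter_upwards [eventually_ge_atTop 0] with R hR
  exact (integral_measure_Iic_mul_sinc μ T x hR).symm

open Topology in
theorem tendsto_integral_sub_sineIntegral (μ : Measure ℝ) [IsFiniteMeasure μ] (x : ℝ) :
    Tendsto (fun T : ℝ ↦ ∫ t, (π / 2 - sineIntegral (T * (t - x))) ∂μ) atTop
      (𝓝 (π / 2 * (μ.real (Iio x) + μ.real (Iic x)))) := by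
  obtain ⟨C, hC⟩ := exists_abs_sineIntegral_le
  have hval : ∫ t, ((Iio x).indicator (fun _ ↦ π / 2) t + (Iic x).indicator (fun _ ↦ π / 2) t) ∂μ =
      π / 2 * (μ.real (Iio x) + μ.real (Iic x)) := by
    rw [integral_add ((integrable_const _).indicator measurableSet_Iio)
      ((integrable_const _).indicator measurableSet_Iic),
      MeasureTheory.integral_indicator measurableSet_Iio,
      MeasureTheory.integral_indicator measurableSet_Iic, setIntegral_const, setIntegral_const,
      smul_eq_mul, smul_eq_mul]
    ring
  rw [← hval]
  refine tendsto_integral_filter_of_dominated_convergence (fun _ ↦ |π / 2| + C) ?_ ?_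
    (integrable_const _) ?_
  · refine Eventually.of_forall fun R ↦ Continuous.aestronglyMeasurable ?_
    have := continuous_sineIntegral
    fun_prop
  · exact Eventually.of_forall fun R ↦ Eventually.of_forall fun t ↦
      (abs_sub _ _).trans (add_le_add le_rfl (hC _))
  · refine Eventually.of_forall fun t ↦ ?_
    rcases lt_trichotomy t x with h | h | h
    · have := (tendsto_sineIntegral_atBot.comp
        (tendsto_id.atTop_mul_const_of_neg (sub_neg.2 h))).const_sub (π / 2)
      simpa [h, h.le] using this
    · simp [h]
    · have := (tendsto_sineIntegral_atTop.comp
        (tendsto_id.atTop_mul_const (sub_pos.2 h))).const_sub (π / 2)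
      simpa [h.le, not_le.2 h] using this

/-- The data of pointwise limits of the symmetric Dirichlet integrals
`∫ T sinc (T y) f (x + y) dy`. -/
structure DirichletConvergent (f : ℝ → ℂ) : Prop where
  intervalIntegrable (a b : ℝ) : IntervalIntegrable f volume a b
  exists_limit : ∃ (L : ℝ → ℝ → ℂ) (C : ℝ),
    (∀ T x, 0 < T → Tendsto
      (fun R : ℝ ↦ ∫ y in (-R)..R, ((T * Real.sinc (T * y) : ℝ) : ℂ) * f (x + y)) atTop
      (nhds (L T x))) ∧
    (∀ T x, 0 < T → ‖L T x‖ ≤ C) ∧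
    ∀ x, ∃ l r, Tendsto f (nhdsWithin x (Iio x)) (nhds l) ∧
      Tendsto f (nhdsWithin x (Ioi x)) (nhds r) ∧
      Tendsto (fun T ↦ L T x) atTop (nhds (π / 2 * (l + r)))

open Topology in
theorem dirichletConvergent_of_monotone {F : ℝ → ℝ} (hF : Monotone F) {B : ℝ}
    (hB : ∀ x, |F x| ≤ B) : DirichletConvergent fun x ↦ (F x : ℂ) := by
  obtain ⟨C, hC⟩ := exists_abs_sineIntegral_le
  set G := hF.stieltjesFunction with hG
  have hGF : ∀ x, G x = F.rightLim x := fun x ↦ rfl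
  have hGB : ∀ x, |G x| ≤ B := fun x ↦
    le_of_tendsto (hF.tendsto_rightLim x).abs (Eventually.of_forall hB)
  have : IsFiniteMeasure G.measure := G.isFiniteMeasure_of_forall_abs_le hGB
  obtain ⟨a, ha⟩ : ∃ a, Tendsto G atBot (𝓝 a) :=
    ⟨_, tendsto_atBot_ciInf G.mono ⟨-B, by rintro _ ⟨x, rfl⟩; exact (abs_le.1 (hGB x)).1⟩⟩
  have hIic : ∀ x, G.measure.real (Iic x) = G x - a := fun x ↦ by
    rw [measureReal_def, G.measure_Iic ha,
      ENNReal.toReal_ofReal (sub_nonneg.2 (G.mono.le_of_tendsto ha x))]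
  have hIio : ∀ x, G.measure.real (Iio x) = F.leftLim x - a := fun x ↦ by
    have hl : Function.leftLim G x = F.leftLim x :=
      leftLim_rightLim (hF.tendsto_leftLim x)
    rw [measureReal_def, G.measure_Iio ha, ENNReal.toReal_ofReal, hl]
    exact sub_nonneg.2 (ge_of_tendsto (G.mono.tendsto_leftLim x)
      (Eventually.of_forall fun y ↦ G.mono.le_of_tendsto ha y))
  have hae : F =ᵐ[volume] G := by
    have h0 : volume {x | ¬ContinuousAt F x} = 0 := hF.countable_not_continuousAt.measure_zero _
    filter_upwards [compl_mem_ae_iff.2 h0] with x hx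
    have hx : ContinuousAt F x := by simpa using hx
    exact (hx.continuousWithinAt.rightLim_eq).symm
  refine ⟨fun p q ↦ ?_, fun T x ↦ ((2 * (π / 2) * a +
    ∫ t, (π / 2 - sineIntegral (T * (t - x))) ∂G.measure : ℝ) : ℂ),
    |2 * (π / 2) * a| + (|π / 2| + C) * G.measure.real univ, ?_, ?_, ?_⟩
  · have := (hF.monotoneOn (uIcc p q)).intervalIntegrable (μ := volume)
    exact ⟨this.1.ofReal, this.2.ofReal⟩
  · intro T x hT
    have h1 : Tendsto (fun R : ℝ ↦ (∫ y in (-R)..R, T * Real.sinc (T * y)) * a +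
        ∫ y in (-R)..R, T * Real.sinc (T * y) * G.measure.real (Iic (x + y))) atTop
        (𝓝 (2 * (π / 2) * a + ∫ t, (π / 2 - sineIntegral (T * (t - x))) ∂G.measure)) := by
      refine Tendsto.add (Tendsto.mul_const a ?_) (tendsto_integral_measure_Iic_mul_sinc _ hT x)
      have := (tendsto_sineIntegral_atTop.comp (tendsto_id.const_mul_atTop hT)).const_mul 2
      refine this.congr fun R ↦ ?_
      rw [integral_mul_sinc, mul_neg, sineIntegral_neg]
      simp only [Function.comp_apply, id]
      ring
    refine ((continuous_ofReal.tendsto _).comp h1).congr fun R ↦ ?_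
    have hc := continuous_mul_sinc T
    have hae' : ∀ᵐ y, F (x + y) = G (x + y) :=
      (measurePreserving_add_left volume x).quasiMeasurePreserving.ae hae
    have hmono : ∀ p q, IntervalIntegrable (fun y ↦ G (x + y)) volume p q := fun p q ↦
      (Monotone.monotoneOn (fun u v h ↦ G.mono (by linarith)) _).intervalIntegrable
    simp only [Function.comp_apply, hIic, ← intervalIntegral.integral_mul_const]
    rw [← intervalIntegral.integral_add]
    · rw [← intervalIntegral.integral_ofReal]
      refine integral_congr_ae ?_
      filter_upwards [hae'] with y hy _
      rw [hy]
      push_cast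
      ring
    · exact (hc.mul_const a).intervalIntegrable _ _
    · exact ((hmono _ _).sub (intervalIntegrable_const)).continuousOn_mul hc.continuousOn
  · intro T x _
    rw [norm_real]
    refine (norm_add_le _ _).trans (add_le_add le_rfl ?_)
    exact norm_integral_le_of_norm_le_const (Eventually.of_forall fun t ↦
        (abs_sub _ _).trans (add_le_add le_rfl (hC _)))
  · intro x
    refine ⟨_, _, (continuous_ofReal.tendsto _).comp (hF.tendsto_leftLim x),
      (continuous_ofReal.tendsto _).comp (hF.tendsto_rightLim x), ?_⟩
    have := (tendsto_integral_sub_sineIntegral G.measure x).const_add (2 * (π / 2) * a)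
    rw [hIic, hIio, hGF] at this
    convert (continuous_ofReal.tendsto _).comp this using 2
    · rfl
    · push_cast
      ring

namespace DirichletConvergent

theorem intervalIntegrable_mul_sinc {f : ℝ → ℂ} (hf : DirichletConvergent f) (T x a b : ℝ) :
    IntervalIntegrable (fun y ↦ ((T * Real.sinc (T * y) : ℝ) : ℂ) * f (x + y)) volume a b := by
  have h : IntervalIntegrable (fun y ↦ f (x + y)) volume a b := by
    simpa using (hf.intervalIntegrable (x + a) (x + b)).comp_add_left x
  exact h.continuousOn_mul (continuous_ofReal.comp (continuous_mul_sinc T)).continuousOn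

theorem add {f g : ℝ → ℂ} (hf : DirichletConvergent f) (hg : DirichletConvergent g) :
    DirichletConvergent fun x ↦ f x + g x := by
  obtain ⟨L, C, hL, hC, hlim⟩ := hf.exists_limit
  obtain ⟨L', C', hL', hC', hlim'⟩ := hg.exists_limit
  refine ⟨fun a b ↦ (hf.intervalIntegrable a b).add (hg.intervalIntegrable a b),
    fun T x ↦ L T x + L' T x, C + C', fun T x hT ↦ ?_,
    fun T x hT ↦ (norm_add_le _ _).trans (add_le_add (hC T x hT) (hC' T x hT)), fun x ↦ ?_⟩
  · refine ((hL T x hT).add (hL' T x hT)).congr fun R ↦ ?_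
    rw [← intervalIntegral.integral_add (hf.intervalIntegrable_mul_sinc T x _ _)
      (hg.intervalIntegrable_mul_sinc T x _ _)]
    simp only [mul_add]
  · obtain ⟨l, r, hl, hr, h⟩ := hlim x
    obtain ⟨l', r', hl', hr', h'⟩ := hlim' x
    refine ⟨l + l', r + r', hl.add hl', hr.add hr', ?_⟩
    convert h.add h' using 2
    ring

theorem const_mul {f : ℝ → ℂ} (hf : DirichletConvergent f) (z : ℂ) :
    DirichletConvergent fun x ↦ z * f x := by
  obtain ⟨L, C, hL, hC, hlim⟩ := hf.exists_limit
  refine ⟨fun a b ↦ (hf.intervalIntegrable a b).const_mul z, fun T x ↦ z * L T x, ‖z‖ * C,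
    fun T x hT ↦ ?_, fun T x hT ↦ ?_, fun x ↦ ?_⟩
  · refine ((hL T x hT).const_mul z).congr fun R ↦ ?_
    rw [← intervalIntegral.integral_const_mul]
    simp only [mul_left_comm]
  · rw [norm_mul]
    exact mul_le_mul_of_nonneg_left (hC T x hT) (norm_nonneg _)
  · obtain ⟨l, r, hl, hr, h⟩ := hlim x
    refine ⟨z * l, z * r, hl.const_mul z, hr.const_mul z, ?_⟩
    convert h.const_mul z using 2
    ring

end DirichletConvergent

theorem BoundedVariationOn.exists_norm_le {E : Type*} [NormedAddCommGroup E] {f : ℝ → E}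
    (hf : BoundedVariationOn f univ) : ∃ B, ∀ x, ‖f x‖ ≤ B := by
  refine ⟨‖f 0‖ + (eVariationOn f univ).toReal, fun x ↦ ?_⟩
  have := hf.dist_le (mem_univ x) (mem_univ 0)
  rw [dist_eq_norm] at this
  calc ‖f x‖ = ‖f 0 + (f x - f 0)‖ := by rw [add_sub_cancel]
    _ ≤ _ := (norm_add_le _ _).trans (add_le_add le_rfl this)

theorem BoundedVariationOn.dirichletConvergent_ofReal {f : ℝ → ℝ}
    (hf : BoundedVariationOn f univ) : DirichletConvergent fun x ↦ (f x : ℂ) := by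
  obtain ⟨B, hB⟩ := hf.exists_norm_le
  have hloc := hf.locallyBoundedVariationOn
  set V : ℝ → ℝ := variationOnFromTo f univ 0
  have hV : Monotone V := monotoneOn_univ.1 (variationOnFromTo.monotoneOn hloc (mem_univ 0))
  have hW : Monotone (V - f) :=
    monotoneOn_univ.1 (variationOnFromTo.sub_self_monotoneOn hloc (mem_univ 0))
  have hVB : ∀ x, |V x| ≤ (eVariationOn f univ).toReal := fun x ↦
    variationOnFromTo.abs_le_eVariationOn hf
  have hWB : ∀ x, |(V - f) x| ≤ (eVariationOn f univ).toReal + B := fun x ↦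
    (abs_sub _ _).trans (add_le_add (hVB x) (hB x))
  have := (dirichletConvergent_of_monotone hV hVB).add
    ((dirichletConvergent_of_monotone hW hWB).const_mul (-1))
  convert this using 2 with x
  simp

theorem BoundedVariationOn.dirichletConvergent {f : ℝ → ℂ} (hf : BoundedVariationOn f univ) :
    DirichletConvergent f := by
  have hre : BoundedVariationOn (fun x ↦ (f x).re) univ :=
    (Complex.reCLM.lipschitz).comp_boundedVariationOn hf
  have him : BoundedVariationOn (fun x ↦ (f x).im) univ :=
    (Complex.imCLM.lipschitz).comp_boundedVariationOn hf
  convert hre.dirichletConvergent_ofReal.add (him.dirichletConvergent_ofReal.const_mul I) using 2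
    with x
  rw [mul_comm, re_add_im]

theorem integrable_mul_sinc_mul {f : ℝ → ℂ} (hf : Integrable f) (T x : ℝ) :
    Integrable fun y ↦ ((T * Real.sinc (T * y) : ℝ) : ℂ) * f (x + y) := by
  refine (hf.comp_add_left x).bdd_mul (c := |T|)
    (continuous_ofReal.comp (continuous_mul_sinc T)).aestronglyMeasurable ?_
  refine Eventually.of_forall fun y ↦ ?_
  rw [norm_real, norm_mul]
  exact mul_le_of_le_one_right (abs_nonneg _) (Real.abs_sinc_le_one _)

open Topology in
/-- The **Dirichlet–Jordan theorem** for integrable functions of bounded variation, together with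
the uniform boundedness of the Dirichlet integrals. -/
theorem BoundedVariationOn.dirichlet_jordan {f : ℝ → ℂ} (hf : BoundedVariationOn f univ)
    (hint : Integrable f) :
    (∃ C, ∀ T x, 0 < T → ‖∫ y, ((T * Real.sinc (T * y) : ℝ) : ℂ) * f (x + y)‖ ≤ C) ∧
    ∀ x l r, Tendsto f (𝓝[<] x) (𝓝 l) → Tendsto f (𝓝[>] x) (𝓝 r) →
      Tendsto (fun T : ℝ ↦ ∫ y, ((T * Real.sinc (T * y) : ℝ) : ℂ) * f (x + y)) atTop
        (𝓝 (π / 2 * (l + r))) := by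
  obtain ⟨L, C, hL, hC, hlim⟩ := hf.dirichletConvergent.exists_limit
  have heq : ∀ T x, 0 < T → ∫ y, ((T * Real.sinc (T * y) : ℝ) : ℂ) * f (x + y) = L T x :=
    fun T x hT ↦ tendsto_nhds_unique (intervalIntegral_tendsto_integral
      (integrable_mul_sinc_mul hint T x) tendsto_neg_atTop_atBot tendsto_id) (hL T x hT)
  refine ⟨⟨C, fun T x hT ↦ heq T x hT ▸ hC T x hT⟩, fun x l r hl hr ↦ ?_⟩
  obtain ⟨l', r', hl', hr', h⟩ := hlim x
  rw [tendsto_nhds_unique hl hl', tendsto_nhds_unique hr hr']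
  refine h.congr' ?_
  filter_upwards [eventually_gt_atTop 0] with T hT using (heq T x hT).symm

theorem integral_exp_mul_I_eq_mul_sinc (T v : ℝ) :
    ∫ t in (-T)..T, cexp (t * v * I) = 2 * ((T * Real.sinc (T * v) : ℝ) : ℂ) := by
  rcases eq_or_ne v 0 with rfl | hv
  · simp; ring
  have hc : (v * I : ℂ) ≠ 0 := mul_ne_zero (ofReal_ne_zero.2 hv) I_ne_zero
  have := integral_exp_mul_complex (a := -T) (b := T) hc
  simp only [show ∀ t : ℝ, (t * v * I : ℂ) = v * I * t from fun t ↦ by ring]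
  rw [this]
  rcases eq_or_ne T 0 with rfl | hT
  · simp
  rw [Real.sinc_of_ne_zero (mul_ne_zero hT hv)]
  push_cast
  rw [Complex.sin]
  have hv' : (v : ℂ) ≠ 0 := ofReal_ne_zero.2 hv
  have hT' : (T : ℂ) ≠ 0 := ofReal_ne_zero.2 hT
  rw [show (v * I * -T : ℂ) = -(T * v) * I by ring, show (v * I * T : ℂ) = T * v * I by ring]
  field_simp
  linear_combination (cexp (T * v * I) - cexp (-(T * v * I))) * I_sq

/-- The truncated Fourier inversion integral is a Dirichlet integral. -/
theorem integral_exp_mul_integral_exp {f : ℝ → ℂ} (hf : Integrable f) (T x : ℝ) :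
    ∫ t in (-T)..T, cexp (t * x * I) * ∫ u : ℝ, cexp (-(t * u * I)) * f u =
      2 * ∫ y, ((T * Real.sinc (T * y) : ℝ) : ℂ) * f (x + y) := by
  have hint : Integrable (Function.uncurry fun t u : ℝ ↦
      cexp (t * x * I) * (cexp (-(t * u * I)) * f u))
      ((volume.restrict (uIoc (-T) T)).prod volume) := by
    have : IsFiniteMeasure (volume.restrict (uIoc (-T) T)) := ⟨by simp [uIoc]⟩
    have hcs : Integrable (fun p : ℝ × ℝ ↦ f p.2)
        ((volume.restrict (uIoc (-T) T)).prod volume) := hf.comp_snd _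
    have hcont : Continuous fun p : ℝ × ℝ ↦ cexp (p.1 * x * I) * cexp (-(p.1 * p.2 * I)) := by
      fun_prop
    refine (hcs.bdd_mul (c := 1) hcont.aestronglyMeasurable ?_).congr
      (Eventually.of_forall fun p ↦ by simp [Function.uncurry, mul_assoc])
    refine Eventually.of_forall fun p ↦ le_of_eq ?_
    rw [← Complex.exp_add, show (p.1 * x * I + -(p.1 * p.2 * I) : ℂ) =
      ((p.1 * x - p.1 * p.2 : ℝ) : ℂ) * I by push_cast; ring, norm_exp_ofReal_mul_I]
  have hswap := intervalIntegral_integral_swap hint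
  simp only [MeasureTheory.integral_const_mul] at hswap
  rw [hswap]
  have h1 : ∀ u : ℝ, ∫ t in (-T)..T, cexp (t * x * I) * (cexp (-(t * u * I)) * f u) =
      2 * (((T * Real.sinc (T * (u - x)) : ℝ) : ℂ) * f u) := by
    intro u
    rw [← Real.sinc_neg, show -(T * (u - x)) = T * (x - u) by ring, ← mul_assoc,
      ← integral_exp_mul_I_eq_mul_sinc, ← intervalIntegral.integral_mul_const]
    refine integral_congr fun t _ ↦ ?_
    rw [← mul_assoc, ← Complex.exp_add]
    push_cast
    ring_nf
  simp only [h1]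
  rw [MeasureTheory.integral_const_mul, ← integral_add_left_eq_self _ x]
  simp

theorem continuous_integral_exp_mul {f : ℝ → ℂ} (hf : Integrable f) :
    Continuous fun t : ℝ ↦ ∫ u : ℝ, cexp (-(t * u * I)) * f u := by
  refine continuous_of_dominated (bound := fun u ↦ ‖f u‖) (fun t ↦ ?_) (fun t ↦ ?_) hf.norm ?_
  · exact (Continuous.aestronglyMeasurable (by fun_prop)).mul hf.aestronglyMeasurable
  · refine Eventually.of_forall fun u ↦ le_of_eq ?_
    rw [norm_mul, show (-(t * u * I) : ℂ) = ((-(t * u) : ℝ) : ℂ) * I by push_cast; ring,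
      norm_exp_ofReal_mul_I, one_mul]
  · exact Eventually.of_forall fun u ↦ by fun_prop

open Topology in
/-- A truncated Perron-type formula for absolutely convergent generalized Dirichlet series tested
against the Fourier transform of an integrable function of bounded variation. -/
theorem BoundedVariationOn.tendsto_integral_tsum_exp_mul {f : ℝ → ℂ}
    (hf : BoundedVariationOn f univ) (hint : Integrable f) {a : ℕ → ℂ}
    (ha : Summable fun n ↦ ‖a n‖) (x : ℕ → ℝ)
    (hlim : ∀ n, a n ≠ 0 → ∃ l r, Tendsto f (𝓝[<] x n) (𝓝 l) ∧ Tendsto f (𝓝[>] x n) (𝓝 r) ∧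
      l + r = 2 * f (x n)) :
    Tendsto (fun T : ℝ ↦ (1 / (2 * (π : ℂ))) * ∫ t in (-T)..T,
      (∑' n, a n * cexp (t * x n * I)) * ∫ u : ℝ, cexp (-(t * u * I)) * f u) atTop
      (𝓝 (∑' n, a n * f (x n))) := by
  obtain ⟨⟨C, hC⟩, hjordan⟩ := hf.dirichlet_jordan hint
  set M : ℝ → ℂ := fun t ↦ ∫ u : ℝ, cexp (-(t * u * I)) * f u with hM
  have hMc : Continuous M := continuous_integral_exp_mul hint
  have hexp : ∀ (t : ℝ) n, ‖cexp (t * x n * I)‖ = 1 := fun t n ↦ by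
    rw [← ofReal_mul, norm_exp_ofReal_mul_I]
  have hser : ∀ t : ℝ, Summable fun n ↦ a n * cexp (t * x n * I) := fun t ↦
    Summable.of_norm (by simpa [hexp] using ha)
  have hswap : ∀ T : ℝ, ∫ t in (-T)..T, (∑' n, a n * cexp (t * x n * I)) * M t =
      ∑' n, a n * (2 * ∫ y, ((T * Real.sinc (T * y) : ℝ) : ℂ) * f (x n + y)) := by
    intro T
    have := intervalIntegral.hasSum_integral_of_dominated_convergence (μ := volume)
      (a := -T) (b := T) (F := fun n t ↦ a n * (cexp (t * x n * I) * M t))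
      (f := fun t ↦ (∑' n, a n * cexp (t * x n * I)) * M t)
      (fun n t ↦ ‖a n‖ * ‖M t‖) (fun n ↦ Continuous.aestronglyMeasurable (by fun_prop))
      (fun n ↦ Eventually.of_forall fun t _ ↦ by simp [hexp])
      (Eventually.of_forall fun t _ ↦ ha.mul_right _) ?_
      (Eventually.of_forall fun t _ ↦ by
        simpa only [mul_assoc] using (hser t).hasSum.mul_right (M t))
    · rw [← this.tsum_eq]
      refine tsum_congr fun n ↦ ?_
      rw [intervalIntegral.integral_const_mul, hM, integral_exp_mul_integral_exp hint]
    · simp only [tsum_mul_right]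
      exact Continuous.intervalIntegrable (by fun_prop) _ _
  refine Tendsto.congr (f₁ := fun T : ℝ ↦ ∑' n, (1 / (2 * (π : ℂ))) *
    (a n * (2 * ∫ y, ((T * Real.sinc (T * y) : ℝ) : ℂ) * f (x n + y))))
    (fun T ↦ by rw [tsum_mul_left, ← hswap T]) ?_
  refine tendsto_tsum_of_dominated_convergence
    (bound := fun n ↦ ‖(1 / (2 * (π : ℂ)))‖ * (‖a n‖ * (2 * C)))
    ((ha.mul_right _).mul_left _) (fun n ↦ ?_) ?_
  · by_cases h0 : a n = 0
    · simp [h0]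
    obtain ⟨l, r, hl, hr, hlr⟩ := hlim n h0
    have := (((hjordan _ l r hl hr).const_mul 2).const_mul (a n)).const_mul (1 / (2 * (π : ℂ)))
    convert this using 2
    rw [hlr]
    have : (π : ℂ) ≠ 0 := ofReal_ne_zero.2 Real.pi_ne_zero
    field_simp
  · filter_upwards [eventually_gt_atTop 0] with T hT n
    rw [norm_mul, norm_mul, norm_mul]
    gcongr
    · simp
    · exact hC T _ hT

theorem Antitone.boundedVariationOn {f : ℝ → ℝ} (hf : Antitone f) {C : ℝ}
    (h : ∀ x, |f x| ≤ C) : BoundedVariationOn f univ := by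
  have := (hf.neg.monotoneOn univ).boundedVariationOn (C := C) fun x _ ↦ by simpa using h x
  simpa [Function.comp_def] using
    (LipschitzWith.id.neg : LipschitzWith 1 fun x : ℝ ↦ -x).comp_boundedVariationOn this

theorem boundedVariationOn_inv_exp_add_exp {a b : ℝ} (ha : 0 < a) (hb : 0 < b) :
    BoundedVariationOn (fun u ↦ (Real.exp (a * u) + Real.exp (-(b * u)))⁻¹) univ := by
  have hpmono : ∀ k : ℝ, 0 < k → Monotone fun u ↦ Real.exp (k * min u 0) := fun k hk u v h ↦ by
    dsimp only; gcongr
  have hqanti : ∀ k : ℝ, 0 < k → Antitone fun u ↦ Real.exp (-(k * max u 0)) := fun k hk u v h ↦ by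
    dsimp only; gcongr
  have hple : ∀ k u : ℝ, 0 < k → Real.exp (k * min u 0) ≤ 1 := fun k u hk ↦
    Real.exp_le_one_iff.2 (mul_nonpos_of_nonneg_of_nonpos hk.le (min_le_right _ _))
  have hqle : ∀ k u : ℝ, 0 < k → Real.exp (-(k * max u 0)) ≤ 1 := fun k u hk ↦
    Real.exp_le_one_iff.2 (neg_nonpos.2 (mul_nonneg hk.le (le_max_right _ _)))
  have hinv : ∀ z : ℝ, 0 < z → |(1 + z)⁻¹| ≤ 1 := fun z hz ↦ by
    rw [abs_of_pos (by positivity)]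
    exact inv_le_one_of_one_le₀ (by linarith)
  have hk : 0 < a + b := by positivity
  have h1 : BoundedVariationOn (fun u ↦ Real.exp (b * min u 0)) univ :=
    ((hpmono b hb).monotoneOn univ).boundedVariationOn (C := 1) fun u _ ↦ by
      simpa using hple b u hb
  have h2 : BoundedVariationOn (fun u ↦ Real.exp (-(a * max u 0))) univ :=
    (hqanti a ha).boundedVariationOn (C := 1) fun u ↦ by simpa using hqle a u ha
  have h3 : BoundedVariationOn (fun u ↦ (1 + Real.exp ((a + b) * min u 0))⁻¹) univ := by
    refine Antitone.boundedVariationOn (C := 1) (fun u v h ↦ ?_) fun u ↦ hinv _ (Real.exp_pos _)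
    have := hpmono _ hk h
    dsimp only at this ⊢
    gcongr
  have h4 : BoundedVariationOn (fun u ↦ (1 + Real.exp (-((a + b) * max u 0)))⁻¹) univ := by
    refine MonotoneOn.boundedVariationOn (C := 1) (fun u _ v _ h ↦ ?_)
      fun u _ ↦ hinv _ (Real.exp_pos _)
    have := hqanti _ hk h
    dsimp only at this ⊢
    gcongr
  have h5 : BoundedVariationOn (fun _ : ℝ ↦ (2 : ℝ)) univ :=
    (monotone_const.monotoneOn univ).boundedVariationOn (C := 2) fun _ _ ↦ by simp
  convert ((h5.mul h1).mul h2).mul (h3.mul h4) using 1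
  ext u
  simp only [Pi.mul_apply]
  rcases le_total 0 u with hu | hu
  · simp only [min_eq_right hu, max_eq_left hu, mul_zero, Real.exp_zero]
    rw [show -((a + b) * u) = -(a * u) + -(b * u) by ring, Real.exp_add, Real.exp_neg (a * u)]
    field_simp
    ring
  · simp only [min_eq_left hu, max_eq_right hu, mul_zero, neg_zero, Real.exp_zero]
    rw [show (a + b) * u = a * u + b * u by ring, Real.exp_add, Real.exp_neg (b * u)]
    field_simp
    ring

theorem integrable_inv_exp_add_exp {a b : ℝ} (ha : 0 < a) (hb : 0 < b) :
    Integrable fun u ↦ (Real.exp (a * u) + Real.exp (-(b * u)))⁻¹ := by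
  have hcont : Continuous fun u ↦ (Real.exp (a * u) + Real.exp (-(b * u)))⁻¹ :=
    Continuous.inv₀ (by fun_prop) fun u ↦ by positivity
  rw [← integrableOn_univ, ← Iic_union_Ioi (a := (0 : ℝ))]
  refine IntegrableOn.union ?_ ?_
  · refine (integrableOn_exp_mul_Iic hb 0).mono' hcont.aestronglyMeasurable
      (Eventually.of_forall fun u ↦ ?_)
    rw [Real.norm_of_nonneg (by positivity), ← inv_inv (Real.exp (b * u)), ← Real.exp_neg]
    gcongr
    linarith [Real.exp_pos (a * u)]
  · refine (integrableOn_exp_mul_Ioi (neg_lt_zero.2 ha) 0).mono' hcont.aestronglyMeasurable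
      (Eventually.of_forall fun u ↦ ?_)
    rw [Real.norm_of_nonneg (by positivity), neg_mul, Real.exp_neg (a * u)]
    gcongr
    linarith [Real.exp_pos (-(b * u))]

theorem mellin_eq_integral_exp_mul (g : ℝ → ℂ) (c t : ℝ) :
    mellin g (c + t * I) =
      ∫ u : ℝ, cexp (-(t * u * I)) * (Real.exp (-c * u) • g (Real.exp (-u))) := by
  rw [mellin_eq_fourier, Real.fourier_eq']
  refine integral_congr_ae (Eventually.of_forall fun u ↦ ?_)
  have hre : ((c : ℂ) + t * I).re = c := by simp
  have him : ((c : ℂ) + t * I).im = t := by simp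
  have : (-2 * π * inner ℝ u (t / (2 * π)) : ℝ) = -(t * u) := by
    simp only [RCLike.inner_apply, conj_trivial]
    field_simp
  simp only [hre, him, this, smul_eq_mul]
  push_cast
  ring_nf

section ExpChangeOfVariables

variable {ε c : ℝ} {g : ℝ → ℂ}

theorem exp_smul_comp_exp_neg_eq (ε c : ℝ) (g : ℝ → ℂ) (u : ℝ) :
    Real.exp (-c * u) • g (Real.exp (-u)) =
      (Real.exp ((c + ε) * u) + Real.exp (-((1 + ε - c) * u)))⁻¹ •
        (g (Real.exp (-u)) * ((Real.exp (-u) ^ (-ε) + Real.exp (-u) ^ (1 + ε) : ℝ) : ℂ)) := by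
  have h : Real.exp (-u) ^ (-ε) + Real.exp (-u) ^ (1 + ε) =
      Real.exp (-c * u) * (Real.exp ((c + ε) * u) + Real.exp (-((1 + ε - c) * u))) := by
    rw [mul_add, ← Real.exp_mul, ← Real.exp_mul, ← Real.exp_add, ← Real.exp_add]
    ring_nf
  have h0 : ((Real.exp ((c + ε) * u) + Real.exp (-((1 + ε - c) * u)) : ℝ) : ℂ) ≠ 0 :=
    ofReal_ne_zero.2 (by positivity)
  rw [h, real_smul, real_smul, ofReal_mul, ofReal_inv, mul_left_comm (g _), ← mul_assoc,
    mul_comm (ofReal _)⁻¹, mul_assoc, mul_comm (g _), inv_mul_cancel_left₀ h0]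

theorem boundedVariationOn_mul_comp_exp_neg
    (hBV : BoundedVariationOn (fun u : ℝ ↦ g u * ((u ^ (-ε) + u ^ (1 + ε) : ℝ) : ℂ)) (Ioi 0)) :
    BoundedVariationOn (fun u : ℝ ↦
      g (Real.exp (-u)) * ((Real.exp (-u) ^ (-ε) + Real.exp (-u) ^ (1 + ε) : ℝ) : ℂ)) univ :=
  ne_top_of_le_ne_top hBV <| eVariationOn.comp_le_of_antitoneOn _ (fun u ↦ Real.exp (-u))
    (fun _ _ _ _ h ↦ Real.exp_le_exp.2 (neg_le_neg h)) fun u _ ↦ Real.exp_pos (-u)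

theorem boundedVariationOn_exp_smul_comp_exp_neg (hc0 : 0 < c + ε) (hc : c < 1 + ε)
    (hBV : BoundedVariationOn (fun u : ℝ ↦ g u * ((u ^ (-ε) + u ^ (1 + ε) : ℝ) : ℂ)) (Ioi 0)) :
    BoundedVariationOn (fun u ↦ Real.exp (-c * u) • g (Real.exp (-u))) univ := by
  simp only [exp_smul_comp_exp_neg_eq ε]
  exact (boundedVariationOn_inv_exp_add_exp hc0 (sub_pos.2 hc)).fun_smul
    (boundedVariationOn_mul_comp_exp_neg hBV)

theorem integrable_exp_smul_comp_exp_neg (hmeas : Measurable g) (hc0 : 0 < c + ε) (hc : c < 1 + ε)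
    (hBV : BoundedVariationOn (fun u : ℝ ↦ g u * ((u ^ (-ε) + u ^ (1 + ε) : ℝ) : ℂ)) (Ioi 0)) :
    Integrable fun u ↦ Real.exp (-c * u) • g (Real.exp (-u)) := by
  obtain ⟨B, hB⟩ := (boundedVariationOn_mul_comp_exp_neg hBV).exists_norm_le
  refine ((integrable_inv_exp_add_exp hc0 (sub_pos.2 hc)).mul_const B).mono'
    (Measurable.aestronglyMeasurable (by fun_prop)) (Eventually.of_forall fun u ↦ ?_)
  rw [exp_smul_comp_exp_neg_eq ε, norm_smul, Real.norm_of_nonneg (by positivity)]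
  gcongr
  exact hB u

open Topology in
theorem tendsto_exp_smul_comp_exp_neg {y : ℝ} (hy : 0 < y) {gp gm : ℂ}
    (hp : Tendsto g (𝓝[>] y) (𝓝 gp)) (hm : Tendsto g (𝓝[<] y) (𝓝 gm)) (c : ℝ) :
    Tendsto (fun u ↦ Real.exp (-c * u) • g (Real.exp (-u))) (𝓝[<] (-Real.log y))
      (𝓝 (Real.exp (-c * -Real.log y) • gp)) ∧
    Tendsto (fun u ↦ Real.exp (-c * u) • g (Real.exp (-u))) (𝓝[>] (-Real.log y))
      (𝓝 (Real.exp (-c * -Real.log y) • gm)) := by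
  have hexp : Tendsto (fun u ↦ Real.exp (-u)) (𝓝 (-Real.log y)) (𝓝 y) := by
    have : Continuous fun u ↦ Real.exp (-u) := by fun_prop
    simpa [Real.exp_log hy] using this.tendsto (-Real.log y)
  have hc : Tendsto (fun u ↦ Real.exp (-c * u)) (𝓝 (-Real.log y))
      (𝓝 (Real.exp (-c * -Real.log y))) :=
    Continuous.tendsto (by fun_prop) _
  constructor
  · refine (hc.mono_left nhdsWithin_le_nhds).smul (hp.comp ?_)
    refine tendsto_nhdsWithin_of_tendsto_nhds_of_eventually_within _
      (hexp.mono_left nhdsWithin_le_nhds) ?_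
    filter_upwards [self_mem_nhdsWithin] with u hu
    rw [mem_Ioi, ← Real.log_lt_iff_lt_exp hy]
    linarith [mem_Iio.1 hu]
  · refine (hc.mono_left nhdsWithin_le_nhds).smul (hm.comp ?_)
    refine tendsto_nhdsWithin_of_tendsto_nhds_of_eventually_within _
      (hexp.mono_left nhdsWithin_le_nhds) ?_
    filter_upwards [self_mem_nhdsWithin] with u hu
    rw [mem_Iio, ← Real.lt_log_iff_exp_lt hy]
    linarith [mem_Ioi.1 hu]

end ExpChangeOfVariables

namespace ArithmeticFunction

theorem summable_vonMangoldt_mul_rpow_neg {c : ℝ} (hc : 1 < c) :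
    Summable fun n : ℕ ↦ Λ n * (n : ℝ) ^ (-c) := by
  have := (LSeriesSummable_vonMangoldt (s := c) (by simpa using hc)).norm
  refine this.congr fun n ↦ ?_
  rw [LSeries.norm_term_eq]
  split_ifs with h
  · simp [h]
  · rw [ofReal_re, Real.rpow_neg n.cast_nonneg, norm_real,
      Real.norm_of_nonneg vonMangoldt_nonneg, div_eq_mul_inv]

theorem neg_deriv_riemannZeta_div_eq_tsum {c : ℝ} (hc : 1 < c) (t : ℝ) :
    -(deriv riemannZeta (c + t * I) / riemannZeta (c + t * I)) =
      ∑' n : ℕ, ((Λ n * (n : ℝ) ^ (-c) : ℝ) : ℂ) * cexp (t * (-Real.log n : ℝ) * I) := by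
  rw [← neg_div, ← LSeries_vonMangoldt_eq_deriv_riemannZeta_div (by simpa using hc), LSeries]
  refine tsum_congr fun n ↦ ?_
  rw [LSeries.term_def]
  split_ifs with h
  · simp [h]
  · have hn : (n : ℂ) ≠ 0 := Nat.cast_ne_zero.2 h
    rw [ofReal_mul, ofReal_cpow n.cast_nonneg, mul_assoc, div_eq_mul_inv, ← cpow_neg,
      ofReal_natCast, cpow_def_of_ne_zero hn, cpow_def_of_ne_zero hn, ← Complex.exp_add,
      ofReal_neg, ← natCast_log]
    congr 2
    push_cast
    ring

theorem vonMangoldt_prime_pow_succ (p : Nat.Primes) (k : ℕ) :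
    Λ ((p : ℕ) ^ (k + 1)) = Real.log (p : ℕ) := by
  rw [vonMangoldt_apply_pow k.succ_ne_zero, vonMangoldt_apply_prime p.2]

/-- The injection `(p, k) ↦ p ^ (k + 1)`, whose range is the support of `Λ`. -/
theorem primes_pow_succ_injective :
    Function.Injective fun pk : Nat.Primes × ℕ ↦ (pk.1 : ℕ) ^ (pk.2 + 1) :=
  Subtype.val_injective.comp Nat.Primes.prodNatEquiv.injective

theorem vonMangoldt_eq_zero_of_notMem_range {n : ℕ}
    (hn : n ∉ range fun pk : Nat.Primes × ℕ ↦ (pk.1 : ℕ) ^ (pk.2 + 1)) : Λ n = 0 := by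
  by_contra h
  refine hn ⟨Nat.Primes.prodNatEquiv.symm ⟨n, vonMangoldt_ne_zero_iff.1 h⟩, ?_⟩
  exact congrArg Subtype.val (Nat.Primes.prodNatEquiv.apply_symm_apply ⟨n, _⟩)

theorem summable_log_mul_primes_pow {f : ℝ → ℝ} (hf : Summable fun n : ℕ ↦ Λ n * f n) :
    Summable fun pk : Nat.Primes × ℕ ↦
      Real.log (pk.1 : ℕ) * f (((pk.1 : ℕ) : ℝ) ^ (pk.2 + 1)) := by
  refine (hf.comp_injective primes_pow_succ_injective).congr fun pk ↦ ?_
  simp [vonMangoldt_prime_pow_succ]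

theorem tsum_log_mul_primes_pow (f : ℝ → ℂ) :
    ∑' pk : Nat.Primes × ℕ, (Real.log (pk.1 : ℕ) : ℂ) * f (((pk.1 : ℕ) : ℝ) ^ (pk.2 + 1)) =
      ∑' n : ℕ, (Λ n : ℂ) * f n := by
  rw [← primes_pow_succ_injective.tsum_eq (f := fun n : ℕ ↦ (Λ n : ℂ) * f n) fun n hn ↦ ?_]
  · refine tsum_congr fun pk ↦ ?_
    simp [vonMangoldt_prime_pow_succ]
  · by_contra h
    exact hn (by simp [vonMangoldt_eq_zero_of_notMem_range h])

end ArithmeticFunction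

open ArithmeticFunction in
/-- Let `ε > 0` and `g : (0,∞) → ℂ` satisfy condition `(A_ε)` (measurable with
`u ↦ g(u)·(u^(-ε)+u^(1+ε))` of bounded total variation on `(0,∞)`) and condition `(B)`
(at every `u > 0` the one-sided limits exist and `g(u+) + g(u-) = 2 g(u)`).  Then for every
`c` with `1 < c < 1+ε`, the double sum `∑_p log p ∑_{k≥1} g(p^k)` converges absolutely,
and `lim_{T→∞} (1/2πi) ∫_{c-iT}^{c+iT} (-ζ'(s)/ζ(s))·ĝ(s) ds` exists and equals it. -/
theorem explicit_formula_fininte_places (ε : ℝ) (hε : 0 < ε) (g : ℝ → ℂ)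
    (hmeas : Measurable g)
    (hBV : BoundedVariationOn
      (fun u : ℝ => g u * ((u ^ (-ε) + u ^ (1 + ε) : ℝ) : ℂ)) (Ioi 0))
    (hB : ∀ u : ℝ, 0 < u → ∃ gp gm : ℂ,
      Tendsto g (nhdsWithin u (Ioi u)) (nhds gp) ∧
      Tendsto g (nhdsWithin u (Iio u)) (nhds gm) ∧
      gp + gm = 2 * g u)
    (c : ℝ) (hc1 : 1 < c) (hc2 : c < 1 + ε) :
    Summable
      (fun pk : Nat.Primes × ℕ =>
        Real.log (pk.1 : ℕ) * ‖g (((pk.1 : ℕ) : ℝ) ^ (pk.2 + 1))‖) ∧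
    Tendsto
      (fun T : ℝ =>
        (1 / (2 * (π : ℂ))) *
          ∫ t in (-T)..T,
            (-(deriv riemannZeta (c + t * I) / riemannZeta (c + t * I))) *
              mellin g (c + t * I))
      atTop
      (nhds (∑' pk : Nat.Primes × ℕ,
        ((Real.log (pk.1 : ℕ) : ℂ) * g (((pk.1 : ℕ) : ℝ) ^ (pk.2 + 1))))) := by
  have hc0 : 0 < c + ε := by linarith
  have hφBV := boundedVariationOn_exp_smul_comp_exp_neg hc0 hc2 hBV
  have hφint := integrable_exp_smul_comp_exp_neg hmeas hc0 hc2 hBV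
  have ha := summable_vonMangoldt_mul_rpow_neg hc1
  have hexp : ∀ n : ℕ, n ≠ 0 → Real.exp (-c * -Real.log n) = ((n : ℝ) ^ (-c))⁻¹ := fun n hn ↦ by
    rw [← Real.rpow_neg n.cast_nonneg, Real.rpow_def_of_pos (by positivity)]
    ring_nf
  have hval : ∀ n : ℕ, ((Λ n * (n : ℝ) ^ (-c) : ℝ) : ℂ) *
      (Real.exp (-c * -Real.log n) • g (Real.exp (- -Real.log n))) = Λ n * g n := fun n ↦ by
    rcases eq_or_ne n 0 with rfl | hn
    · simp
    have hn' : (0 : ℝ) < n := by positivity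
    have : (((n : ℝ) ^ (-c) : ℝ) : ℂ) ≠ 0 := ofReal_ne_zero.2 (by positivity)
    rw [hexp n hn, neg_neg, Real.exp_log hn', real_smul, ofReal_mul, ofReal_inv]
    field_simp
  constructor
  · refine summable_log_mul_primes_pow (f := fun x ↦ ‖g x‖) ?_
    obtain ⟨B, hB⟩ := hφBV.exists_norm_le
    refine (ha.mul_right B).of_nonneg_of_le
      (fun n ↦ mul_nonneg vonMangoldt_nonneg (norm_nonneg _)) fun n ↦ ?_
    have hnn : 0 ≤ Λ n * (n : ℝ) ^ (-c) := mul_nonneg vonMangoldt_nonneg (by positivity)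
    calc Λ n * ‖g n‖ = ‖(Λ n : ℂ) * g n‖ := by
          rw [norm_mul, norm_real, Real.norm_of_nonneg vonMangoldt_nonneg]
      _ ≤ Λ n * (n : ℝ) ^ (-c) * B := by
          rw [← hval, norm_mul, norm_real, Real.norm_of_nonneg hnn]
          gcongr
          exact hB _
  · rw [tsum_log_mul_primes_pow]
    simp only [neg_deriv_riemannZeta_div_eq_tsum hc1, mellin_eq_integral_exp_mul, ← hval]
    refine hφBV.tendsto_integral_tsum_exp_mul hφint
      (a := fun n ↦ ((Λ n * (n : ℝ) ^ (-c) : ℝ) : ℂ)) ?_ (fun n ↦ -Real.log n) fun n hn ↦ ?_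
    · simpa only [norm_real] using ha.norm
    · have hn0 : n ≠ 0 := by
        rintro rfl
        simp at hn
      have hn' : (0 : ℝ) < n := by positivity
      obtain ⟨gp, gm, hp, hm, hpm⟩ := hB n hn'
      obtain ⟨hl, hr⟩ := tendsto_exp_smul_comp_exp_neg hn' hp hm c
      refine ⟨_, _, hl, hr, ?_⟩
      rw [← smul_add, hpm, neg_neg, Real.exp_log hn', mul_smul_comm]
end

section
/- Fix X > 1 and let g : (0,∞) → ℂ be the step function with g(u) = 1 for 1 < u < X, g(1) = g(X) = 1/2, and g(u) = 0 for all other u; its Mellin transform is ĝ(s) = (X^s − 1)/s. Then for every c with 0 < c < 1 the limit W_r(g) = lim_{T→∞} (1/2πi) ∫_{c−iT}^{c+iT} (−L_r′(s)/L_r(s))·(ĝ(s) + ĝ(1−s)) ds exists and equals (log(π) + γ)/2 + log(X) + (1/2)·log(1 − X^{−2}). -/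
open scoped Classical

open Complex MeasureTheory Set Filter intervalIntegral

open scoped Real

/-- The archimedean local factor `L_r(s) = π^(-s/2) Γ(s/2)`. -/
noncomputable def Lr (s : ℂ) : ℂ := (π : ℂ) ^ (-s / 2) * Complex.Gamma (s / 2)

theorem exp_sum_eq_GammaSeq {z : ℂ} (hz : 0 < z.re) {n : ℕ} (hn : n ≠ 0) :
    cexp (∑ k ∈ Finset.range n, (z / (k + 1) - Complex.log (1 + z / (k + 1)))) =
      cexp (((harmonic n - Real.log n : ℝ) : ℂ) * z) * (z * GammaSeq z n) := by
  have hk : ∀ k : ℕ, (k + 1 : ℂ) ≠ 0 := fun k => Nat.cast_add_one_ne_zero k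
  have hkz : ∀ k : ℕ, z + (k + 1) ≠ 0 := fun k h => by
    have := congrArg Complex.re h
    simp at this
    linarith [k.cast_nonneg (α := ℝ)]
  have hz0 : z ≠ 0 := by rintro rfl; simp at hz
  have h1 : ∀ k : ℕ, cexp (z / (k + 1) - Complex.log (1 + z / (k + 1))) =
      cexp (z / (k + 1)) * ((k + 1) / (z + (k + 1))) := fun k => by
    have h2 : 1 + z / (k + 1) = (z + (k + 1)) / (k + 1) := by
      field_simp [hk k]; ring
    rw [Complex.exp_sub, h2, Complex.exp_log (div_ne_zero (hkz k) (hk k)), div_div_eq_mul_div,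
      mul_div_assoc]
  have h3 : ∏ k ∈ Finset.range n, (k + 1 : ℂ) = (n.factorial : ℂ) := by
    rw [← Finset.prod_range_add_one_eq_factorial]; push_cast; rfl
  have h4 : ∑ k ∈ Finset.range n, z / (k + 1 : ℂ) = (harmonic n : ℝ) * z := by
    rw [harmonic]; push_cast; rw [Finset.sum_mul]
    exact Finset.sum_congr rfl fun k _ => by rw [div_eq_inv_mul]
  have hn' : (n : ℂ) ≠ 0 := Nat.cast_ne_zero.mpr hn
  rw [Complex.exp_sum, Finset.prod_congr rfl fun k _ => h1 k, Finset.prod_mul_distrib,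
    ← Complex.exp_sum, h4, Finset.prod_div_distrib, h3, GammaSeq, Finset.prod_range_succ',
    Complex.cpow_def_of_ne_zero hn', Nat.cast_zero, add_zero, ofReal_sub, sub_mul,
    Complex.exp_sub, ofReal_log n.cast_nonneg, ofReal_natCast]
  have h5 : ∏ k ∈ Finset.range n, (z + (k + 1)) ≠ 0 := Finset.prod_ne_zero_iff.mpr fun k _ => hkz k
  push_cast
  have h6 := Complex.exp_ne_zero (Complex.log n * z)
  field_simp

theorem hasSum_deriv_Gamma_div_Gamma {z : ℂ} (hz : 0 < z.re) :
    HasSum (fun n : ℕ => z / ((n + 1) * (n + 1 + z)))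
      (deriv Complex.Gamma z / Complex.Gamma z + Real.eulerMascheroniConstant + 1 / z) := by
  set f : ℕ → ℂ → ℂ := fun k w => w / (k + 1) - Complex.log (1 + w / (k + 1)) with hf
  set f' : ℕ → ℂ → ℂ := fun k w => w / ((k + 1) * (k + 1 + w)) with hf'
  set R : ℝ := ‖z‖ + 1
  set U : Set ℂ := Metric.ball 0 R ∩ {w | -(1 / 2) < w.re} with hU
  have hUo : IsOpen U := Metric.isOpen_ball.inter (isOpen_lt continuous_const continuous_re)
  have hUc : IsPreconnected U :=
    ((convex_ball 0 R).inter (convex_halfSpace_re_gt _)).isPreconnected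
  have h0U : (0 : ℂ) ∈ U := ⟨by simp [R]; positivity, by simp⟩
  have hzU : z ∈ U := ⟨by simp [R], by simp; linarith⟩
  have hk : ∀ k : ℕ, (k + 1 : ℂ) ≠ 0 := fun k => Nat.cast_add_one_ne_zero k
  have hre : ∀ (k : ℕ) w, w ∈ U → (k + 1) / 2 ≤ (k + 1 + w).re := fun k w hw => by
    have := hw.2
    simp only [mem_ofPred_eq] at this
    simp
    have : (0:ℝ) ≤ k := k.cast_nonneg
    linarith
  have hkw : ∀ (k : ℕ) w, w ∈ U → (k + 1 + w) ≠ 0 := fun k w hw h => by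
    have := hre k w hw
    rw [h] at this
    simp at this
    have : (0:ℝ) ≤ k := k.cast_nonneg
    linarith
  have hd : ∀ (k : ℕ) w, w ∈ U → HasDerivAt (f k) (f' k w) w := fun k w hw => by
    have hs : 1 + w / (k + 1) ∈ slitPlane := by
      left
      have e : 1 + w / (k + 1) = ((1 / (k + 1 : ℝ) : ℝ) : ℂ) * (k + 1 + w) := by
        push_cast; field_simp [hk k]
      rw [e, re_ofReal_mul]
      have := hre k w hw
      have : 0 < (k + 1 + w).re := lt_of_lt_of_le (by positivity) this
      positivity
    have h1 : HasDerivAt (fun w : ℂ => w / (k + 1 : ℂ)) (1 / (k + 1)) w :=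
      (hasDerivAt_id w).div_const _
    convert! h1.sub ((h1.const_add 1).clog hs) using 1
    simp only [hf']
    have := hkw k w hw
    have h2 : 1 + w / (k + 1 : ℂ) = (k + 1 + w) / (k + 1) := by field_simp [hk k]
    rw [h2]
    field_simp [hk k]
    ring
  have hb : ∀ (k : ℕ) w, w ∈ U → ‖f' k w‖ ≤ 2 * R * (1 / ((k + 1 : ℕ) : ℝ) ^ 2) := fun k w hw => by
    have h1 : ((k : ℝ) + 1) / 2 ≤ ‖(k + 1 + w : ℂ)‖ := (hre k w hw).trans (re_le_norm _)
    have h2 : ‖w‖ ≤ R := by have := hw.1; simp at this; exact this.le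
    have h3 : ‖(k + 1 : ℂ)‖ = k + 1 := by
      rw [← Nat.cast_add_one, norm_natCast]; push_cast; rfl
    simp only [hf', norm_div, norm_mul, h3]
    calc _ ≤ R / (((k : ℝ) + 1) * ((k + 1) / 2)) := by gcongr
      _ = _ := by push_cast; field_simp
  have hu : Summable fun k : ℕ => 2 * R * (1 / ((k + 1 : ℕ) : ℝ) ^ 2) :=
    ((summable_nat_add_iff 1).mpr (Real.summable_one_div_nat_pow.mpr one_lt_two)).mul_left _
  have hs0 : Summable fun k => f k 0 := by simp [hf, summable_zero]
  have hD := hasDerivAt_tsum_of_isPreconnected hu hUo hUc hd hb h0U hs0 hzU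
  have hS : Summable fun k => f' k z := .of_norm_bounded hu fun k => hb k z hzU
  have key : ∀ w ∈ U, 0 < w.re → cexp (∑' k, f k w) =
      cexp (Real.eulerMascheroniConstant * w) * (w * Complex.Gamma w) := fun w hw hw0 => by
    have h1 := (summable_of_summable_hasDerivAt_of_isPreconnected hu hUo hUc hd hb h0U hs0
      hw).hasSum.tendsto_sum_nat
    refine tendsto_nhds_unique ((Complex.continuous_exp.tendsto _).comp h1) ?_
    have h2 : Tendsto (fun n : ℕ => cexp (((harmonic n - Real.log n : ℝ) : ℂ) * w) *
        (w * GammaSeq w n)) atTop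
        (nhds (cexp (Real.eulerMascheroniConstant * w) * (w * Complex.Gamma w))) := by
      refine Tendsto.mul ?_ ((GammaSeq_tendsto_Gamma w).const_mul w)
      exact (Complex.continuous_exp.tendsto _).comp
        (((continuous_ofReal.tendsto _).comp Real.tendsto_harmonic_sub_log).mul_const w)
    refine h2.congr' ?_
    filter_upwards [eventually_ne_atTop 0] with n hn
    exact (exp_sum_eq_GammaSeq hw0 hn).symm
  have hz0 : z ≠ 0 := by rintro rfl; simp at hz
  have hG : Complex.Gamma z ≠ 0 := Gamma_ne_zero_of_re_pos hz
  have hGd : HasDerivAt Complex.Gamma (deriv Complex.Gamma z) z :=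
    (differentiableAt_Gamma z fun m h => by
      rw [h] at hz; simp at hz; have : (0:ℝ) ≤ m := m.cast_nonneg
      linarith).hasDerivAt
  have hL := hD.cexp
  have hR := (((hasDerivAt_id z).const_mul (Real.eulerMascheroniConstant : ℂ)).cexp).mul
    ((hasDerivAt_id z).mul hGd)
  have hev : (fun w => cexp (∑' k, f k w)) =ᶠ[nhds z] fun w =>
      cexp (Real.eulerMascheroniConstant * w) * (w * Complex.Gamma w) := by
    filter_upwards [hUo.mem_nhds hzU, (isOpen_lt continuous_const continuous_re).mem_nhds hz]
      with w hw hw0 using key w hw hw0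
  have e := (hL.congr_of_eventuallyEq hev.symm).unique hR
  have e2 : ∑' k, f' k z =
      deriv Complex.Gamma z / Complex.Gamma z + Real.eulerMascheroniConstant + 1 / z := by
    rw [key z hzU hz] at e
    simp only [id, Pi.mul_apply, mul_one, one_mul] at e
    have h6 := Complex.exp_ne_zero (Real.eulerMascheroniConstant * z)
    field_simp
    apply mul_left_cancel₀ h6
    linear_combination e
  exact e2 ▸ hS.hasSum

/-- The truncated Perron integral `∫_{-T}^{T} e^{iLt} / (a + it) dt`. -/
noncomputable def perron (L a T : ℝ) : ℂ :=
  ∫ t in (-T)..T, cexp (L * t * I) / (a + t * I)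

theorem add_mul_I_ne_zero {a : ℝ} (ha : 0 < a) (t : ℝ) : (a + t * I : ℂ) ≠ 0 := fun h => by
  have := congrArg Complex.re h
  simp at this
  exact ha.ne' this

theorem norm_add_mul_I_sq (a t : ℝ) : ‖(a + t * I : ℂ)‖ ^ 2 = a ^ 2 + t ^ 2 := by
  rw [← normSq_eq_norm_sq, normSq_add_mul_I]

theorem le_norm_add_mul_I (a t : ℝ) : a ≤ ‖(a + t * I : ℂ)‖ := by
  simpa using re_le_norm (a + t * I : ℂ)

theorem abs_le_norm_add_mul_I (a t : ℝ) : |t| ≤ ‖(a + t * I : ℂ)‖ := by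
  simpa using abs_im_le_norm (a + t * I : ℂ)

theorem norm_exp_mul_div_sq (L a t : ℝ) :
    ‖cexp (L * t * I) / (a + t * I) ^ 2‖ = (a ^ 2 + t ^ 2)⁻¹ := by
  rw [norm_div, norm_pow, norm_add_mul_I_sq, ← ofReal_mul, norm_exp_ofReal_mul_I, one_div]

theorem integrable_inv_sq_add_sq {a : ℝ} (ha : 0 < a) :
    Integrable fun t : ℝ => (a ^ 2 + t ^ 2)⁻¹ := by
  convert! (integrable_inv_one_add_sq.comp_div ha.ne').const_mul (a ^ 2)⁻¹ using 1
  ext t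
  rw [← mul_inv]
  congr 1
  field_simp

theorem continuous_exp_mul_I (L : ℝ) : Continuous fun t : ℝ => cexp (L * t * I) := by
  fun_prop

theorem continuous_perron_integrand (L : ℝ) {a : ℝ} (ha : 0 < a) :
    Continuous fun t : ℝ => cexp (L * t * I) / (a + t * I) :=
  (continuous_exp_mul_I L).div (by fun_prop) (add_mul_I_ne_zero ha)

theorem continuous_exp_mul_div_sq (L : ℝ) {a : ℝ} (ha : 0 < a) :
    Continuous fun t : ℝ => cexp (L * t * I) / (a + t * I) ^ 2 :=
  (continuous_exp_mul_I L).div (by fun_prop) fun t => pow_ne_zero 2 (add_mul_I_ne_zero ha t)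

theorem integrable_exp_mul_div_sq (L : ℝ) {a : ℝ} (ha : 0 < a) :
    Integrable fun t : ℝ => cexp (L * t * I) / (a + t * I) ^ 2 :=
  (integrable_inv_sq_add_sq ha).mono' (continuous_exp_mul_div_sq L ha).aestronglyMeasurable
    (ae_of_all _ fun t => (norm_exp_mul_div_sq L a t).le)

theorem hasMellin_max_neg_log {s : ℂ} (hs : 0 < s.re) :
    HasMellin (fun t : ℝ => ((max (-Real.log t) 0 : ℝ) : ℂ)) s (1 / s ^ 2) := by
  set f : ℝ → ℂ := indicator (Ioc 0 1) fun _ => 1 with hf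
  have hs0 : s ≠ 0 := by rintro rfl; simp at hs
  have hfc : LocallyIntegrableOn f (Ioi 0) :=
    (((integrableOn_const (by simp)).integrable_indicator
      measurableSet_Ioc).locallyIntegrable).locallyIntegrableOn _
  have htop : f =O[atTop] (· ^ (-(s.re + 1)) : ℝ → ℝ) := by
    refine (Asymptotics.isBigO_zero _ _).congr' ?_ EventuallyEq.rfl
    filter_upwards [eventually_gt_atTop 1] with t ht
    simp [hf, ht]
  have hbot : f =O[nhdsWithin 0 (Ioi 0)] (· ^ (-(0 : ℝ)) : ℝ → ℝ) := by
    refine Asymptotics.IsBigO.of_bound 1 (Eventually.of_forall fun t => ?_)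
    simp only [hf, indicator]
    split_ifs <;> simp
  obtain ⟨hc, hd⟩ := mellin_hasDerivAt_of_isBigO_rpow hfc htop (by linarith) hbot hs
  have hev : mellin f =ᶠ[nhds s] fun w => w⁻¹ := by
    filter_upwards [(isOpen_lt continuous_const continuous_re).mem_nhds hs] with w hw
    rw [(hasMellin_one_Ioc hw).2, one_div]
  have hval := (hd.congr_of_eventuallyEq hev.symm).unique (hasDerivAt_inv hs0)
  have heq : EqOn (fun t : ℝ => ((max (-Real.log t) 0 : ℝ) : ℂ))
      (fun t => -(Real.log t • f t)) (Ioi 0) := fun t ht => by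
    rw [mem_Ioi] at ht
    simp only [hf, indicator, mem_Ioc, ht, true_and]
    split_ifs with h
    · simp [max_eq_left (neg_nonneg.mpr (Real.log_nonpos ht.le h))]
    · simp [Real.log_nonneg (not_le.mp h).le]
  constructor
  · refine (integrableOn_congr_fun (fun t ht => ?_) measurableSet_Ioi).mpr hc.neg
    simp only [heq ht, smul_neg, Pi.neg_apply]
  · have : mellin (fun t : ℝ => ((max (-Real.log t) 0 : ℝ) : ℂ)) s
        = -mellin (fun t => Real.log t • f t) s := by
      rw [mellin, mellin, ← MeasureTheory.integral_neg]
      refine setIntegral_congr_fun measurableSet_Ioi fun t ht => ?_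
      simp only [heq ht, smul_neg]
    rw [this, hval, neg_neg, one_div]

theorem integral_exp_mul_div_sq (L : ℝ) {a : ℝ} (ha : 0 < a) :
    ∫ t : ℝ, cexp (L * t * I) / (a + t * I) ^ 2 =
      ((2 * π * (max L 0 * Real.exp (-(a * L))) : ℝ) : ℂ) := by
  have hre : ∀ t : ℝ, 0 < (a + t * I : ℂ).re := fun t => by simpa using ha
  have hv : VerticalIntegrable (mellin fun t : ℝ => ((max (-Real.log t) 0 : ℝ) : ℂ)) a := by
    refine (integrable_exp_mul_div_sq 0 ha).congr (ae_of_all _ fun t => ?_)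
    simp [(hasMellin_max_neg_log (hre t)).2]
  have hcont : ContinuousAt (fun t : ℝ => ((max (-Real.log t) 0 : ℝ) : ℂ)) (Real.exp (-L)) :=
    continuous_ofReal.continuousAt.comp
      ((Real.continuousAt_log (Real.exp_pos _).ne').neg.max continuousAt_const)
  have h := mellinInv_mellin_eq a _ (Real.exp_pos (-L)) (hasMellin_max_neg_log (by simpa using ha)).1
    hv hcont
  have hint : ∀ t : ℝ, ((Real.exp (-L) : ℝ) : ℂ) ^ (-(a + t * I : ℂ)) •
      mellin (fun t : ℝ => ((max (-Real.log t) 0 : ℝ) : ℂ)) (a + t * I) =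
      ((Real.exp (a * L) : ℝ) : ℂ) * (cexp (L * t * I) / (a + t * I) ^ 2) := fun t => by
    rw [(hasMellin_max_neg_log (hre t)).2, cpow_def_of_ne_zero (by simp), ← ofReal_log
      (Real.exp_pos _).le, Real.log_exp, smul_eq_mul, ofReal_exp, mul_one_div, mul_div_assoc',
      ← Complex.exp_add]
    congr 2
    push_cast
    ring
  simp only [mellinInv, hint, Real.log_exp, neg_neg] at h
  rw [MeasureTheory.integral_const_mul, real_smul] at h
  have he : (Real.exp (a * L) : ℂ) * Real.exp (-(a * L)) = 1 := by
    rw [← ofReal_mul, ← Real.exp_add]; simp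
  have hpi : (π : ℂ) ≠ 0 := ofReal_ne_zero.mpr Real.pi_ne_zero
  rw [ofReal_mul, ofReal_mul (max L 0), ← h]
  generalize (∫ t : ℝ, cexp (L * t * I) / (a + t * I) ^ 2) = J
  push_cast at he ⊢
  field_simp
  linear_combination (-J) * he

theorem mul_perron (L : ℝ) {a : ℝ} (ha : 0 < a) (T : ℝ) :
    L * perron L a T = (∫ t in (-T)..T, cexp (L * t * I) / (a + t * I) ^ 2) -
      I * (cexp (L * T * I) / (a + T * I) - cexp (L * (-T : ℝ) * I) / (a + (-T : ℝ) * I)) := by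
  have hd : ∀ t : ℝ, HasDerivAt (fun t : ℝ => cexp (L * t * I) / (a + t * I))
      (I * (L * (cexp (L * t * I) / (a + t * I)) - cexp (L * t * I) / (a + t * I) ^ 2)) t :=
    fun t => by
    have h1 : HasDerivAt (fun t : ℝ => (t : ℂ)) 1 t := ofRealCLM.hasDerivAt
    have h2 := (((h1.const_mul (L : ℂ)).mul_const I).cexp).div
      ((h1.mul_const I).const_add (a : ℂ)) (add_mul_I_ne_zero ha t)
    convert! h2 using 1
    have := add_mul_I_ne_zero ha t
    field_simp
  have hi1 := ((continuous_perron_integrand L ha).intervalIntegrable (μ := volume) (-T) T)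
  have hi2 := ((continuous_exp_mul_div_sq L ha).intervalIntegrable (μ := volume) (-T) T)
  have h := integral_eq_sub_of_hasDerivAt (fun t _ => hd t)
    (((hi1.const_mul (L : ℂ)).sub hi2).const_mul I)
  rw [intervalIntegral.integral_const_mul, intervalIntegral.integral_sub (hi1.const_mul _) hi2,
    intervalIntegral.integral_const_mul] at h
  rw [perron, ← h]
  linear_combination (L * (∫ t in (-T)..T, cexp (L * t * I) / (a + t * I)) -
    ∫ t in (-T)..T, cexp (L * t * I) / (a + t * I) ^ 2) * I_sq

theorem norm_perron_le {L : ℝ} (hL : L ≠ 0) {a : ℝ} (ha : 0 < a) {T : ℝ} (hT : 0 ≤ T) :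
    ‖perron L a T‖ ≤ (π + 2) / |L| / a := by
  have h1 : ‖∫ t in (-T)..T, cexp (L * t * I) / (a + t * I) ^ 2‖ ≤ π / a := by
    refine (intervalIntegral.norm_integral_le_integral_norm (by linarith)).trans ?_
    simp_rw [norm_exp_mul_div_sq]
    rw [integral_inv_sq_add_sq ha.ne', inv_mul_eq_div]
    gcongr
    linarith [Real.arctan_lt_pi_div_two (T / a), Real.neg_pi_div_two_lt_arctan (-T / a)]
  have h2 : ∀ t : ℝ, ‖cexp (L * t * I) / (a + t * I)‖ ≤ 1 / a := fun t => by
    rw [norm_div, ← ofReal_mul, norm_exp_ofReal_mul_I]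
    exact one_div_le_one_div_of_le ha (le_norm_add_mul_I a t)
  have h3 := congrArg norm (mul_perron L ha T)
  rw [norm_mul, norm_real, Real.norm_eq_abs] at h3
  have h4 : |L| * ‖perron L a T‖ ≤ (π + 2) / a := by
    rw [h3]
    refine (norm_sub_le _ _).trans ?_
    rw [norm_mul, norm_I, one_mul]
    calc _ ≤ π / a + (1 / a + 1 / a) :=
          add_le_add h1 ((norm_sub_le _ _).trans (add_le_add (h2 _) (h2 _)))
      _ = _ := by ring
  rw [div_right_comm, le_div_iff₀ (abs_pos.mpr hL), mul_comm]
  exact h4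

theorem tendsto_integral_exp_mul_div_sq (L : ℝ) {a : ℝ} (ha : 0 < a) :
    Tendsto (fun T : ℝ => ∫ t in (-T)..T, cexp (L * t * I) / (a + t * I) ^ 2) atTop
      (nhds ((2 * π * (max L 0 * Real.exp (-(a * L))) : ℝ) : ℂ)) := by
  rw [← integral_exp_mul_div_sq L ha]
  exact intervalIntegral_tendsto_integral (integrable_exp_mul_div_sq L ha)
    tendsto_neg_atTop_atBot tendsto_id

theorem tendsto_perron {L : ℝ} (hL : L ≠ 0) {a : ℝ} (ha : 0 < a) :
    Tendsto (perron L a) atTop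
      (nhds ((2 * π * (max L 0 / L * Real.exp (-(a * L))) : ℝ) : ℂ)) := by
  have hz : ∀ u : ℝ → ℝ, Tendsto (fun T => |u T|) atTop atTop →
      Tendsto (fun T => cexp (L * u T * I) / (a + u T * I)) atTop (nhds 0) := fun u hu => by
    refine squeeze_zero_norm' ?_ (tendsto_inv_atTop_zero.comp hu)
    filter_upwards [hu.eventually_gt_atTop 0] with T hT
    rw [norm_div, ← ofReal_mul, norm_exp_ofReal_mul_I, one_div, Function.comp]
    exact inv_anti₀ hT (abs_le_norm_add_mul_I a _)
  have h := (tendsto_integral_exp_mul_div_sq L ha).sub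
    (((hz (fun T => T) tendsto_abs_atTop_atTop).sub
      (hz (fun T => -T) (by simpa using tendsto_abs_atTop_atTop))).const_mul I)
  have hL' : (L : ℂ) ≠ 0 := ofReal_ne_zero.mpr hL
  refine (Tendsto.congr (fun T => ?_) (h.const_mul (L : ℂ)⁻¹)).trans_eq ?_
  · rw [← mul_perron L ha T, inv_mul_cancel_left₀ hL']
  · congr 1
    push_cast
    field_simp
    ring

theorem perron_zero {a : ℝ} (ha : 0 < a) (T : ℝ) :
    perron 0 a T = ((2 * Real.arctan (T / a) : ℝ) : ℂ) := by
  have hp : ∀ t : ℝ, 0 < a ^ 2 + t ^ 2 := fun t => by positivity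
  have hd : ∀ t : ℝ, HasDerivAt (fun t : ℝ => ((Real.arctan (t / a) : ℝ) : ℂ) -
      I / 2 * ((Real.log (a ^ 2 + t ^ 2) : ℝ) : ℂ)) (cexp ((0 : ℝ) * t * I) / (a + t * I)) t :=
    fun t => by
    have h1 : HasDerivAt (fun t : ℝ => Real.arctan (t / a)) (a / (a ^ 2 + t ^ 2)) t := by
      convert! ((hasDerivAt_id t).div_const a).arctan using 1
      have := (hp t).ne'
      simp only [id]
      field_simp
    have h2 : HasDerivAt (fun t : ℝ => Real.log (a ^ 2 + t ^ 2)) (2 * t / (a ^ 2 + t ^ 2)) t := by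
      convert! (((hasDerivAt_id t).pow 2).const_add (a ^ 2)).log (hp t).ne' using 1
      simp
    convert! h1.ofReal_comp.sub (h2.ofReal_comp.const_mul (I / 2)) using 1
    have h3 := add_mul_I_ne_zero ha t
    have h4 : (a ^ 2 + t ^ 2 : ℂ) ≠ 0 := by exact_mod_cast (hp t).ne'
    push_cast
    simp only [zero_mul, Complex.exp_zero]
    field_simp
    linear_combination (t ^ 2 : ℂ) * I_sq
  rw [perron, integral_eq_sub_of_hasDerivAt (fun t _ => hd t)
    ((continuous_perron_integrand 0 ha).intervalIntegrable _ _), neg_div, Real.arctan_neg,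
    neg_sq]
  push_cast
  ring

theorem norm_perron_zero_le {a : ℝ} (ha : 0 < a) (T : ℝ) : ‖perron 0 a T‖ ≤ π := by
  rw [perron_zero ha, norm_real, Real.norm_eq_abs, abs_le]
  constructor <;> linarith [Real.arctan_lt_pi_div_two (T / a), Real.neg_pi_div_two_lt_arctan (T / a)]

theorem tendsto_perron_zero {a : ℝ} (ha : 0 < a) : Tendsto (perron 0 a) atTop (nhds (π : ℂ)) := by
  have h := ((continuous_ofReal.tendsto _).comp
    (((Real.tendsto_arctan_atTop.mono_right nhdsWithin_le_nhds).comp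
      (tendsto_id.atTop_div_const ha)).const_mul 2))
  refine (Tendsto.congr (fun T => (perron_zero ha T).symm) h).trans_eq ?_
  congr 1
  push_cast
  ring

theorem hasSum_deriv_Lr_div_Lr {s : ℂ} (hs : 0 < s.re) :
    HasSum (fun n : ℕ => s / (2 * (n + 1) * (2 * (n + 1) + s)))
      (deriv Lr s / Lr s + (Real.log π + Real.eulerMascheroniConstant) / 2 + 1 / s) := by
  have hs2 : 0 < (s / 2).re := by simpa using hs
  have hs0 : s ≠ 0 := by rintro rfl; simp at hs
  have hpi : (π : ℂ) ≠ 0 := ofReal_ne_zero.mpr Real.pi_ne_zero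
  have hG : Complex.Gamma (s / 2) ≠ 0 := Gamma_ne_zero_of_re_pos hs2
  have hGd : HasDerivAt Complex.Gamma (deriv Complex.Gamma (s / 2)) (s / 2) :=
    (differentiableAt_Gamma _ fun m h => by
      rw [h] at hs2; simp at hs2; linarith [m.cast_nonneg (α := ℝ)]).hasDerivAt
  have hid : HasDerivAt (fun w : ℂ => w / 2) (1 / 2) s := (hasDerivAt_id s).div_const 2
  have hd1 := ((hasDerivAt_id s).neg.div_const 2).const_cpow (c := (π : ℂ)) (Or.inl hpi)
  have hd : HasDerivAt Lr _ s := hd1.mul (hGd.comp s hid)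
  have hc : (π : ℂ) ^ (-s / 2) ≠ 0 := by simp [cpow_eq_zero_iff, hpi]
  have hlog : deriv Lr s / Lr s =
      -(Real.log π / 2) + deriv Complex.Gamma (s / 2) / Complex.Gamma (s / 2) / 2 := by
    rw [hd.deriv, Lr, ofReal_log Real.pi_pos.le]
    simp only [id, Pi.neg_apply]
    field_simp
  convert! (hasSum_deriv_Gamma_div_Gamma hs2).mul_left (1 / 2) using 1
  · ext n
    have h1 : (n + 1 : ℂ) ≠ 0 := Nat.cast_add_one_ne_zero n
    have h2 : (2 * (n + 1) + s : ℂ) ≠ 0 := fun h => by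
      have := congrArg Complex.re h
      simp at this
      linarith [n.cast_nonneg (α := ℝ)]
    have h3 : (n + 1 + s / 2 : ℂ) = (2 * (n + 1) + s) / 2 := by ring
    rw [h3]
    field_simp
  · rw [hlog]
    field_simp
    ring

theorem mellin_step {X : ℝ} (hX : 1 < X) {s : ℂ} (hs : 0 < s.re) :
    mellin (fun u : ℝ =>
      if 1 < u ∧ u < X then (1 : ℂ) else if u = 1 ∨ u = X then 1 / 2 else 0) s =
      ((X : ℂ) ^ s - 1) / s := by
  have h1 : mellin (fun u : ℝ =>
      if 1 < u ∧ u < X then (1 : ℂ) else if u = 1 ∨ u = X then 1 / 2 else 0) s =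
      ∫ u in Ioi (0 : ℝ), (Ioc 1 X).indicator (fun u : ℝ => (u : ℂ) ^ (s - 1)) u := by
    refine integral_congr_ae ((ae_restrict_of_ae ?_))
    filter_upwards [compl_mem_ae_iff.mpr (measure_singleton (1 : ℝ)),
      compl_mem_ae_iff.mpr (measure_singleton X)] with u h1 h2
    have h1 : u ≠ 1 := h1
    have h2 : u ≠ X := h2
    simp only [h1, h2, indicator, mem_Ioc, or_self, if_false, smul_eq_mul, h2.le_iff_lt]
    split_ifs <;> simp
  rw [h1, setIntegral_indicator measurableSet_Ioc, inter_eq_self_of_subset_right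
    (show Ioc 1 X ⊆ Ioi 0 from fun u hu => zero_lt_one.trans hu.1), ← integral_of_le hX.le,
    integral_cpow (Or.inl (by simpa using hs)), sub_add_cancel, ofReal_one, one_cpow]

/-- The kernel `e^{iLt} / (a + it)` of the truncated Perron integral. -/
noncomputable def perronKernel (L a t : ℝ) : ℂ := cexp (L * t * I) / (a + t * I)

theorem continuous_perronKernel (L : ℝ) {a : ℝ} (ha : 0 < a) : Continuous (perronKernel L a) :=
  continuous_perron_integrand L ha

theorem integral_perronKernel (L a T : ℝ) : ∫ t in (-T)..T, perronKernel L a t = perron L a T :=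
  rfl

theorem integral_perronKernel_neg (L a T : ℝ) :
    ∫ t in (-T)..T, perronKernel L a (-t) = perron L a T := by
  rw [integral_comp_neg (perronKernel L a), neg_neg, integral_perronKernel]

/-- The Mellin transform of `g + g^τ` for the step function `g` on `(1, X)`. -/
noncomputable def stepTransform (X : ℝ) (s : ℂ) : ℂ :=
  ((X : ℂ) ^ s - 1) / s + ((X : ℂ) ^ (1 - s) - 1) / (1 - s)

theorem cpow_vertical {X : ℝ} (hX : 0 < X) (c t : ℝ) :
    (X : ℂ) ^ (c + t * I : ℂ) = (X ^ c : ℝ) * cexp (Real.log X * t * I) := by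
  rw [cpow_def_of_ne_zero (by exact_mod_cast hX.ne'), Real.rpow_def_of_pos hX, ofReal_exp,
    ← Complex.exp_add, ← ofReal_log hX.le]
  push_cast
  congr 1
  ring

theorem cpow_one_sub_vertical {X : ℝ} (hX : 0 < X) (c t : ℝ) :
    (X : ℂ) ^ (1 - (c + t * I) : ℂ) = (X ^ (1 - c) : ℝ) * cexp ((-Real.log X : ℝ) * t * I) := by
  have h := cpow_vertical hX (1 - c) (-t)
  convert! h using 2
  · push_cast; ring
  · push_cast; ring_nf

theorem stepTransform_vertical {X : ℝ} (hX : 0 < X) (c t : ℝ) :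
    stepTransform X (c + t * I) =
      (X ^ c : ℝ) * perronKernel (Real.log X) c t +
        (X ^ (1 - c) : ℝ) * perronKernel (Real.log X) (1 - c) (-t) -
        perronKernel 0 c t - perronKernel 0 (1 - c) (-t) := by
  have h1 : (((1 - c : ℝ) : ℂ) + ((-t : ℝ) : ℂ) * I) = 1 - (c + t * I) := by push_cast; ring
  have h2 : ((Real.log X : ℂ) * ((-t : ℝ) : ℂ) * I) = (-Real.log X : ℝ) * t * I := by
    push_cast; ring
  simp only [stepTransform, perronKernel, cpow_vertical hX, cpow_one_sub_vertical hX, h1, h2,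
    ofReal_zero, zero_mul, Complex.exp_zero]
  ring

theorem stepTransform_div {X c : ℝ} (hX : 0 < X) (hc0 : 0 < c) (hc1 : c < 1) (t : ℝ) :
    stepTransform X (c + t * I) / (c + t * I) =
      (X ^ c : ℝ) * (cexp (Real.log X * t * I) / (c + t * I) ^ 2) -
        cexp ((0 : ℝ) * t * I) / (c + t * I) ^ 2 +
        (X ^ (1 - c) : ℝ) * perronKernel (-Real.log X) c t +
        (X ^ (1 - c) : ℝ) * perronKernel (Real.log X) (1 - c) (-t) -
        perronKernel 0 c t - perronKernel 0 (1 - c) (-t) := by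
  have h1 : (((1 - c : ℝ) : ℂ) + ((-t : ℝ) : ℂ) * I) = 1 - (c + t * I) := by push_cast; ring
  have h2 : ((Real.log X : ℂ) * ((-t : ℝ) : ℂ) * I) = (-Real.log X : ℝ) * t * I := by
    push_cast; ring
  have h3 := add_mul_I_ne_zero hc0 t
  have h4 := h1 ▸ add_mul_I_ne_zero (sub_pos.mpr hc1) (-t)
  simp only [stepTransform, perronKernel, cpow_vertical hX, cpow_one_sub_vertical hX, h1, h2,
    ofReal_zero, zero_mul, Complex.exp_zero]
  generalize (c + t * I : ℂ) = s at *
  field_simp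
  ring

theorem mul_stepTransform {X c : ℝ} (hX : 0 < X) (hc0 : 0 < c) (hc1 : c < 1) {N : ℝ} (hN : 0 < N)
    (t : ℝ) :
    (c + t * I) / (N * (N + (c + t * I))) * stepTransform X (c + t * I) =
      (X ^ c : ℝ) / N * perronKernel (Real.log X) (N + c) t +
        (X ^ (1 - c) : ℝ) / (N * (N + 1)) * perronKernel (Real.log X) (1 - c) (-t) -
        1 / (N * (N + 1)) * perronKernel 0 (1 - c) (-t) -
        1 / (N * (N + 1)) * perronKernel 0 (N + c) t -
        (X ^ (1 - c) : ℝ) / (N + 1) * perronKernel (-Real.log X) (N + c) t := by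
  have h1 : (((1 - c : ℝ) : ℂ) + ((-t : ℝ) : ℂ) * I) = 1 - (c + t * I) := by push_cast; ring
  have h2 : ((Real.log X : ℂ) * ((-t : ℝ) : ℂ) * I) = (-Real.log X : ℝ) * t * I := by
    push_cast; ring
  have h3 := add_mul_I_ne_zero hc0 t
  have h4 := h1 ▸ add_mul_I_ne_zero (sub_pos.mpr hc1) (-t)
  have h5 : (((N + c : ℝ) : ℂ) + t * I) = N + (c + t * I) := by push_cast; ring
  have h6 := h5 ▸ add_mul_I_ne_zero (add_pos hN hc0) t
  have h7 : (N : ℂ) ≠ 0 := by exact_mod_cast hN.ne'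
  have h8 : (N : ℂ) + 1 ≠ 0 := by exact_mod_cast (add_pos hN one_pos).ne'
  simp only [stepTransform, perronKernel, cpow_vertical hX, cpow_one_sub_vertical hX, h1, h2, h5,
    ofReal_zero, zero_mul, Complex.exp_zero]
  generalize (c + t * I : ℂ) = s at *
  field_simp
  ring

theorem continuous_deriv_Lr_div_Lr {c : ℝ} (hc : 0 < c) :
    Continuous fun t : ℝ => deriv Lr (c + t * I) / Lr (c + t * I) := by
  have hopen : IsOpen {s : ℂ | 0 < s.re} := isOpen_lt continuous_const continuous_re
  have hpi : (π : ℂ) ≠ 0 := ofReal_ne_zero.mpr Real.pi_ne_zero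
  have hdiff : DifferentiableOn ℂ Lr {s : ℂ | 0 < s.re} := fun s hs => by
    have hs2 : 0 < (s / 2).re := by simpa using hs
    have hG : DifferentiableAt ℂ Complex.Gamma (s / 2) :=
      differentiableAt_Gamma _ fun m h => by
        rw [h] at hs2; simp at hs2; linarith [m.cast_nonneg (α := ℝ)]
    have h1 : DifferentiableAt ℂ (fun w : ℂ => (π : ℂ) ^ (-w / 2)) s :=
      (differentiableAt_id.neg.div_const 2).const_cpow (Or.inl hpi)
    exact (h1.mul (hG.comp s (differentiableAt_id.div_const 2))).differentiableWithinAt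
  have hre : ∀ t : ℝ, (c + t * I : ℂ) ∈ {s : ℂ | 0 < s.re} := fun t => by
    show 0 < (c + t * I : ℂ).re
    simpa using hc
  have hline : Continuous fun t : ℝ => (c + t * I : ℂ) := by fun_prop
  refine ((hdiff.deriv hopen).continuousOn.comp_continuous hline hre).div
    (hdiff.continuousOn.comp_continuous hline hre) fun t => mul_ne_zero ?_ ?_
  · simp [cpow_eq_zero_iff, hpi]
  · exact Gamma_ne_zero_of_re_pos (by simpa using hc)

theorem integral_mul_stepTransform {X c : ℝ} (hX : 0 < X) (hc0 : 0 < c) (hc1 : c < 1) {N : ℝ}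
    (hN : 0 < N) (T : ℝ) :
    ∫ t in (-T)..T, (c + t * I) / (N * (N + (c + t * I))) * stepTransform X (c + t * I) =
      (X ^ c : ℝ) / N * perron (Real.log X) (N + c) T +
        (X ^ (1 - c) : ℝ) / (N * (N + 1)) * perron (Real.log X) (1 - c) T -
        1 / (N * (N + 1)) * perron 0 (1 - c) T -
        1 / (N * (N + 1)) * perron 0 (N + c) T -
        (X ^ (1 - c) : ℝ) / (N + 1) * perron (-Real.log X) (N + c) T := by
  have hNc := add_pos hN hc0
  have hc := sub_pos.mpr hc1
  have i1 := ((continuous_perronKernel (Real.log X) hNc).intervalIntegrable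
    (μ := volume) (-T) T).const_mul ((X ^ c : ℝ) / N : ℂ)
  have i2 := (((continuous_perronKernel (Real.log X) hc).comp continuous_neg).intervalIntegrable
    (μ := volume) (-T) T).const_mul ((X ^ (1 - c) : ℝ) / (N * (N + 1)) : ℂ)
  have i3 := (((continuous_perronKernel 0 hc).comp continuous_neg).intervalIntegrable
    (μ := volume) (-T) T).const_mul (1 / (N * (N + 1)) : ℂ)
  have i4 := ((continuous_perronKernel 0 hNc).intervalIntegrable
    (μ := volume) (-T) T).const_mul (1 / (N * (N + 1)) : ℂ)
  have i5 := ((continuous_perronKernel (-Real.log X) hNc).intervalIntegrable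
    (μ := volume) (-T) T).const_mul ((X ^ (1 - c) : ℝ) / (N + 1) : ℂ)
  simp only [Function.comp_apply] at i2 i3
  simp_rw [mul_stepTransform hX hc0 hc1 hN]
  rw [intervalIntegral.integral_sub (((i1.add i2).sub i3).sub i4) i5,
    intervalIntegral.integral_sub ((i1.add i2).sub i3) i4,
    intervalIntegral.integral_sub (i1.add i2) i3, intervalIntegral.integral_add i1 i2]
  simp only [intervalIntegral.integral_const_mul, integral_perronKernel,
    integral_perronKernel_neg]

theorem integral_stepTransform {X c : ℝ} (hX : 0 < X) (hc0 : 0 < c) (hc1 : c < 1) (T : ℝ) :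
    ∫ t in (-T)..T, stepTransform X (c + t * I) =
      (X ^ c : ℝ) * perron (Real.log X) c T + (X ^ (1 - c) : ℝ) * perron (Real.log X) (1 - c) T -
        perron 0 c T - perron 0 (1 - c) T := by
  have hc := sub_pos.mpr hc1
  have i1 := ((continuous_perronKernel (Real.log X) hc0).intervalIntegrable
    (μ := volume) (-T) T).const_mul (X ^ c : ℝ)
  have i2 := (((continuous_perronKernel (Real.log X) hc).comp continuous_neg).intervalIntegrable
    (μ := volume) (-T) T).const_mul (X ^ (1 - c) : ℝ)
  have i3 := (continuous_perronKernel 0 hc0).intervalIntegrable (μ := volume) (-T) T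
  have i4 : IntervalIntegrable (fun t => perronKernel 0 (1 - c) (-t)) volume (-T) T :=
    ((continuous_perronKernel 0 hc).comp continuous_neg).intervalIntegrable _ _
  simp only [Function.comp_apply] at i2
  simp_rw [stepTransform_vertical hX]
  rw [intervalIntegral.integral_sub ((i1.add i2).sub i3) i4,
    intervalIntegral.integral_sub (i1.add i2) i3, intervalIntegral.integral_add i1 i2]
  simp only [intervalIntegral.integral_const_mul, integral_perronKernel,
    integral_perronKernel_neg]

theorem integral_stepTransform_div {X c : ℝ} (hX : 0 < X) (hc0 : 0 < c) (hc1 : c < 1) (T : ℝ) :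
    ∫ t in (-T)..T, stepTransform X (c + t * I) / (c + t * I) =
      (X ^ c : ℝ) * (∫ t in (-T)..T, cexp (Real.log X * t * I) / (c + t * I) ^ 2) -
        (∫ t in (-T)..T, cexp ((0 : ℝ) * t * I) / (c + t * I) ^ 2) +
        (X ^ (1 - c) : ℝ) * perron (-Real.log X) c T +
        (X ^ (1 - c) : ℝ) * perron (Real.log X) (1 - c) T -
        perron 0 c T - perron 0 (1 - c) T := by
  have hc := sub_pos.mpr hc1
  have i1 := ((continuous_exp_mul_div_sq (Real.log X) hc0).intervalIntegrable
    (μ := volume) (-T) T).const_mul (X ^ c : ℝ)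
  have i2 := (continuous_exp_mul_div_sq 0 hc0).intervalIntegrable (μ := volume) (-T) T
  have i3 := ((continuous_perronKernel (-Real.log X) hc0).intervalIntegrable
    (μ := volume) (-T) T).const_mul (X ^ (1 - c) : ℝ)
  have i4 := (((continuous_perronKernel (Real.log X) hc).comp continuous_neg).intervalIntegrable
    (μ := volume) (-T) T).const_mul (X ^ (1 - c) : ℝ)
  have i5 := (continuous_perronKernel 0 hc0).intervalIntegrable (μ := volume) (-T) T
  have i6 : IntervalIntegrable (fun t => perronKernel 0 (1 - c) (-t)) volume (-T) T :=
    ((continuous_perronKernel 0 hc).comp continuous_neg).intervalIntegrable _ _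
  simp only [Function.comp_apply] at i4
  simp_rw [stepTransform_div hX hc0 hc1]
  rw [intervalIntegral.integral_sub ((((i1.sub i2).add i3).add i4).sub i5) i6,
    intervalIntegral.integral_sub (((i1.sub i2).add i3).add i4) i5,
    intervalIntegral.integral_add ((i1.sub i2).add i3) i4,
    intervalIntegral.integral_add (i1.sub i2) i3, intervalIntegral.integral_sub i1 i2]
  simp only [intervalIntegral.integral_const_mul, integral_perronKernel,
    integral_perronKernel_neg]

theorem rpow_mul_exp_neg_mul_log {X : ℝ} (hX : 0 < X) (a b : ℝ) :
    X ^ a * Real.exp (-(b * Real.log X)) = X ^ (a - b) := by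
  rw [Real.rpow_def_of_pos hX, Real.rpow_def_of_pos hX, ← Real.exp_add]
  ring_nf

theorem tendsto_rpow_mul_perron_log {X : ℝ} (hX : 1 < X) (a : ℝ) {b : ℝ} (hb : 0 < b) :
    Tendsto (fun T => ((X ^ a : ℝ) : ℂ) * perron (Real.log X) b T) atTop
      (nhds (2 * π * (X ^ (a - b) : ℝ) : ℂ)) := by
  have hl := Real.log_pos hX
  refine ((tendsto_perron hl.ne' hb).const_mul _).trans_eq ?_
  rw [max_eq_left hl.le, div_self hl.ne', one_mul,
    ← rpow_mul_exp_neg_mul_log (zero_lt_one.trans hX)]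
  congr 1
  push_cast
  ring

theorem tendsto_perron_neg_log {X : ℝ} (hX : 1 < X) {b : ℝ} (hb : 0 < b) :
    Tendsto (perron (-Real.log X) b) atTop (nhds 0) := by
  have hl := Real.log_pos hX
  refine (tendsto_perron (neg_ne_zero.mpr hl.ne') hb).trans_eq ?_
  rw [max_eq_right (neg_nonpos.mpr hl.le)]
  simp

theorem tendsto_integral_stepTransform {X c : ℝ} (hX : 1 < X) (hc0 : 0 < c) (hc1 : c < 1) :
    Tendsto (fun T : ℝ => ∫ t in (-T)..T, stepTransform X (c + t * I)) atTop
      (nhds (2 * π : ℂ)) := by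
  have hc := sub_pos.mpr hc1
  simp_rw [integral_stepTransform (zero_lt_one.trans hX) hc0 hc1]
  refine ((((tendsto_rpow_mul_perron_log hX c hc0).add
    (tendsto_rpow_mul_perron_log hX (1 - c) hc)).sub (tendsto_perron_zero hc0)).sub
    (tendsto_perron_zero hc)).trans_eq ?_
  congr 1
  simp
  ring

theorem tendsto_integral_stepTransform_div {X c : ℝ} (hX : 1 < X) (hc0 : 0 < c) (hc1 : c < 1) :
    Tendsto (fun T : ℝ => ∫ t in (-T)..T, stepTransform X (c + t * I) / (c + t * I)) atTop
      (nhds (2 * π * Real.log X : ℂ)) := by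
  have hc := sub_pos.mpr hc1
  have hX0 := zero_lt_one.trans hX
  simp_rw [integral_stepTransform_div hX0 hc0 hc1]
  have h1 := (tendsto_integral_exp_mul_div_sq (Real.log X) hc0).const_mul ((X ^ c : ℝ) : ℂ)
  have h2 := tendsto_integral_exp_mul_div_sq 0 hc0
  have h3 := (tendsto_perron_neg_log hX hc0).const_mul ((X ^ (1 - c) : ℝ) : ℂ)
  refine (((((h1.sub h2).add h3).add (tendsto_rpow_mul_perron_log hX (1 - c) hc)).sub
    (tendsto_perron_zero hc0)).sub (tendsto_perron_zero hc)).trans_eq ?_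
  have e := rpow_mul_exp_neg_mul_log hX0 c c
  rw [sub_self, Real.rpow_zero] at e
  have e' : ((X ^ c : ℝ) : ℂ) * (Real.exp (-(c * Real.log X)) : ℝ) = 1 := by
    rw [← ofReal_mul, e, ofReal_one]
  congr 1
  rw [max_eq_left (Real.log_pos hX).le, max_self, sub_self, Real.rpow_zero, ofReal_mul,
    ofReal_mul (Real.log X)]
  push_cast at e' ⊢
  linear_combination (2 * π * Real.log X : ℂ) * e'

theorem tendsto_integral_mul_stepTransform {X c : ℝ} (hX : 1 < X) (hc0 : 0 < c) (hc1 : c < 1)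
    {N : ℝ} (hN : 0 < N) :
    Tendsto (fun T : ℝ => ∫ t in (-T)..T,
      (c + t * I) / (N * (N + (c + t * I))) * stepTransform X (c + t * I)) atTop
      (nhds (2 * π * (X ^ (-N) / N : ℝ) : ℂ)) := by
  have hc := sub_pos.mpr hc1
  have hNc := add_pos hN hc0
  simp_rw [integral_mul_stepTransform (zero_lt_one.trans hX) hc0 hc1 hN]
  have h1 := (tendsto_rpow_mul_perron_log hX c hNc).const_mul (1 / N : ℂ)
  have h2 := (tendsto_rpow_mul_perron_log hX (1 - c) hc).const_mul (1 / (N * (N + 1)) : ℂ)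
  have h3 := (tendsto_perron_zero hc).const_mul (1 / (N * (N + 1)) : ℂ)
  have h4 := (tendsto_perron_zero hNc).const_mul (1 / (N * (N + 1)) : ℂ)
  have h5 := (tendsto_perron_neg_log hX hNc).const_mul ((X ^ (1 - c) : ℝ) / (N + 1) : ℂ)
  refine ((((h1.add h2).sub h3).sub h4).sub h5).congr (fun T => by ring) |>.trans_eq ?_
  congr 1
  rw [sub_self, Real.rpow_zero, sub_add_cancel_right]
  push_cast
  ring

theorem norm_integral_mul_stepTransform_le {X c : ℝ} (hX : 1 < X) (hc0 : 0 < c) (hc1 : c < 1)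
    {N : ℝ} (hN : 0 < N) {T : ℝ} (hT : 0 ≤ T) :
    ‖∫ t in (-T)..T, (c + t * I) / (N * (N + (c + t * I))) * stepTransform X (c + t * I)‖ ≤
      (X ^ c * ((π + 2) / Real.log X) + X ^ (1 - c) * ((π + 2) / Real.log X / (1 - c)) + π + π +
        X ^ (1 - c) * ((π + 2) / Real.log X)) * (1 / N ^ 2) := by
  have hc := sub_pos.mpr hc1
  have hNc := add_pos hN hc0
  have hX0 := zero_lt_one.trans hX
  have hl := Real.log_pos hX
  have hK : 0 ≤ (π + 2) / Real.log X := by positivity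
  have hp1 := Real.rpow_nonneg hX0.le c
  have hp2 := Real.rpow_nonneg hX0.le (1 - c)
  have b1 := norm_perron_le hl.ne' hNc hT
  have b2 := norm_perron_le hl.ne' hc hT
  have b3 := norm_perron_zero_le hc T
  have b4 := norm_perron_zero_le hNc T
  have b5 := norm_perron_le (neg_ne_zero.mpr hl.ne') hNc hT
  rw [abs_neg] at b5
  rw [abs_of_pos hl] at b1 b2 b5
  have hd : (π + 2) / Real.log X / (N + c) ≤ (π + 2) / Real.log X / N :=
    div_le_div_of_nonneg_left hK hN (by linarith)
  have hN1 : 1 / (N * (N + 1)) ≤ 1 / N ^ 2 :=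
    one_div_le_one_div_of_le (by positivity) (by nlinarith)
  have hN2 : 1 / (N + 1) ≤ 1 / N := one_div_le_one_div_of_le hN (by linarith)
  have nN : ‖(N : ℂ)‖ = N := by rw [norm_real, Real.norm_of_nonneg hN.le]
  have nN1 : ‖(N + 1 : ℂ)‖ = N + 1 := by
    rw [← ofReal_one, ← ofReal_add, norm_real, Real.norm_of_nonneg (by linarith)]
  rw [integral_mul_stepTransform hX0 hc0 hc1 hN]
  refine (norm_sub_le _ _).trans ((add_le_add_left ((norm_sub_le _ _).trans (add_le_add_left
    ((norm_sub_le _ _).trans (add_le_add_left (norm_add_le _ _) _)) _)) _).trans ?_)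
  simp only [norm_mul, norm_div, norm_one, nN, nN1, norm_real, Real.norm_of_nonneg hp1,
    Real.norm_of_nonneg hp2]
  have t1 : X ^ c / N * ‖perron (Real.log X) (N + c) T‖ ≤
      X ^ c * ((π + 2) / Real.log X) * (1 / N ^ 2) := by
    calc _ ≤ X ^ c / N * ((π + 2) / Real.log X / N) := by gcongr; exact b1.trans hd
      _ = _ := by field_simp
  have t2 : X ^ (1 - c) / (N * (N + 1)) * ‖perron (Real.log X) (1 - c) T‖ ≤
      X ^ (1 - c) * ((π + 2) / Real.log X / (1 - c)) * (1 / N ^ 2) := by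
    calc _ = X ^ (1 - c) * ‖perron (Real.log X) (1 - c) T‖ * (1 / (N * (N + 1))) := by ring
      _ ≤ _ := by gcongr
  have t3 : 1 / (N * (N + 1)) * ‖perron 0 (1 - c) T‖ ≤ π * (1 / N ^ 2) := by
    rw [mul_comm]; gcongr
  have t4 : 1 / (N * (N + 1)) * ‖perron 0 (N + c) T‖ ≤ π * (1 / N ^ 2) := by
    rw [mul_comm]; gcongr
  have t5 : X ^ (1 - c) / (N + 1) * ‖perron (-Real.log X) (N + c) T‖ ≤
      X ^ (1 - c) * ((π + 2) / Real.log X) * (1 / N ^ 2) := by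
    calc _ = X ^ (1 - c) * (1 / (N + 1)) * ‖perron (-Real.log X) (N + c) T‖ := by ring
      _ ≤ X ^ (1 - c) * (1 / N) * ((π + 2) / Real.log X / N) := by gcongr; exact b5.trans hd
      _ = _ := by field_simp
  linarith

theorem continuous_stepTransform {X c : ℝ} (hX : 0 < X) (hc0 : 0 < c) (hc1 : c < 1) :
    Continuous fun t : ℝ => stepTransform X (c + t * I) := by
  have hc := sub_pos.mpr hc1
  simp_rw [stepTransform_vertical hX]
  exact ((((continuous_perronKernel _ hc0).const_mul _).add
    (((continuous_perronKernel _ hc).comp continuous_neg).const_mul _)).sub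
    (continuous_perronKernel _ hc0)).sub ((continuous_perronKernel _ hc).comp continuous_neg)

theorem summable_one_div_two_mul_add_one_sq :
    Summable fun n : ℕ => 1 / (2 * (n + 1) : ℝ) ^ 2 := by
  convert! ((summable_nat_add_iff 1).mpr
    (Real.summable_one_div_nat_pow.mpr one_lt_two)).mul_left (1 / 4) using 2 with n
  push_cast
  field_simp
  norm_num

theorem hasSum_integral_mul_stepTransform {X c : ℝ} (hX : 0 < X) (hc0 : 0 < c) (hc1 : c < 1)
    (T : ℝ) :
    HasSum (fun n : ℕ => ∫ t in (-T)..T, (c + t * I) / ((2 * (n + 1) : ℝ) *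
        ((2 * (n + 1) : ℝ) + (c + t * I))) * stepTransform X (c + t * I))
      (∫ t in (-T)..T, (deriv Lr (c + t * I) / Lr (c + t * I) +
        (Real.log π + Real.eulerMascheroniConstant) / 2 + 1 / (c + t * I)) *
          stepTransform X (c + t * I)) := by
  have hs := continuous_stepTransform hX hc0 hc1
  have hN : ∀ n : ℕ, (0 : ℝ) < 2 * (n + 1) := fun n => by positivity
  have hNt : ∀ (n : ℕ) (t : ℝ), ((2 * (n + 1) : ℝ) + (c + t * I) : ℂ) =
      ((2 * (n + 1) + c : ℝ) : ℂ) + t * I := fun n t => by push_cast; ring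
  have hden : ∀ (n : ℕ) (t : ℝ),
      (((2 * (n + 1) : ℝ) : ℂ) * ((2 * (n + 1) : ℝ) + (c + t * I))) ≠ 0 := fun n t =>
    mul_ne_zero (ofReal_ne_zero.mpr (hN n).ne')
      (hNt n t ▸ add_mul_I_ne_zero (add_pos (hN n) hc0) t)
  refine hasSum_integral_of_dominated_convergence
    (fun n t => 1 / (2 * (n + 1) : ℝ) ^ 2 * (‖(c + t * I : ℂ)‖ * ‖stepTransform X (c + t * I)‖))
    (fun n => ?_) (fun n => ae_of_all _ fun t _ => ?_)
    (ae_of_all _ fun t _ => summable_one_div_two_mul_add_one_sq.mul_right _) ?_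
    (ae_of_all _ fun t _ => ?_)
  · exact (((by fun_prop : Continuous fun t : ℝ => (c + t * I : ℂ)).div (by fun_prop)
      (hden n)).mul hs).aestronglyMeasurable
  · rw [norm_mul, norm_div, norm_mul, hNt, norm_real, Real.norm_of_nonneg (hN n).le]
    have h1 := le_norm_add_mul_I (2 * (n + 1) + c : ℝ) t
    have h2 : (2 * (n + 1) : ℝ) ≤ ‖((2 * (n + 1) + c : ℝ) + t * I : ℂ)‖ := by linarith
    have := hN n
    calc _ ≤ ‖(c + t * I : ℂ)‖ / ((2 * (n + 1) : ℝ) * (2 * (n + 1) : ℝ)) *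
          ‖stepTransform X (c + t * I)‖ := by gcongr
      _ = _ := by ring
  · simp_rw [tsum_mul_right]
    exact Continuous.intervalIntegrable (by fun_prop) _ _
  · have h := (hasSum_deriv_Lr_div_Lr (s := c + t * I) (by simpa using hc0)).mul_right
      (stepTransform X (c + t * I))
    push_cast
    exact h

theorem tsum_rpow_neg_div {X : ℝ} (hX : 1 < X) :
    ∑' n : ℕ, X ^ (-(2 * (n + 1) : ℝ)) / (2 * (n + 1)) =
      -(1 / 2 * Real.log (1 - X ^ (-2 : ℤ))) := by
  have hX0 := zero_lt_one.trans hX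
  have h1 : |X ^ (-2 : ℤ)| < 1 := by
    rw [abs_of_pos (by positivity)]
    exact zpow_lt_one_of_neg₀ hX (by norm_num)
  rw [← mul_neg, ← ((Real.hasSum_pow_div_log_of_abs_lt_one h1).mul_left (1 / 2)).tsum_eq]
  refine tsum_congr fun n => ?_
  have h2 : X ^ (-(2 * (n + 1) : ℝ)) = (X ^ (-2 : ℤ)) ^ (n + 1) := by
    rw [← Real.rpow_intCast, ← Real.rpow_natCast, ← Real.rpow_mul hX0.le]
    push_cast
    ring_nf
  rw [h2]
  field_simp

/-- Fix `X > 1` and let `g` be the step function equal to `1` on `(1,X)`, to `1/2` at `1`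
and `X`, and to `0` elsewhere (its Mellin transform is `(X^s-1)/s`).  Then for every
`0 < c < 1` the limit
`W_r(g) = lim_{T→∞} (1/2πi) ∫_{c-iT}^{c+iT} (-L_r'(s)/L_r(s)) (ĝ(s)+ĝ(1-s)) ds`
exists and equals `(log π + γ)/2 + log X + (1/2) log(1 - X⁻²)`. -/
theorem archimedean_term_of_step_function (X : ℝ) (hX : 1 < X)
    (g : ℝ → ℂ)
    (hg : g = fun u : ℝ =>
      if 1 < u ∧ u < X then 1 else if u = 1 ∨ u = X then 1 / 2 else 0)
    (c : ℝ) (hc0 : 0 < c) (hc1 : c < 1) :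
    Tendsto
      (fun T : ℝ =>
        (1 / (2 * (π : ℂ))) *
          ∫ t in (-T)..T,
            (-(deriv Lr (c + t * I) / Lr (c + t * I))) *
              (mellin g (c + t * I) + mellin g (1 - (c + t * I))))
      atTop
      (nhds ((((Real.log π + Real.eulerMascheroniConstant) / 2
        + Real.log X + 1 / 2 * Real.log (1 - X ^ (-2 : ℤ)) : ℝ)) : ℂ)) := by
  have hX0 := zero_lt_one.trans hX
  set A : ℂ := (Real.log π + Real.eulerMascheroniConstant) / 2 with hA
  set J : ℝ → ℕ → ℂ := fun T n => ∫ t in (-T)..T, (c + t * I) / ((2 * (n + 1) : ℝ) *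
    ((2 * (n + 1) : ℝ) + (c + t * I))) * stepTransform X (c + t * I) with hJ
  have hre : ∀ t : ℝ, (c + t * I : ℂ).re = c := fun t => by simp
  have hne : ∀ t : ℝ, (c + t * I : ℂ) ≠ 0 := add_mul_I_ne_zero hc0
  have hcs := continuous_stepTransform hX0 hc0 hc1
  have hN : ∀ n : ℕ, (0 : ℝ) < 2 * (n + 1) := fun n => by positivity
  have hline : Continuous fun t : ℝ => (c + t * I : ℂ) := by fun_prop
  have htransform : ∀ t : ℝ, mellin g (c + t * I) + mellin g (1 - (c + t * I)) =
      stepTransform X (c + t * I) := fun t => by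
    rw [hg, mellin_step hX (by rwa [hre]),
      mellin_step hX (by rw [sub_re, one_re, hre]; linarith), stepTransform]
  have hmain : ∀ T : ℝ, (∫ t in (-T)..T, (-(deriv Lr (c + t * I) / Lr (c + t * I))) *
      (mellin g (c + t * I) + mellin g (1 - (c + t * I)))) =
      A * (∫ t in (-T)..T, stepTransform X (c + t * I)) +
        (∫ t in (-T)..T, stepTransform X (c + t * I) / (c + t * I)) - ∑' n, J T n := fun T => by
    have i1 : IntervalIntegrable (fun t : ℝ => A * stepTransform X (c + t * I)) volume (-T) T :=
      (hcs.const_mul A).intervalIntegrable _ _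
    have i2 : IntervalIntegrable (fun t : ℝ => stepTransform X (c + t * I) / (c + t * I))
        volume (-T) T := (hcs.div hline hne).intervalIntegrable _ _
    have i3 : IntervalIntegrable (fun t : ℝ => (deriv Lr (c + t * I) / Lr (c + t * I) + A +
        1 / (c + t * I)) * stepTransform X (c + t * I)) volume (-T) T :=
      ((((continuous_deriv_Lr_div_Lr hc0).add continuous_const).add
        (continuous_const.div hline hne)).mul hcs).intervalIntegrable _ _
    rw [(hasSum_integral_mul_stepTransform hX0 hc0 hc1 T).tsum_eq,
      ← intervalIntegral.integral_const_mul, ← intervalIntegral.integral_add i1 i2,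
      ← intervalIntegral.integral_sub (i1.add i2) i3]
    refine intervalIntegral.integral_congr fun t _ => ?_
    simp only [htransform]
    ring
  have htsum : Tendsto (fun T => ∑' n, J T n) atTop
      (nhds (∑' n : ℕ, (2 * π * (X ^ (-(2 * (n + 1) : ℝ)) / (2 * (n + 1) : ℝ) : ℝ) : ℂ))) := by
    refine tendsto_tsum_of_dominated_convergence
      (summable_one_div_two_mul_add_one_sq.mul_left
        (X ^ c * ((π + 2) / Real.log X) + X ^ (1 - c) * ((π + 2) / Real.log X / (1 - c)) + π + π +
          X ^ (1 - c) * ((π + 2) / Real.log X)))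
      (fun n => tendsto_integral_mul_stepTransform hX hc0 hc1 (hN n)) ?_
    filter_upwards [eventually_ge_atTop 0] with T hT n
    exact norm_integral_mul_stepTransform_le hX hc0 hc1 (hN n) hT
  have hpi : (π : ℂ) ≠ 0 := ofReal_ne_zero.mpr Real.pi_ne_zero
  simp_rw [hmain]
  refine (((((tendsto_integral_stepTransform hX hc0 hc1).const_mul A).add
    (tendsto_integral_stepTransform_div hX hc0 hc1)).sub htsum).const_mul _).trans_eq ?_
  rw [tsum_mul_left, ← ofReal_tsum, tsum_rpow_neg_div hX, hA]
  congr 1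
  push_cast
  field_simp
  ring
end

section
/- Let ε > 0 and let g : (0,∞) → ℂ admit a derivative g′ which is continuous and locally of bounded variation, with |g(u)| + |u·g′(u)| = O(1/K_ε(u)) on (0,∞). Then for every c with 0 < c < 1 the limit V_r(g) = lim_{T→∞} (1/2πi) ∫_{c−iT}^{c+iT} (−L_r′(s)/L_r(s))·ĝ(s) ds exists and equals ((log(π) + γ)/2)·g(1) + ∫₁^∞ g(t) dt/t + ∫₁^∞ (g(t) − g(1))/(t² − 1) dt/t; moreover the limit W_r(g) = lim_{T→∞} (1/2πi) ∫_{c−iT}^{c+iT} (−L_r′(s)/L_r(s))·(ĝ(s) + ĝ(1−s)) ds exists and equals V_r(g) + V_r(g^τ). -/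
open Complex MeasureTheory Set Filter intervalIntegral

open scoped Real

/-- The transpose `g^τ(x) = (1/x)·g(1/x)`. -/
noncomputable def transp (g : ℝ → ℂ) : ℝ → ℂ := fun x => ((x⁻¹ : ℝ) : ℂ) * g x⁻¹

/-- The archimedean integral `V_r(g)` truncated at height `T`:
`(1/2πi) ∫_{c-iT}^{c+iT} (-L_r'(s)/L_r(s)) ĝ(s) ds`. -/
noncomputable def Vint (g : ℝ → ℂ) (c T : ℝ) : ℂ :=
  (1 / (2 * (π : ℂ))) *
    ∫ t in (-T)..T, (-(deriv Lr (c + t * I) / Lr (c + t * I))) * mellin g (c + t * I)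

/-- The finite form of Weil's archimedean term:
`((log π + γ)/2)·g(1) + ∫₁^∞ g(t) dt/t + ∫₁^∞ (g(t)-g(1))/(t²-1) dt/t`. -/
noncomputable def VrValue (g : ℝ → ℂ) : ℂ :=
  (((Real.log π + Real.eulerMascheroniConstant) / 2 : ℝ) : ℂ) * g 1
    + (∫ t in Ioi (1 : ℝ), g t / (t : ℂ))
    + ∫ t in Ioi (1 : ℝ), (g t - g 1) / (((t ^ 2 - 1) * t : ℝ) : ℂ)

open scoped FourierTransform in
theorem continuous_fourier_of_integrable {h : ℝ → ℂ} (h1 : Integrable h) : Continuous (𝓕 h) := by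
  have := VectorFourier.fourierIntegral_continuous (μ := volume) (L := innerₗ ℝ)
    Real.continuous_fourierChar (by exact continuous_inner) h1
  exact this

open scoped FourierTransform SchwartzMap in
/-- The Fourier integral of a function in `L¹ ∩ L²` is in `L²`. -/
theorem memLp_two_fourier {h : ℝ → ℂ} (h1 : Integrable h) (h2 : MemLp h 2) :
    MemLp (𝓕 h) 2 := by
  have key : ∀ᵐ x, 𝓕 h x = (𝓕 h2.toLp : Lp ℂ 2 (volume : Measure ℝ)) x := by
    apply ae_eq_of_integral_contDiff_smul_eq (continuous_fourier_of_integrable h1).locallyIntegrable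
      ((Lp.memLp _).locallyIntegrable (by norm_num))
    intro φ hφ hφc
    have hφc' : HasCompactSupport (fun x => (φ x : ℂ)) :=
      hφc.comp_left (g := fun r : ℝ => (r : ℂ)) (by simp)
    have hφ' : ContDiff ℝ (⊤ : ℕ∞) (fun x => (φ x : ℂ)) :=
      Complex.ofRealCLM.contDiff.comp hφ
    set ψ : 𝓢(ℝ, ℂ) := hφc'.toSchwartzMap hφ' with hψ
    have e1 := Lp.fourier_toTemperedDistribution_eq h2.toLp
    have e2 := congrArg (fun D => D ψ) e1
    simp only [TemperedDistribution.fourier_apply, Lp.toTemperedDistribution_apply] at e2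
    have e3 : ∫ x, (𝓕 ψ) x • h2.toLp h x = ∫ x, (𝓕 ψ) x • h x := by
      apply MeasureTheory.integral_congr_ae
      filter_upwards [h2.coeFn_toLp] with x hx
      rw [hx]
    have e4 : ∫ x, (𝓕 ψ) x • h x = ∫ x, ψ x • 𝓕 h x := by
      simpa using! VectorFourier.integral_bilin_fourierIntegral_eq_flip (.lsmul ℂ ℂ) (L := innerₗ ℝ)
        Real.continuous_fourierChar continuous_inner ψ.integrable h1
    rw [e3] at e2
    exact e4.symm.trans e2
  exact (memLp_congr_ae key).2 (Lp.memLp _)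

theorem integrable_exp_neg_mul_abs {δ : ℝ} (hδ : 0 < δ) :
    Integrable fun v : ℝ => Real.exp (-δ * |v|) := by
  rw [← integrableOn_univ, ← Iic_union_Ioi (a := (0 : ℝ))]
  refine IntegrableOn.union ?_ ?_
  · refine (integrableOn_exp_mul_Iic hδ 0).congr_fun (fun v hv => ?_) measurableSet_Iic
    simp [abs_of_nonpos (mem_Iic.1 hv)]
  · refine (exp_neg_integrableOn_Ioi 0 hδ).congr_fun (fun v hv => ?_) measurableSet_Ioi
    simp [abs_of_pos (mem_Ioi.1 hv)]

/-- A continuous function with exponential decay is in `L¹ ∩ L²`. -/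
theorem integrable_and_memLp_two_of_exp_decay {h : ℝ → ℂ} (hc : Continuous h) {C δ : ℝ}
    (hδ : 0 < δ) (hb : ∀ v, ‖h v‖ ≤ C * Real.exp (-δ * |v|)) :
    Integrable h ∧ MemLp h 2 := by
  refine ⟨((integrable_exp_neg_mul_abs hδ).const_mul C).mono' hc.aestronglyMeasurable
    (ae_of_all _ hb), ?_⟩
  rw [memLp_two_iff_integrable_sq_norm hc.aestronglyMeasurable]
  refine ((integrable_exp_neg_mul_abs (δ := 2 * δ) (by positivity)).const_mul (C ^ 2)).mono'
    (by fun_prop) (ae_of_all _ fun v => ?_)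
  rw [norm_pow, norm_norm]
  calc ‖h v‖ ^ 2 ≤ (C * Real.exp (-δ * |v|)) ^ 2 := by gcongr; exact hb v
    _ = C ^ 2 * Real.exp (-(2 * δ) * |v|) := by
      rw [mul_pow, ← Real.exp_nat_mul]; ring_nf

open scoped FourierTransform in
/-- If `f` and `f'` are in `L¹ ∩ L²`, the Fourier transform of `f` is integrable against
`(1 + |t|) ^ (1 / 4)`. -/
theorem integrable_rpow_mul_norm_fourier {f : ℝ → ℂ} (hf : Differentiable ℝ f)
    (h1 : Integrable f) (h2 : MemLp f 2) (h1' : Integrable (deriv f)) (h2' : MemLp (deriv f) 2) :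
    Integrable fun t : ℝ => (1 + |t|) ^ (1 / 4 : ℝ) * ‖𝓕 f (t / (2 * π))‖ := by
  set G : ℝ → ℝ := fun y => ‖𝓕 f y‖ + ‖𝓕 (deriv f) y‖ with hG
  have hGm : MemLp G 2 := (memLp_two_fourier h1 h2).norm.add (memLp_two_fourier h1' h2').norm
  have hKm : MemLp (fun t : ℝ => G (t / (2 * π))) 2 := by
    have hGc : Continuous G := (continuous_fourier_of_integrable h1).norm.add
      (continuous_fourier_of_integrable h1').norm
    have hKc : Continuous fun t : ℝ => G (t / (2 * π)) := hGc.comp (by fun_prop)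
    rw [memLp_two_iff_integrable_sq_norm hKc.aestronglyMeasurable]
    exact ((memLp_two_iff_integrable_sq_norm hGm.1).1 hGm).comp_div (by positivity)
  have hJ : MemLp (fun t : ℝ => (1 + |t|) ^ (-(3 / 4) : ℝ)) 2 := by
    have hcont : Continuous fun t : ℝ => (1 + |t|) ^ (-(3 / 4) : ℝ) :=
      Continuous.rpow_const (by fun_prop) fun t => Or.inl (by positivity)
    rw [memLp_two_iff_integrable_sq_norm hcont.aestronglyMeasurable]
    refine (integrable_one_add_norm (E := ℝ) (μ := volume) (r := 3 / 2) (by norm_num)).congr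
      (ae_of_all _ fun t => ?_)
    have : (0 : ℝ) ≤ 1 + |t| := by positivity
    simp only [Real.norm_eq_abs, sq_abs]
    rw [← Real.rpow_natCast, ← Real.rpow_mul this]
    norm_num
  refine (hJ.integrable_mul hKm).congr (ae_of_all _ fun t => ?_)
  have hpos : (0 : ℝ) < 1 + |t| := by positivity
  have hd : ‖𝓕 (deriv f) (t / (2 * π))‖ = |t| * ‖𝓕 f (t / (2 * π))‖ := by
    rw [Real.fourier_deriv h1 hf h1']
    have : (2 * π * I * (t / (2 * π) : ℝ) : ℂ) = t * I := by
      have : (π : ℂ) ≠ 0 := by exact_mod_cast Real.pi_ne_zero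
      push_cast
      field_simp
    simp only [this, smul_eq_mul, norm_mul, norm_I, mul_one, norm_real, Real.norm_eq_abs]
  have : (1 + |t|) ^ (1 / 4 : ℝ) = (1 + |t|) ^ (-(3 / 4) : ℝ) * (1 + |t|) := by
    nth_rewrite 3 [← Real.rpow_one (1 + |t|)]
    rw [← Real.rpow_add hpos]
    norm_num
  simp only [Pi.mul_apply, hG, hd, this]
  ring

/-- Differentiability on `(0, ∞)` together with the decay `O(1 / (u ^ (-ε) + u ^ (1 + ε)))` of the
function and of its logarithmic derivative. -/
structure HasDecay (ε : ℝ) (g g' : ℝ → ℂ) : Prop where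
  hasDerivAt : ∀ u ∈ Ioi (0 : ℝ), HasDerivAt g (g' u) u
  continuousOn : ContinuousOn g' (Ioi 0)
  bound : ∃ C : ℝ, ∀ u : ℝ, 0 < u → ‖g u‖ + u * ‖g' u‖ ≤ C / (u ^ (-ε) + u ^ (1 + ε))

namespace HasDecay

variable {ε : ℝ} {g g' : ℝ → ℂ}

theorem exists_bound (h : HasDecay ε g g') :
    ∃ C : ℝ, 0 ≤ C ∧ ∀ u : ℝ, 0 < u →
      ‖g u‖ + u * ‖g' u‖ ≤ C * u ^ ε ∧ ‖g u‖ + u * ‖g' u‖ ≤ C * u ^ (-(1 + ε)) := by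
  obtain ⟨C, hC⟩ := h.bound
  have hC0 : 0 ≤ C := by
    have := hC 1 one_pos
    have h0 : 0 ≤ ‖g 1‖ + 1 * ‖g' 1‖ := by positivity
    norm_num at this
    norm_num at h0
    linarith
  refine ⟨C, hC0, fun u hu => ⟨(hC u hu).trans ?_, (hC u hu).trans ?_⟩⟩
  · rw [div_le_iff₀ (by positivity), mul_assoc, mul_add, ← Real.rpow_add hu]
    have : 0 ≤ u ^ ε * u ^ (1 + ε) := by positivity
    simp only [add_neg_cancel, Real.rpow_zero]
    nlinarith
  · rw [div_le_iff₀ (by positivity), mul_assoc, mul_add, ← Real.rpow_add hu, ← Real.rpow_add hu]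
    have : 0 ≤ u ^ (-(1 + ε) + -ε) := by positivity
    simp only [neg_add_cancel, Real.rpow_zero]
    nlinarith

theorem transp (h : HasDecay ε g g') :
    HasDecay ε (transp g)
      (fun u => -((u⁻¹ ^ 2 : ℝ) : ℂ) * (g u⁻¹ + ((u⁻¹ : ℝ) : ℂ) * g' u⁻¹)) := by
  have hinv : ContinuousOn (fun u : ℝ => u⁻¹) (Ioi 0) :=
    continuousOn_inv₀.mono fun u hu => ne_of_gt hu
  have hmaps : MapsTo (fun u : ℝ => u⁻¹) (Ioi 0) (Ioi 0) := fun u hu =>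
    mem_Ioi.2 (inv_pos.2 (mem_Ioi.1 hu))
  have hg : ContinuousOn g (Ioi 0) := fun u hu =>
    (h.hasDerivAt u hu).continuousAt.continuousWithinAt
  refine ⟨fun u hu => ?_, ?_, ?_⟩
  · have hu' : u ≠ 0 := ne_of_gt hu
    have h1 : HasDerivAt (fun x : ℝ => x⁻¹) (-(u ^ 2)⁻¹) u := hasDerivAt_inv hu'
    have h2 := (h.hasDerivAt u⁻¹ (hmaps hu)).scomp u h1
    have h3 := h1.ofReal_comp.mul h2
    refine (show HasDerivAt (_root_.transp g) _ u from h3).congr_deriv ?_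
    simp only [Function.comp_apply, real_smul]
    push_cast
    ring
  · refine ContinuousOn.mul (Complex.continuous_ofReal.comp_continuousOn (hinv.pow 2)).neg
      ((hg.comp hinv hmaps).add ((Complex.continuous_ofReal.comp_continuousOn hinv).mul
        (h.continuousOn.comp hinv hmaps)))
  · obtain ⟨C, hC⟩ := h.bound
    refine ⟨2 * C, fun u hu => ?_⟩
    have hu' : u ≠ 0 := ne_of_gt hu
    have hb := hC u⁻¹ (inv_pos.2 hu)
    have hn : ‖g u⁻¹ + ((u⁻¹ : ℝ) : ℂ) * g' u⁻¹‖ ≤ ‖g u⁻¹‖ + u⁻¹ * ‖g' u⁻¹‖ := by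
      refine (norm_add_le _ _).trans_eq ?_
      rw [norm_mul, norm_real, Real.norm_of_nonneg (by positivity)]
    have e : u⁻¹ * (C / (u⁻¹ ^ (-ε) + u⁻¹ ^ (1 + ε))) = C / (u ^ (-ε) + u ^ (1 + ε)) := by
      have h1 : u⁻¹ ^ (-ε) = u ^ ε := by rw [Real.inv_rpow hu.le, Real.rpow_neg hu.le, inv_inv]
      have h2 : u⁻¹ ^ (1 + ε) = u⁻¹ * u ^ (-ε) := by
        rw [Real.inv_rpow hu.le, Real.rpow_add hu, Real.rpow_one, mul_inv, Real.rpow_neg hu.le]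
      rw [h1, h2, Real.rpow_add hu, Real.rpow_one]
      field_simp
      ring
    rw [mul_div_assoc, two_mul, ← e]
    simp only [_root_.transp, norm_mul, norm_neg, norm_real, norm_pow, Real.norm_eq_abs,
      abs_of_pos (inv_pos.2 hu)]
    have hui := inv_pos.2 hu
    refine add_le_add ?_ ?_
    · gcongr
      exact le_trans (by have : 0 ≤ u⁻¹ * ‖g' u⁻¹‖ := by positivity
                         linarith) hb
    · rw [pow_two, mul_assoc, ← mul_assoc u, mul_inv_cancel₀ hu', one_mul]
      gcongr
      exact hn.trans hb

end HasDecay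

namespace HasDecay

variable {ε c : ℝ} {g g' : ℝ → ℂ}

theorem continuousOn_Ioi (h : HasDecay ε g g') : ContinuousOn g (Ioi 0) := fun u hu =>
  (h.hasDerivAt u hu).continuousAt.continuousWithinAt

theorem isBigO_atTop (h : HasDecay ε g g') : g =O[atTop] fun u => u ^ (-(1 + ε)) := by
  obtain ⟨C, -, hC⟩ := h.exists_bound
  refine Asymptotics.IsBigO.of_bound C ?_
  filter_upwards [eventually_gt_atTop 0] with u hu
  rw [Real.norm_of_nonneg (by positivity)]
  exact (le_add_of_nonneg_right (by positivity)).trans (hC u hu).2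

theorem isBigO_zero (h : HasDecay ε g g') : g =O[nhdsWithin 0 (Ioi 0)] fun u => u ^ (-(-ε)) := by
  obtain ⟨C, -, hC⟩ := h.exists_bound
  refine Asymptotics.IsBigO.of_bound C ?_
  filter_upwards [self_mem_nhdsWithin] with u hu
  have hu : 0 < u := hu
  rw [Real.norm_of_nonneg (by positivity), neg_neg]
  exact (le_add_of_nonneg_right (by positivity)).trans (hC u hu).1

theorem mellinConvergent (h : HasDecay ε g g') (hε : 0 < ε) {s : ℂ} (hs0 : 0 ≤ s.re)
    (hs1 : s.re ≤ 1) : MellinConvergent g s :=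
  mellinConvergent_of_isBigO_rpow (h.continuousOn_Ioi.locallyIntegrableOn measurableSet_Ioi)
    h.isBigO_atTop (by linarith) h.isBigO_zero (by linarith)

/-- The Mellin transform is integrable on vertical lines in the critical strip, with some room. -/
theorem integrable_rpow_mul_norm_mellin (h : HasDecay ε g g') (hε : 0 < ε) (hc0 : 0 < c)
    (hc1 : c < 1) :
    Integrable fun t : ℝ => (1 + |t|) ^ (1 / 4 : ℝ) * ‖mellin g (c + t * I)‖ := by
  obtain ⟨C, hC0, hC⟩ := h.exists_bound
  set f : ℝ → ℂ := fun v => Real.exp (-c * v) • g (Real.exp (-v)) with hf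
  set k : ℝ → ℂ := fun v => Real.exp (-c * v) • (Real.exp (-v) • g' (Real.exp (-v))) with hk
  have hf' : ∀ v, HasDerivAt f (-(c * f v + k v)) v := fun v => by
    have h1 : HasDerivAt (fun v : ℝ => Real.exp (-v)) (-Real.exp (-v)) v := by
      simpa using (hasDerivAt_neg v).exp
    have h2 : HasDerivAt (fun v : ℝ => Real.exp (-c * v)) (-c * Real.exp (-c * v)) v := by
      simpa [mul_comm] using ((hasDerivAt_id v).const_mul (-c)).exp
    refine (h2.smul ((h.hasDerivAt _ (Real.exp_pos (-v))).scomp v h1)).congr_deriv ?_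
    simp only [hf, hk, real_smul, Function.comp_apply]
    push_cast
    ring
  have hfd : Differentiable ℝ f := fun v => (hf' v).differentiableAt
  have hkc : Continuous k := by
    have hcomp : Continuous fun v : ℝ => g' (Real.exp (-v)) :=
      h.continuousOn.comp_continuous (by fun_prop) fun v => Real.exp_pos _
    have hexp : Continuous fun v : ℝ => Real.exp (-c * v) := by fun_prop
    have hexp' : Continuous fun v : ℝ => Real.exp (-v) := by fun_prop
    exact hexp.smul (hexp'.smul hcomp)
  have hb : ∀ v, ‖f v‖ + ‖k v‖ ≤ C * Real.exp (-ε * |v|) := fun v => by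
    have e : ‖f v‖ + ‖k v‖ = Real.exp (-c * v) *
        (‖g (Real.exp (-v))‖ + Real.exp (-v) * ‖g' (Real.exp (-v))‖) := by
      simp only [hf, hk, norm_smul, Real.norm_eq_abs, Real.abs_exp]
      ring
    rw [e]
    have hv := hC (Real.exp (-v)) (Real.exp_pos _)
    rw [← Real.exp_mul, ← Real.exp_mul] at hv
    rcases le_total 0 v with h0 | h0
    · calc _ ≤ Real.exp (-c * v) * (C * Real.exp (-v * ε)) := by gcongr; exact hv.1
        _ = C * Real.exp (-c * v + -v * ε) := by rw [Real.exp_add]; ring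
        _ ≤ _ := by
          rw [abs_of_nonneg h0]
          gcongr
          nlinarith
    · calc _ ≤ Real.exp (-c * v) * (C * Real.exp (-v * -(1 + ε))) := by gcongr; exact hv.2
        _ = C * Real.exp (-c * v + -v * -(1 + ε)) := by rw [Real.exp_add]; ring
        _ ≤ _ := by
          rw [abs_of_nonpos h0]
          gcongr
          nlinarith
  obtain ⟨f1, f2⟩ := integrable_and_memLp_two_of_exp_decay hfd.continuous hε
    fun v => (le_add_of_nonneg_right (norm_nonneg (k v))).trans (hb v)
  obtain ⟨k1, k2⟩ := integrable_and_memLp_two_of_exp_decay hkc hε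
    fun v => (le_add_of_nonneg_left (norm_nonneg (f v))).trans (hb v)
  have hd : deriv f = fun v => -(c * f v + k v) := funext fun v => (hf' v).deriv
  have d1 : Integrable (deriv f) := hd ▸ ((f1.const_mul _).add k1).neg
  have d2 : MemLp (deriv f) 2 := hd ▸ ((f2.const_mul _).add k2).neg
  refine (integrable_rpow_mul_norm_fourier hfd f1 f2 d1 d2).congr (ae_of_all _ fun t => ?_)
  simp [mellin_eq_fourier, hf]

theorem continuous_mellin (h : HasDecay ε g g') (hε : 0 < ε) (hc0 : 0 < c)
    (hc1 : c < 1) : Continuous fun t : ℝ => mellin g (c + t * I) := by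
  refine continuous_iff_continuousAt.2 fun t => ?_
  have hd : DifferentiableAt ℂ (mellin g) (c + t * I) :=
    mellin_differentiableAt_of_isBigO_rpow
      (h.continuousOn_Ioi.locallyIntegrableOn measurableSet_Ioi)
      h.isBigO_atTop (by simp; linarith) h.isBigO_zero (by simp; linarith)
  exact ContinuousAt.comp (f := fun t : ℝ => (c + t * I : ℂ)) hd.continuousAt (by fun_prop)

end HasDecay

theorem mellin_transp (g : ℝ → ℂ) (s : ℂ) : mellin (transp g) s = mellin g (1 - s) := by
  rw [show 1 - s = -(s + -1) by ring, ← mellin_comp_inv, ← mellin_cpow_smul]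
  simp [transp, mellin, cpow_neg_one]

/-- The difference between `exp (-x)` and its approximation `(1 - x / n) ^ n` on `(0, n]`. -/
noncomputable def expNegDefect (n : ℕ) (x : ℝ) : ℝ :=
  Real.exp (-x) - (Ioc 0 (n : ℝ)).indicator (fun x => (1 - x / n) ^ n) x

theorem expNegDefect_nonneg (n : ℕ) (x : ℝ) : 0 ≤ expNegDefect n x := by
  rw [expNegDefect, sub_nonneg]
  refine indicator_apply_le' (fun hx => Real.one_sub_div_pow_le_exp_neg hx.2) fun _ => by positivity

theorem expNegDefect_le (n : ℕ) (x : ℝ) : expNegDefect n x ≤ Real.exp (-x) := by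
  rw [expNegDefect, sub_le_self_iff]
  refine indicator_nonneg (fun y hy => pow_nonneg (sub_nonneg.2 ?_) _) _
  exact div_le_one_of_le₀ hy.2 (by positivity)

theorem measurable_expNegDefect (n : ℕ) : Measurable (expNegDefect n) :=
  (by fun_prop : Measurable fun x : ℝ => Real.exp (-x)).sub
    ((by fun_prop : Measurable fun x : ℝ => (1 - x / n) ^ n).indicator measurableSet_Ioc)

theorem integrableOn_expNegDefect_mul_rpow (n : ℕ) {a : ℝ} (ha : 0 < a) :
    IntegrableOn (fun x => expNegDefect n x * x ^ (a - 1)) (Ioi 0) := by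
  refine (Real.GammaIntegral_convergent ha).mono'
    ((measurable_expNegDefect n).mul (by fun_prop)).aestronglyMeasurable ?_
  filter_upwards [ae_restrict_mem measurableSet_Ioi] with x hx
  have hx : 0 < x := hx
  rw [norm_mul, Real.norm_of_nonneg (expNegDefect_nonneg n x), Real.norm_of_nonneg (by positivity)]
  gcongr
  exact expNegDefect_le n x

theorem integral_expNegDefect_mul_cpow {n : ℕ} (hn : n ≠ 0) {s : ℂ} (hs : 0 < s.re) :
    ∫ x in Ioi (0 : ℝ), (expNegDefect n x : ℂ) * (x : ℂ) ^ (s - 1) = Gamma s - GammaSeq s n := by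
  have hi : IntegrableOn (fun x : ℝ => ((1 - x / n) ^ n : ℝ) * (x : ℂ) ^ (s - 1))
      (Ioc 0 (n : ℝ)) := by
    rw [← intervalIntegrable_iff_integrableOn_Ioc_of_le (by positivity : (0 : ℝ) ≤ n)]
    apply IntervalIntegrable.continuousOn_mul
    · refine intervalIntegral.intervalIntegrable_cpow' ?_
      rwa [sub_re, one_re, ← zero_sub, sub_lt_sub_iff_right]
    · fun_prop
  have hsub : Ioc 0 (n : ℝ) ∩ Ioi 0 = Ioc 0 (n : ℝ) := inter_eq_left.2 Ioc_subset_Ioi_self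
  rw [Gamma_eq_integral hs, GammaSeq_eq_approx_Gamma_integral hs hn, GammaIntegral,
    intervalIntegral.integral_of_le (by positivity : (0 : ℝ) ≤ n), ← hsub,
    ← Measure.restrict_restrict measurableSet_Ioc,
    ← MeasureTheory.integral_indicator measurableSet_Ioc,
    ← MeasureTheory.integral_sub (GammaIntegral_convergent hs)]
  · refine setIntegral_congr_fun measurableSet_Ioi fun x hx => ?_
    by_cases hxn : x ∈ Ioc 0 (n : ℝ)
    · simp only [expNegDefect, indicator_of_mem hxn]
      push_cast
      ring
    · simp only [expNegDefect, indicator_of_notMem hxn, sub_zero]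
  · rwa [integrable_indicator_iff measurableSet_Ioc, IntegrableOn,
      Measure.restrict_restrict measurableSet_Ioc, hsub]

theorem norm_Gamma_sub_GammaSeq_le {n : ℕ} (hn : n ≠ 0) {s : ℂ} {a b : ℝ} (ha : 0 < a)
    (has : a ≤ s.re) (hsb : s.re ≤ b) :
    ‖Gamma s - GammaSeq s n‖ ≤ ‖Gamma a - GammaSeq a n‖ + ‖Gamma b - GammaSeq b n‖ := by
  have hs : 0 < s.re := ha.trans_le has
  have hb : 0 < b := hs.trans_le hsb
  have hreal : ∀ {r : ℝ}, 0 < r →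
      ∫ x in Ioi (0 : ℝ), expNegDefect n x * x ^ (r - 1) ≤ ‖Gamma r - GammaSeq r n‖ := by
    intro r hr
    rw [← integral_expNegDefect_mul_cpow hn (by simpa using hr)]
    have : ∫ x in Ioi (0 : ℝ), (expNegDefect n x : ℂ) * (x : ℂ) ^ ((r : ℂ) - 1) =
        ((∫ x in Ioi (0 : ℝ), expNegDefect n x * x ^ (r - 1) : ℝ) : ℂ) := by
      rw [← integral_complex_ofReal]
      refine setIntegral_congr_fun measurableSet_Ioi fun x hx => ?_
      rw [ofReal_mul, ofReal_cpow (le_of_lt hx), ofReal_sub, ofReal_one]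
    rw [this, norm_real]
    exact le_abs_self _
  refine le_trans ?_ (add_le_add (hreal ha) (hreal hb))
  rw [← integral_expNegDefect_mul_cpow hn hs, ← MeasureTheory.integral_add
    (integrableOn_expNegDefect_mul_rpow n ha) (integrableOn_expNegDefect_mul_rpow n hb)]
  refine norm_integral_le_of_norm_le ((integrableOn_expNegDefect_mul_rpow n ha).add
    (integrableOn_expNegDefect_mul_rpow n hb)) ?_
  filter_upwards [ae_restrict_mem measurableSet_Ioi] with x hx
  have hx : 0 < x := hx
  have h0 := expNegDefect_nonneg n x
  rw [norm_mul, norm_real, Real.norm_of_nonneg h0, norm_cpow_eq_rpow_re_of_pos hx, ← mul_add]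
  gcongr
  rw [sub_re, one_re]
  have ha' : 0 < x ^ (a - 1) := by positivity
  have hb' : 0 < x ^ (b - 1) := by positivity
  rcases le_total x 1 with h1 | h1
  · have := Real.rpow_le_rpow_of_exponent_ge hx h1 (show a - 1 ≤ s.re - 1 by linarith)
    linarith
  · have := Real.rpow_le_rpow_of_exponent_le h1 (show s.re - 1 ≤ b - 1 by linarith)
    linarith

theorem tendstoLocallyUniformlyOn_GammaSeq :
    TendstoLocallyUniformlyOn (fun n s => GammaSeq s n) Gamma atTop {s | 0 < s.re} := by
  rw [Metric.tendstoLocallyUniformlyOn_iff]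
  intro δ hδ s hs
  have hs : 0 < s.re := hs
  refine ⟨{z | s.re / 2 < z.re ∧ z.re < s.re + 1}, mem_nhdsWithin_of_mem_nhds ?_, ?_⟩
  · exact ((isOpen_lt continuous_const continuous_re).inter
      (isOpen_lt continuous_re continuous_const)).mem_nhds ⟨by simp; linarith, by simp⟩
  · have hlim : ∀ r : ℝ, Tendsto (fun n => ‖Gamma r - GammaSeq r n‖) atTop (nhds 0) := fun r => by
      have := (tendsto_const_nhds (x := Gamma r)).sub (GammaSeq_tendsto_Gamma r)
      simpa using this.norm
    have h2 := (hlim (s.re / 2)).add (hlim (s.re + 1))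
    rw [add_zero] at h2
    filter_upwards [h2.eventually (gt_mem_nhds hδ), eventually_ne_atTop 0] with n hn hn0 z hz
    rw [dist_eq_norm]
    exact (norm_Gamma_sub_GammaSeq_le hn0 (by linarith) hz.1.le hz.2.le).trans_lt hn

theorem add_natCast_ne_zero_of_re_pos {s : ℂ} (hs : 0 < s.re) (n : ℕ) : s + n ≠ 0 := fun h => by
  have := congrArg re h
  simp at this
  have h2 : (0 : ℝ) ≤ n := by positivity
  linarith

theorem logDeriv_GammaSeq {n : ℕ} (hn : n ≠ 0) {s : ℂ} (hs : 0 < s.re) :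
    logDeriv (fun z => GammaSeq z n) s = Real.log n - ∑ j ∈ Finset.range (n + 1), (s + j)⁻¹ := by
  have hn' : (n : ℂ) ≠ 0 := by exact_mod_cast hn
  have hprod : ∀ j ∈ Finset.range (n + 1), s + j ≠ 0 := fun j _ => add_natCast_ne_zero_of_re_pos hs j
  have hcpow : HasDerivAt (fun z : ℂ => (n : ℂ) ^ z) ((n : ℂ) ^ s * Complex.log n) s := by
    simpa using (hasDerivAt_id s).const_cpow (c := (n : ℂ)) (Or.inl hn')
  have hfac : (n.factorial : ℂ) ≠ 0 := by exact_mod_cast n.factorial_ne_zero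
  have hpow : (n : ℂ) ^ s ≠ 0 := by simp [cpow_eq_zero_iff, hn']
  simp only [GammaSeq]
  rw [logDeriv_div s (f := fun z : ℂ => (n : ℂ) ^ z * (n.factorial : ℂ))
      (g := fun z : ℂ => ∏ j ∈ Finset.range (n + 1), (z + j))
      (mul_ne_zero hpow hfac) (Finset.prod_ne_zero_iff.2 hprod)
      (hcpow.differentiableAt.mul_const _) (by fun_prop),
    logDeriv_mul_const s _ hfac, logDeriv_apply, hcpow.deriv, mul_div_cancel_left₀ _ hpow]
  rw [logDeriv_prod hprod (by fun_prop), Complex.natCast_log]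
  congr 1
  refine Finset.sum_congr rfl fun j _ => ?_
  simp [logDeriv_apply]

/-- The partial fraction expansion of the digamma function on the right half-plane. -/
theorem tendsto_sum_digamma {s : ℂ} (hs : 0 < s.re) :
    Tendsto (fun n : ℕ => ∑ j ∈ Finset.range n, (((j : ℂ) + 1)⁻¹ - (s + j)⁻¹)) atTop
      (nhds (digamma s + Real.eulerMascheroniConstant)) := by
  have hopen : IsOpen {z : ℂ | 0 < z.re} := isOpen_lt continuous_const continuous_re
  have hdiff : ∀ n : ℕ, n ≠ 0 → DifferentiableOn ℂ (fun z => GammaSeq z n) {z | 0 < z.re} := by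
    intro n hn z hz
    have hn' : (n : ℂ) ≠ 0 := by exact_mod_cast hn
    refine (DifferentiableAt.div ?_ (by fun_prop) ?_).differentiableWithinAt
    · exact ((differentiableAt_id).const_cpow (Or.inl hn')).mul_const _
    · exact Finset.prod_ne_zero_iff.2 fun j _ => add_natCast_ne_zero_of_re_pos hz j
  have hd := (tendstoLocallyUniformlyOn_GammaSeq.deriv
    (by filter_upwards [eventually_ne_atTop 0] with n hn using hdiff n hn) hopen).tendsto_at hs
  have hl := hd.div (GammaSeq_tendsto_Gamma s) (Gamma_ne_zero_of_re_pos hs)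
  have hl' : Tendsto (fun n : ℕ => (Real.log n : ℂ) - ∑ j ∈ Finset.range (n + 1), (s + j)⁻¹) atTop
      (nhds (digamma s)) := by
    refine hl.congr' ?_
    filter_upwards [eventually_ne_atTop 0] with n hn
    rw [← logDeriv_GammaSeq hn hs]
    rfl
  have hh : Tendsto (fun n : ℕ => (((harmonic n : ℚ) : ℝ) - Real.log n + (1 / ((n : ℝ) + 1)))) atTop
      (nhds (Real.eulerMascheroniConstant + 0)) :=
    Real.tendsto_harmonic_sub_log.add tendsto_one_div_add_atTop_nhds_zero_nat
  rw [add_zero] at hh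
  rw [← tendsto_add_atTop_iff_nat 1]
  refine (hl'.add ((continuous_ofReal.tendsto _).comp hh)).congr fun n => ?_
  rw [Finset.sum_sub_distrib, Finset.sum_range_succ (fun j : ℕ => ((j : ℂ) + 1)⁻¹)]
  simp only [Function.comp_apply, harmonic]
  push_cast
  ring

theorem neg_deriv_Lr_div {s : ℂ} (hs : 0 < s.re) :
    -(deriv Lr s / Lr s) = (Real.log π : ℂ) / 2 - digamma (s / 2) / 2 := by
  have hπ : (π : ℂ) ≠ 0 := by exact_mod_cast Real.pi_ne_zero
  have hs2 : 0 < (s / 2).re := by simpa using hs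
  have hG : DifferentiableAt ℂ Gamma (s / 2) :=
    differentiableAt_Gamma _ fun m h => add_natCast_ne_zero_of_re_pos hs2 m (by rw [h]; ring)
  have h1 : HasDerivAt (fun z : ℂ => (π : ℂ) ^ (-z / 2))
      ((π : ℂ) ^ (-s / 2) * Complex.log π * (-1 / 2)) s :=
    ((hasDerivAt_neg s).div_const 2).const_cpow (Or.inl hπ)
  have h2 : HasDerivAt (fun z : ℂ => Gamma (z / 2)) (deriv Gamma (s / 2) * (1 / 2)) s :=
    HasDerivAt.comp s hG.hasDerivAt ((hasDerivAt_id s).div_const 2)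
  have h3 : HasDerivAt Lr _ s := h1.mul h2
  have hG0 := Gamma_ne_zero_of_re_pos hs2
  have hp0 : (π : ℂ) ^ (-s / 2) ≠ 0 := by simp [cpow_eq_zero_iff, hπ]
  rw [h3.deriv, Lr, digamma_def, logDeriv_apply, ofReal_log Real.pi_pos.le]
  field_simp
  ring

/-- The `n`-th term of the partial fraction expansion of `-L_r' / L_r`. -/
noncomputable def LrTerm (n : ℕ) (s : ℂ) : ℂ := (s + 2 * n)⁻¹ - (2 * (n : ℂ) + 2)⁻¹

theorem tendsto_sum_LrTerm {s : ℂ} (hs : 0 < s.re) :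
    Tendsto (fun N : ℕ => ∑ n ∈ Finset.range N, LrTerm n s) atTop
      (nhds (-(deriv Lr s / Lr s) -
        (((Real.log π + Real.eulerMascheroniConstant) / 2 : ℝ) : ℂ))) := by
  have hs2 : 0 < (s / 2).re := by simpa using hs
  have h := (tendsto_sum_digamma hs2).mul_const (-(1 / 2) : ℂ)
  rw [neg_deriv_Lr_div hs]
  convert h using 2
  · rw [Finset.sum_mul]
    refine Finset.sum_congr rfl fun n _ => ?_
    have e1 : s + 2 * n = 2 * (s / 2 + n) := by ring
    have e2 : (2 * n + 2 : ℂ) = 2 * (n + 1) := by ring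
    rw [LrTerm, e1, e2, mul_inv, mul_inv]
    ring
  · push_cast
    ring

theorem norm_LrTerm_le {c : ℝ} (hc0 : 0 < c) (hc1 : c < 1) (n : ℕ) (t : ℝ) :
    ‖LrTerm n (c + t * I)‖ ≤
      2 / c * (1 / ((n : ℝ) + 1) ^ (5 / 4 : ℝ)) * (1 + |t|) ^ (1 / 4 : ℝ) := by
  set s : ℂ := c + t * I with hs
  have hsre : s.re = c := by simp [hs]
  have hn : (0 : ℝ) ≤ n := by positivity
  have hn1 : (0 : ℝ) < n + 1 := by positivity
  have hA : c * (n + 1) ≤ ‖s + 2 * n‖ := by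
    refine le_trans ?_ (re_le_norm _)
    simp [hs]
    nlinarith
  have hA0 : 0 < ‖s + 2 * n‖ := lt_of_lt_of_le (by positivity) hA
  have hB : ‖(2 * n + 2 : ℂ)‖ = 2 * (n + 1) := by
    rw [show (2 * n + 2 : ℂ) = ((2 * (n + 1) : ℝ) : ℂ) by push_cast; ring, norm_real,
      Real.norm_of_nonneg (by positivity)]
  have hs0 : s + 2 * n ≠ 0 := norm_pos_iff.1 hA0
  have hB0 : (2 * n + 2 : ℂ) ≠ 0 := norm_pos_iff.1 (by rw [hB]; positivity)
  have hinv : ‖s + 2 * n‖⁻¹ ≤ 1 / c * (1 / (n + 1)) := by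
    rw [one_div_mul_one_div, ← one_div]
    exact one_div_le_one_div_of_le (by positivity) hA
  have hc1' : 1 ≤ 1 / c := by rw [le_div_iff₀ hc0]; linarith
  have h1 : ‖LrTerm n s‖ ≤ 2 / c * (1 / (n + 1)) := by
    have e := norm_sub_le (s + 2 * n)⁻¹ (2 * n + 2 : ℂ)⁻¹
    rw [norm_inv, norm_inv, hB] at e
    have e2 : (2 * ((n : ℝ) + 1))⁻¹ ≤ 1 / c * (1 / (n + 1)) := by
      rw [mul_inv, one_div ((n : ℝ) + 1)]
      gcongr
      linarith
    rw [LrTerm]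
    calc _ ≤ ‖s + 2 * n‖⁻¹ + (2 * ((n : ℝ) + 1))⁻¹ := e
      _ ≤ 1 / c * (1 / ((n : ℝ) + 1)) + 1 / c * (1 / (n + 1)) := add_le_add hinv e2
      _ = _ := by ring
  have h2 : ‖LrTerm n s‖ ≤ 2 / c * (1 / (n + 1)) * ((1 + |t|) / (n + 1)) := by
    have e : LrTerm n s = (2 - s) * (s + 2 * n)⁻¹ * (2 * n + 2 : ℂ)⁻¹ := by
      rw [LrTerm]
      field_simp
      ring
    have e2 : ‖2 - s‖ ≤ 2 * (1 + |t|) := by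
      have : 2 - s = ((2 - c : ℝ) : ℂ) - t * I := by rw [hs]; push_cast; ring
      rw [this]
      refine (norm_sub_le _ _).trans ?_
      rw [norm_mul, norm_I, norm_real, norm_real, Real.norm_eq_abs, Real.norm_eq_abs,
        abs_of_pos (by linarith)]
      linarith [abs_nonneg t]
    rw [e, norm_mul, norm_mul, norm_inv, norm_inv, hB]
    calc _ ≤ 2 * (1 + |t|) * (1 / c * (1 / (n + 1))) * (2 * (n + 1 : ℝ))⁻¹ := by gcongr
      _ = 1 / c * (1 / (n + 1)) * ((1 + |t|) / (n + 1)) := by field_simp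
      _ ≤ _ := by gcongr; norm_num
  set Y : ℝ := (1 + |t|) / (n + 1) with hY
  have hY0 : 0 < Y := by positivity
  have h3 : ‖LrTerm n s‖ ≤ 2 / c * (1 / (n + 1)) * Y ^ (1 / 4 : ℝ) := by
    rcases le_total Y 1 with h | h
    · refine h2.trans ?_
      gcongr
      simpa using Real.rpow_le_rpow_of_exponent_ge hY0 h (show (1 / 4 : ℝ) ≤ 1 by norm_num)
    · refine h1.trans (le_mul_of_one_le_right (by positivity) ?_)
      exact Real.one_le_rpow h (by norm_num)
  refine h3.trans_eq ?_
  rw [hY, Real.div_rpow (by positivity) hn1.le,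
    show (5 / 4 : ℝ) = 1 + 1 / 4 by norm_num, Real.rpow_add hn1, Real.rpow_one]
  field_simp

theorem summable_LrTerm_majorant (c : ℝ) :
    Summable fun n : ℕ => 2 / c * (1 / ((n : ℝ) + 1) ^ (5 / 4 : ℝ)) := by
  refine Summable.mul_left _ ?_
  have := (summable_nat_add_iff 1).2
    (Real.summable_one_div_nat_rpow (p := 5 / 4) |>.2 (by norm_num))
  simpa using this

theorem hasSum_LrTerm {c : ℝ} (hc0 : 0 < c) (hc1 : c < 1) (t : ℝ) :
    HasSum (fun n => LrTerm n (c + t * I)) (-(deriv Lr (c + t * I) / Lr (c + t * I)) -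
        (((Real.log π + Real.eulerMascheroniConstant) / 2 : ℝ) : ℂ)) := by
  have hsum : Summable fun n => LrTerm n (c + t * I) :=
    Summable.of_norm_bounded ((summable_LrTerm_majorant c).mul_right _)
      fun n => norm_LrTerm_le hc0 hc1 n t
  exact (hsum.hasSum_iff_tendsto_nat).2 (tendsto_sum_LrTerm (by simpa using hc0))

theorem integrableOn_and_integral_Ioi_one_inv_pow (n : ℕ) :
    IntegrableOn (fun x : ℝ => (x ^ (2 * (n + 1) + 1))⁻¹) (Ioi 1) ∧
      ∫ x in Ioi (1 : ℝ), (x ^ (2 * (n + 1) + 1))⁻¹ = (2 * (n : ℝ) + 2)⁻¹ := by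
  have hn : (0 : ℝ) ≤ n := by positivity
  set a : ℝ := -(2 * n + 3) with ha
  have hcongr : EqOn (fun x : ℝ => x ^ a) (fun x : ℝ => (x ^ (2 * (n + 1) + 1))⁻¹) (Ioi 1) := by
    intro x hx
    have hx : 0 < x := one_pos.trans hx
    simp only [ha]
    rw [Real.rpow_neg hx.le, ← Real.rpow_natCast]
    congr 2
    push_cast
    ring
  refine ⟨(integrableOn_Ioi_rpow_of_lt (by rw [ha]; linarith) one_pos).congr_fun hcongr
    measurableSet_Ioi, ?_⟩
  rw [← setIntegral_congr_fun measurableSet_Ioi hcongr,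
    integral_Ioi_rpow_of_lt (by rw [ha]; linarith) one_pos, Real.one_rpow, neg_div, ← one_div,
    ← div_neg]
  congr 1
  rw [ha]
  ring

theorem hasSum_inv_pow {x : ℝ} (hx : 1 < x) :
    HasSum (fun n : ℕ => (x ^ (2 * (n + 1) + 1))⁻¹) (((x ^ 2 - 1) * x)⁻¹) := by
  have hx0 : 0 < x := one_pos.trans hx
  have hx2 : 1 < x ^ 2 := one_lt_pow₀ hx two_ne_zero
  have h := (hasSum_geometric_of_lt_one (r := (x ^ 2)⁻¹) (by positivity)
    (inv_lt_one_of_one_lt₀ hx2)).mul_left (x ^ 3)⁻¹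
  have e : (x ^ 3)⁻¹ * (1 - (x ^ 2)⁻¹)⁻¹ = ((x ^ 2 - 1) * x)⁻¹ := by
    rw [← mul_inv, show x ^ 3 * (1 - (x ^ 2)⁻¹) = (x ^ 2 - 1) * x by field_simp]
  rw [e] at h
  refine h.congr_fun fun n => ?_
  rw [inv_pow, ← mul_inv, ← pow_mul]
  ring_nf

namespace HasDecay

variable {ε c : ℝ} {g g' : ℝ → ℂ}

theorem integrableOn_and_tendsto_integral_inv_pow_smul (h : HasDecay ε g g') (hε : 0 < ε) :
    (∀ n : ℕ, IntegrableOn (fun x : ℝ => (x ^ (2 * n + 1))⁻¹ • g x) (Ioi 1)) ∧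
    Tendsto (fun n : ℕ => ∫ x in Ioi (1 : ℝ), (x ^ (2 * n + 1))⁻¹ • g x) atTop (nhds 0) := by
  obtain ⟨C, hC0, hC⟩ := h.exists_bound
  have hb : IntegrableOn (fun x : ℝ => C * x ^ (-(1 + ε))) (Ioi 1) :=
    (integrableOn_Ioi_rpow_of_lt (by linarith) one_pos).const_mul C
  have hm : ∀ n : ℕ, AEStronglyMeasurable (fun x : ℝ => (x ^ (2 * n + 1))⁻¹ • g x)
      (volume.restrict (Ioi 1)) := fun n => by
    refine ContinuousOn.aestronglyMeasurable (ContinuousOn.fun_smul ?_ ?_) measurableSet_Ioi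
    · exact ContinuousOn.fun_inv₀ (continuousOn_pow _) fun x hx =>
        (pow_pos (one_pos.trans hx) _).ne'
    · exact h.continuousOn_Ioi.mono (Ioi_subset_Ioi zero_le_one)
  have hle : ∀ n : ℕ, ∀ᵐ x ∂(volume.restrict (Ioi (1 : ℝ))),
      ‖(x ^ (2 * n + 1))⁻¹ • g x‖ ≤ C * x ^ (-(1 + ε)) := fun n => by
    filter_upwards [ae_restrict_mem measurableSet_Ioi] with x hx
    have hx0 : 0 < x := one_pos.trans hx
    rw [norm_smul, Real.norm_of_nonneg (by positivity)]
    have h1 : (x ^ (2 * n + 1))⁻¹ ≤ 1 := inv_le_one_of_one_le₀ (one_le_pow₀ (le_of_lt hx))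
    exact (mul_le_of_le_one_left (norm_nonneg _) h1).trans
      ((le_add_of_nonneg_right (by positivity)).trans (hC x hx0).2)
  refine ⟨fun n => hb.mono' (hm n) (hle n), ?_⟩
  rw [← MeasureTheory.integral_zero ℝ ℂ (μ := volume.restrict (Ioi (1 : ℝ)))]
  refine tendsto_integral_of_dominated_convergence _ hm hb hle ?_
  filter_upwards [ae_restrict_mem measurableSet_Ioi] with x hx
  have hx : 1 < x := hx
  have h1 : Tendsto (fun n : ℕ => 2 * n + 1) atTop atTop :=
    tendsto_atTop_mono (fun n => by simp only [id]; omega) tendsto_id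
  have h2 := ((tendsto_pow_atTop_atTop_of_one_lt hx).comp h1).inv_tendsto_atTop
  simpa using h2.smul_const (g x)

theorem exists_norm_sub_le (h : HasDecay ε g g') (hε : 0 < ε) :
    ∃ M : ℝ, ∀ x : ℝ, 1 < x → ‖g x - g 1‖ ≤ M * (x - 1) := by
  obtain ⟨C, hC0, hC⟩ := h.exists_bound
  refine ⟨C, fun x hx => ?_⟩
  have hb : ∀ y ∈ Ici (1 : ℝ), ‖g' y‖ ≤ C := fun y hy => by
    have hy : 1 ≤ y := hy
    have hy0 : 0 < y := one_pos.trans_le hy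
    have h1 := (hC y hy0).2
    have h2 : y ^ (-(1 + ε)) ≤ 1 := Real.rpow_le_one_of_one_le_of_nonpos hy (by linarith)
    have h3 : 1 * ‖g' y‖ ≤ y * ‖g' y‖ := by gcongr
    have h4 : C * y ^ (-(1 + ε)) ≤ C := mul_le_of_le_one_right hC0 h2
    linarith [norm_nonneg (g y)]
  have := (convex_Ici (1 : ℝ)).norm_image_sub_le_of_norm_hasDerivWithin_le
    (fun y hy => (h.hasDerivAt y (one_pos.trans_le (mem_Ici.1 hy))).hasDerivWithinAt) hb
    (mem_Ici.2 (le_refl (1 : ℝ))) (show x ∈ Ici (1 : ℝ) from hx.le)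
  rwa [Real.norm_of_nonneg (by linarith)] at this

theorem hasSum_integral_inv_pow_smul_sub (h : HasDecay ε g g') (hε : 0 < ε) :
    HasSum (fun n : ℕ => ∫ x in Ioi (1 : ℝ), (x ^ (2 * (n + 1) + 1))⁻¹ • (g x - g 1))
      (∫ x in Ioi (1 : ℝ), (g x - g 1) / (((x ^ 2 - 1) * x : ℝ) : ℂ)) := by
  obtain ⟨M, hM⟩ := h.exists_norm_sub_le hε
  have hsum : ∀ x : ℝ, 1 < x → HasSum (fun n : ℕ => (x ^ (2 * (n + 1) + 1))⁻¹ * (M * (x - 1)))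
      (((x ^ 2 - 1) * x)⁻¹ * (M * (x - 1))) := fun x hx => (hasSum_inv_pow hx).mul_right _
  refine hasSum_integral_of_dominated_convergence
    (fun n x => (x ^ (2 * (n + 1) + 1))⁻¹ * (M * (x - 1))) (fun n => ?_) (fun n => ?_) ?_ ?_ ?_
  · refine ContinuousOn.aestronglyMeasurable (ContinuousOn.fun_smul ?_ ?_) measurableSet_Ioi
    · exact ContinuousOn.fun_inv₀ (continuousOn_pow _) fun x hx =>
        (pow_pos (one_pos.trans hx) _).ne'
    · exact (h.continuousOn_Ioi.mono (Ioi_subset_Ioi zero_le_one)).sub continuousOn_const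
  · filter_upwards [ae_restrict_mem measurableSet_Ioi] with x hx
    have hx0 : 0 < x := one_pos.trans hx
    rw [norm_smul, Real.norm_of_nonneg (by positivity)]
    gcongr
    exact hM x hx
  · filter_upwards [ae_restrict_mem measurableSet_Ioi] with x hx using (hsum x hx).summable
  · have hi : IntegrableOn (fun x : ℝ => |M| * x ^ (-2 : ℝ)) (Ioi 1) :=
      (integrableOn_Ioi_rpow_of_lt (by norm_num) one_pos).const_mul _
    have hcont : ContinuousOn (fun x : ℝ => ((x ^ 2 - 1) * x)⁻¹ * (M * (x - 1))) (Ioi 1) := by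
      refine ContinuousOn.mul (ContinuousOn.inv₀ (by fun_prop) fun x hx => ?_) (by fun_prop)
      have hx : 1 < x := hx
      have : 0 < (x ^ 2 - 1) * x := mul_pos (by nlinarith) (by linarith)
      exact this.ne'
    refine (hi.mono' (hcont.aestronglyMeasurable measurableSet_Ioi) ?_).congr ?_
    · filter_upwards [ae_restrict_mem measurableSet_Ioi] with x hx
      have hx : 1 < x := hx
      have e : ((x ^ 2 - 1) * x)⁻¹ * (M * (x - 1)) = M * ((x + 1) * x)⁻¹ := by
        have h1 : x - 1 ≠ 0 := by linarith
        rw [show x ^ 2 - 1 = (x - 1) * (x + 1) by ring]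
        field_simp
      have hx0 : 0 < x := by linarith
      rw [e, norm_mul, Real.norm_eq_abs, Real.norm_of_nonneg (by positivity),
        Real.rpow_neg hx0.le, Real.rpow_two]
      gcongr
      nlinarith
    · filter_upwards [ae_restrict_mem measurableSet_Ioi] with x hx using (hsum x hx).tsum_eq.symm
  · filter_upwards [ae_restrict_mem measurableSet_Ioi] with x hx
    have e : (g x - g 1) / (((x ^ 2 - 1) * x : ℝ) : ℂ) = ((x ^ 2 - 1) * x)⁻¹ • (g x - g 1) := by
      rw [div_eq_inv_mul, real_smul, ofReal_inv]
    rw [e]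
    exact (hasSum_inv_pow hx).smul_const _

theorem tendsto_sum_integral_inv_pow_smul (h : HasDecay ε g g') (hε : 0 < ε) :
    Tendsto (fun N : ℕ => ∑ n ∈ Finset.range N,
        ((∫ x in Ioi (1 : ℝ), (x ^ (2 * n + 1))⁻¹ • g x) - (2 * (n : ℂ) + 2)⁻¹ * g 1))
      atTop (nhds ((∫ x in Ioi (1 : ℝ), g x / (x : ℂ)) +
        ∫ x in Ioi (1 : ℝ), (g x - g 1) / (((x ^ 2 - 1) * x : ℝ) : ℂ))) := by
  set A : ℕ → ℂ := fun n => ∫ x in Ioi (1 : ℝ), (x ^ (2 * n + 1))⁻¹ • g x with hA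
  have hd : ∀ n : ℕ, ∫ x in Ioi (1 : ℝ), (x ^ (2 * (n + 1) + 1))⁻¹ • (g x - g 1) =
      A (n + 1) - (2 * (n : ℂ) + 2)⁻¹ * g 1 := fun n => by
    obtain ⟨i1, i2⟩ := integrableOn_and_integral_Ioi_one_inv_pow n
    simp_rw [smul_sub]
    rw [MeasureTheory.integral_sub ((h.integrableOn_and_tendsto_integral_inv_pow_smul hε).1 (n + 1))
      (i1.smul_const (g 1)), _root_.integral_smul_const, i2, real_smul]
    push_cast
    rfl
  have hA0 : A 0 = ∫ x in Ioi (1 : ℝ), g x / (x : ℂ) := by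
    simp only [hA, real_smul, div_eq_inv_mul]
    simp
  have hlim : Tendsto (fun N => A 0 - A N) atTop (nhds (A 0 - 0)) :=
    tendsto_const_nhds.sub (h.integrableOn_and_tendsto_integral_inv_pow_smul hε).2
  rw [sub_zero] at hlim
  rw [← hA0]
  refine (hlim.add (h.hasSum_integral_inv_pow_smul_sub hε).tendsto_sum_nat).congr fun N => ?_
  rw [← Finset.sum_range_sub', ← Finset.sum_add_distrib]
  refine Finset.sum_congr rfl fun n _ => ?_
  rw [hd]
  ring

end HasDecay

namespace HasDecay

variable {ε c : ℝ} {g g' : ℝ → ℂ}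

theorem integrable_mellin (h : HasDecay ε g g') (hε : 0 < ε) (hc0 : 0 < c) (hc1 : c < 1) :
    Integrable fun t : ℝ => mellin g (c + t * I) := by
  refine (h.integrable_rpow_mul_norm_mellin hε hc0 hc1).mono'
    (h.continuous_mellin hε hc0 hc1).aestronglyMeasurable (ae_of_all _ fun t => ?_)
  exact le_mul_of_one_le_left (norm_nonneg _)
    (Real.one_le_rpow (by linarith [abs_nonneg t]) (by norm_num))

theorem integral_cpow_smul_mellin (h : HasDecay ε g g') (hε : 0 < ε) (hc0 : 0 < c) (hc1 : c < 1)
    {x : ℝ} (hx : 0 < x) :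
    ∫ t : ℝ, (x : ℂ) ^ (-(c + t * I : ℂ)) * mellin g (c + t * I) = 2 * π * g x := by
  have hinv := mellinInv_mellin_eq c g hx
    (h.mellinConvergent hε (by simpa using hc0.le) (by simpa using hc1.le))
    (h.integrable_mellin hε hc0 hc1) (h.hasDerivAt x hx).continuousAt
  rw [← hinv, mellinInv, real_smul]
  simp only [smul_eq_mul]
  push_cast
  rw [← mul_assoc, mul_one_div_cancel (by simp [Real.pi_ne_zero]), one_mul]

theorem integral_mellin (h : HasDecay ε g g') (hε : 0 < ε) (hc0 : 0 < c) (hc1 : c < 1) :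
    ∫ t : ℝ, mellin g (c + t * I) = 2 * π * g 1 := by
  simpa using h.integral_cpow_smul_mellin hε hc0 hc1 one_pos

theorem integral_inv_mul_mellin (h : HasDecay ε g g') (hε : 0 < ε) (hc0 : 0 < c) (hc1 : c < 1)
    (n : ℕ) :
    ∫ t : ℝ, (c + t * I + 2 * n : ℂ)⁻¹ * mellin g (c + t * I) =
      2 * π * ∫ x in Ioi (1 : ℝ), (x ^ (2 * n + 1))⁻¹ • g x := by
  have hn : (0 : ℝ) ≤ n := n.cast_nonneg
  have hlhs : ∀ t : ℝ, (c + t * I + 2 * n : ℂ)⁻¹ * mellin g (c + t * I) =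
      ∫ x in Ioi (1 : ℝ), (x : ℂ) ^ (-(c + t * I + 2 * n + 1 : ℂ)) * mellin g (c + t * I) :=
    fun t => by
      rw [MeasureTheory.integral_mul_const, integral_Ioi_cpow_of_lt _ one_pos]
      · simp only [ofReal_one, one_cpow, neg_div, ← one_div]
        rw [← div_neg]
        congr 3
        ring
      · simp
        linarith
  have hrhs : ∀ x ∈ Ioi (1 : ℝ),
      ∫ t : ℝ, (x : ℂ) ^ (-(c + t * I + 2 * n + 1 : ℂ)) * mellin g (c + t * I) =
        2 * π * ((x ^ (2 * n + 1))⁻¹ • g x) := fun x hx => by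
    have hx0 : 0 < x := one_pos.trans hx
    have hxc : (x : ℂ) ≠ 0 := ofReal_ne_zero.2 hx0.ne'
    have e : ∀ t : ℝ, (x : ℂ) ^ (-(c + t * I + 2 * n + 1 : ℂ)) * mellin g (c + t * I) =
        ((x : ℂ) ^ (2 * n + 1))⁻¹ * ((x : ℂ) ^ (-(c + t * I : ℂ)) * mellin g (c + t * I)) :=
      fun t => by
        rw [show (-(c + t * I + 2 * n + 1 : ℂ)) = -(c + t * I : ℂ) + -((2 * n + 1 : ℕ) : ℂ) by
          push_cast; ring, cpow_add _ _ hxc, cpow_neg _ ((2 * n + 1 : ℕ) : ℂ), cpow_natCast]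
        ring
    simp_rw [e]
    rw [MeasureTheory.integral_const_mul, h.integral_cpow_smul_mellin hε hc0 hc1 hx0, real_smul]
    push_cast
    ring
  have hint : Integrable (fun p : ℝ × ℝ =>
      (p.2 : ℂ) ^ (-(c + p.1 * I + 2 * n + 1 : ℂ)) * mellin g (c + p.1 * I))
      (volume.prod (volume.restrict (Ioi 1))) := by
    have hb : Integrable (fun p : ℝ × ℝ => mellin g (c + p.1 * I) * (p.2 ^ (-(c + 2 * n + 1)) : ℝ))
        (volume.prod (volume.restrict (Ioi 1))) :=
      (h.integrable_mellin hε hc0 hc1).mul_prod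
        (integrableOn_Ioi_rpow_of_lt (by linarith) one_pos).ofReal
    have hae : ∀ᵐ p : ℝ × ℝ ∂(volume.prod (volume.restrict (Ioi 1))), p.2 ∈ Ioi (1 : ℝ) :=
      Measure.quasiMeasurePreserving_snd.ae (ae_restrict_mem measurableSet_Ioi)
    refine hb.mono (AEStronglyMeasurable.mul (Measurable.aestronglyMeasurable (by fun_prop))
      ((h.continuous_mellin hε hc0 hc1).comp continuous_fst).aestronglyMeasurable) ?_
    filter_upwards [hae] with p hp
    have hp0 : 0 < p.2 := one_pos.trans hp
    rw [norm_mul, norm_mul, mul_comm, norm_cpow_eq_rpow_re_of_pos hp0, norm_real,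
      Real.norm_of_nonneg (by positivity)]
    simp
  simp_rw [hlhs]
  rw [integral_integral_swap hint, setIntegral_congr_fun measurableSet_Ioi hrhs,
    MeasureTheory.integral_const_mul]

/-- The archimedean integral over the whole vertical line converges absolutely, and its value is
the finite form of the archimedean term. -/
theorem integrable_and_integral_eq (h : HasDecay ε g g') (hε : 0 < ε) (hc0 : 0 < c)
    (hc1 : c < 1) :
    Integrable (fun t : ℝ => -(deriv Lr (c + t * I) / Lr (c + t * I)) * mellin g (c + t * I)) ∧
      ∫ t : ℝ, -(deriv Lr (c + t * I) / Lr (c + t * I)) * mellin g (c + t * I) =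
        2 * π * VrValue g := by
  set F : ℝ → ℂ := fun t => mellin g (c + t * I) with hF
  set k : ℂ := (((Real.log π + Real.eulerMascheroniConstant) / 2 : ℝ) : ℂ) with hk
  set Ψ : ℝ → ℂ := fun t => -(deriv Lr (c + t * I) / Lr (c + t * I)) with hΨ
  have hFi : Integrable F := h.integrable_mellin hε hc0 hc1
  have hW := h.integrable_rpow_mul_norm_mellin hε hc0 hc1
  have hLc : ∀ n : ℕ, Continuous fun t : ℝ => LrTerm n (c + t * I) := fun n => by
    unfold LrTerm
    refine (Continuous.inv₀ (by fun_prop) fun t h0 => ?_).sub continuous_const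
    have := congrArg re h0
    simp at this
    linarith [(n.cast_nonneg : (0 : ℝ) ≤ n)]
  have hterm : ∀ t : ℝ, HasSum (fun n => LrTerm n (c + t * I) * F t) ((Ψ t - k) * F t) := fun t =>
    (hasSum_LrTerm hc0 hc1 t).mul_right _
  have hle : ∀ (n : ℕ) (t : ℝ), ‖LrTerm n (c + t * I) * F t‖ ≤
      2 / c * (1 / ((n : ℝ) + 1) ^ (5 / 4 : ℝ)) * ((1 + |t|) ^ (1 / 4 : ℝ) * ‖F t‖) :=
    fun n t => by
      rw [norm_mul, ← mul_assoc]
      gcongr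
      exact norm_LrTerm_le hc0 hc1 n t
  have hmeas : ∀ n : ℕ, AEStronglyMeasurable (fun t : ℝ => LrTerm n (c + t * I) * F t) := fun n =>
    ((hLc n).mul (h.continuous_mellin hε hc0 hc1)).aestronglyMeasurable
  have hLi : ∀ n : ℕ, Integrable fun t : ℝ => LrTerm n (c + t * I) * F t := fun n =>
    (hW.const_mul _).mono' (hmeas n) (ae_of_all _ (hle n))
  have hinv : ∀ n : ℕ, Integrable fun t : ℝ => (c + t * I + 2 * n : ℂ)⁻¹ * F t := fun n => by
    refine ((hLi n).add (hFi.const_mul (2 * (n : ℂ) + 2)⁻¹)).congr (ae_of_all _ fun t => ?_)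
    simp only [LrTerm, Pi.add_apply]
    ring
  have hmaj := summable_LrTerm_majorant c
  have hbi : Integrable fun t => ∑' n : ℕ,
      2 / c * (1 / ((n : ℝ) + 1) ^ (5 / 4 : ℝ)) * ((1 + |t|) ^ (1 / 4 : ℝ) * ‖F t‖) := by
    simp_rw [tsum_mul_right]
    exact hW.const_mul _
  have hsum := hasSum_integral_of_dominated_convergence _ hmeas
    (fun n => ae_of_all _ (hle n)) (ae_of_all _ fun t => hmaj.mul_right _) hbi
    (ae_of_all _ hterm)
  have hdiff : Integrable fun t => (Ψ t - k) * F t := by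
    refine hbi.mono' (aestronglyMeasurable_of_tendsto_ae atTop
      (fun N => Finset.aestronglyMeasurable_fun_sum (Finset.range N) fun n _ => hmeas n)
      (ae_of_all _ fun t => (hterm t).tendsto_sum_nat)) (ae_of_all _ fun t => ?_)
    rw [← (hterm t).tsum_eq]
    exact tsum_of_norm_bounded (hmaj.mul_right _).hasSum fun n => hle n t
  have e : (fun t => Ψ t * F t) = fun t => (Ψ t - k) * F t + k * F t := by
    ext t
    ring
  have hval : ∀ n : ℕ, ∫ t : ℝ, LrTerm n (c + t * I) * F t =
      2 * π * ((∫ x in Ioi (1 : ℝ), (x ^ (2 * n + 1))⁻¹ • g x) - (2 * (n : ℂ) + 2)⁻¹ * g 1) :=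
    fun n => by
      simp_rw [LrTerm, sub_mul]
      rw [MeasureTheory.integral_sub (hinv n) (hFi.const_mul _),
        MeasureTheory.integral_const_mul, h.integral_inv_mul_mellin hε hc0 hc1,
        h.integral_mellin hε hc0 hc1]
      ring
  have hlim := (h.tendsto_sum_integral_inv_pow_smul hε).const_mul (2 * (π : ℂ))
  simp_rw [Finset.mul_sum, ← hval] at hlim
  have huniq := tendsto_nhds_unique hsum.tendsto_sum_nat hlim
  rw [e]
  refine ⟨hdiff.add (hFi.const_mul k), ?_⟩
  rw [MeasureTheory.integral_add hdiff (hFi.const_mul k), huniq, MeasureTheory.integral_const_mul,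
    h.integral_mellin hε hc0 hc1, VrValue]
  ring

theorem tendsto_Vint (h : HasDecay ε g g') (hε : 0 < ε) (hc0 : 0 < c) (hc1 : c < 1) :
    Tendsto (fun T : ℝ => Vint g c T) atTop (nhds (VrValue g)) := by
  obtain ⟨h1, h2⟩ := h.integrable_and_integral_eq hε hc0 hc1
  have h3 := (intervalIntegral_tendsto_integral h1 tendsto_neg_atTop_atBot tendsto_id).const_mul
    (1 / (2 * (π : ℂ)))
  have hpi : (π : ℂ) ≠ 0 := ofReal_ne_zero.2 Real.pi_ne_zero
  rw [h2, ← mul_assoc, one_div_mul_cancel (by simp [hpi]), one_mul] at h3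
  exact h3

end HasDecay

/-- If `g` has a continuous, locally bounded-variation derivative on `(0,∞)` with
`|g(u)| + |u·g'(u)| = O(1/(u^(-ε)+u^(1+ε)))`, then for `0 < c < 1` the limit `V_r(g)`
exists and is given by the finite form
`((log π + γ)/2)·g(1) + ∫₁^∞ g dt/t + ∫₁^∞ (g(t)-g(1))/(t²-1) dt/t`, and the limit
`W_r(g)` exists and equals `V_r(g) + V_r(g^τ)`. -/
theorem archimedean_term_finite_form
    (ε c : ℝ) (hε : 0 < ε) (hc0 : 0 < c) (hc1 : c < 1)
    (g g' : ℝ → ℂ)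
    (hderiv : ∀ u ∈ Ioi (0 : ℝ), HasDerivAt g (g' u) u)
    (hcont : ContinuousOn g' (Ioi 0))
    (hBV : LocallyBoundedVariationOn g' (Ioi 0))
    (hbound : ∃ C : ℝ, ∀ u : ℝ, 0 < u →
      ‖g u‖ + u * ‖g' u‖ ≤ C / (u ^ (-ε) + u ^ (1 + ε))) :
    Tendsto (fun T : ℝ => Vint g c T) atTop (nhds (VrValue g)) ∧
    Tendsto (fun T : ℝ => Vint (transp g) c T) atTop (nhds (VrValue (transp g))) ∧
    Tendsto
      (fun T : ℝ =>
        (1 / (2 * (π : ℂ))) *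
          ∫ t in (-T)..T,
            (-(deriv Lr (c + t * I) / Lr (c + t * I))) *
              (mellin g (c + t * I) + mellin g (1 - (c + t * I))))
      atTop (nhds (VrValue g + VrValue (transp g))) := by
  have h : HasDecay ε g g' := ⟨hderiv, hcont, hbound⟩
  have hV := h.tendsto_Vint hε hc0 hc1
  have hV' := h.transp.tendsto_Vint hε hc0 hc1
  refine ⟨hV, hV', (hV.add hV').congr fun T => ?_⟩
  have i := (h.integrable_and_integral_eq hε hc0 hc1).1
  have i' := (h.transp.integrable_and_integral_eq hε hc0 hc1).1
  simp_rw [← mellin_transp, mul_add]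
  rw [Vint, Vint, ← mul_add,
    intervalIntegral.integral_add i.intervalIntegrable i'.intervalIntegrable, mul_add]
end
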